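/- arXiv:2311.04041 — 6 statements merged into one kernel-verified Lean document; each statement's English description precedes it below -/
import Mathlib

section
/- Assume α(r) ≥ 2·μ(B_r^c) for all r ≥ m₁. Then for all g, g̃ in the set S₂ := {ĝ ∈ 𝓖^μ_{α,α̃} : ĝ ≥ 0 μ-a.s., ‖ĝ‖_{L¹(μ)} = 1}, one has ‖g − g̃‖_{L¹(μ)} ≤ 3·(exp(d_{𝓖^μ_{α,α̃}}(g, g̃)) − 1). -/
open MeasureTheory Metric Set Filter
open scoped ENNReal NNReal Topology

noncomputable section

namespace Paper

variable {X : Type*} [MeasurableSpace X] [MetricSpace X] [PolishSpace X] [BorelSpace X]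

/-- The cone of test functions `𝓕^μ_{α,α̃}` (as a subset of `L²(μ)`). -/
def Fcone (μ : Measure X) (x₀ : X) (m₁ m₂ : ℝ) (α αt : ℝ → ℝ) :
    Set (Lp ℝ 2 μ) :=
  {f | (∀ᵐ x ∂μ, x ∈ closedBall x₀ m₂ → 0 ≤ f x)
    ∧ (∀ r, m₁ ≤ r → ∫ x in (closedBall x₀ r)ᶜ, max (f x) 0 ∂μ ≤ α r * ∫ x, f x ∂μ)
    ∧ (∀ r, m₂ ≤ r → ∫ x in (closedBall x₀ r)ᶜ, max (-(f x)) 0 ∂μ ≤ αt r * ∫ x, f x ∂μ)}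

/-- The dual cone `𝓖^μ_{α,α̃}`. -/
def Gcone (μ : Measure X) (x₀ : X) (m₁ m₂ : ℝ) (α αt : ℝ → ℝ) :
    Set (Lp ℝ 2 μ) :=
  {g | ∀ f ∈ Fcone μ x₀ m₁ m₂ α αt, 0 ≤ ∫ x, f x * g x ∂μ}

/-- `M(f,g) = inf { b > 0 : b • g - f ∈ C }`. -/
def Msup {Y : Type*} [AddCommGroup Y] [Module ℝ Y] (C : Set Y) (f g : Y) : ℝ :=
  sInf {b : ℝ | 0 < b ∧ b • g - f ∈ C}

/-- `m(f,g) = sup { a > 0 : f - a • g ∈ C }`. -/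
def minf {Y : Type*} [AddCommGroup Y] [Module ℝ Y] (C : Set Y) (f g : Y) : ℝ :=
  sSup {a : ℝ | 0 < a ∧ f - a • g ∈ C}

/-- `f ∼_C g` : `a • g ≤_C f ≤_C b • g` for some `a, b > 0`. -/
def simC {Y : Type*} [AddCommGroup Y] [Module ℝ Y] (C : Set Y) (f g : Y) : Prop :=
  (∃ a : ℝ, 0 < a ∧ f - a • g ∈ C) ∧ (∃ b : ℝ, 0 < b ∧ b • g - f ∈ C)

open Classical in
/-- Hilbert's projective metric of the cone `C`, with value `∞` when `f ≁_C g` or `g = 0`. -/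
def hilbertD {Y : Type*} [AddCommGroup Y] [Module ℝ Y] (C : Set Y) (f g : Y) : ℝ≥0∞ :=
  if simC C f g ∧ g ≠ 0 then ENNReal.ofReal (Real.log (Msup C f g / minf C f g)) else ⊤

open Classical in
/-- `exp(x) - 1` on `[0,∞]`. -/
def expm1 (x : ℝ≥0∞) : ℝ≥0∞ :=
  if x = ⊤ then ⊤ else ENNReal.ofReal (Real.exp x.toReal - 1)

open Classical in
/-- extended-real logarithm on `[0,∞]`. -/
def elog (x : ℝ≥0∞) : EReal :=
  if x = 0 then ⊥ else if x = ⊤ then ⊤ else ((Real.log x.toReal : ℝ) : EReal)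

/-- tail function: non-increasing on `(0,∞)`, non-negative, tending to `0`. -/
def IsTail (α : ℝ → ℝ) : Prop :=
  (∀ r s : ℝ, 0 < r → r ≤ s → α s ≤ α r) ∧ (∀ r : ℝ, 0 < r → 0 ≤ α r) ∧
    Tendsto α atTop (𝓝 0)

/-- the kernel integral operator `L_{K,ρ}`. -/
def Lker (K : X → X → ℝ) (ρ : Measure X) (f : X → ℝ) : X → ℝ :=
  fun x => ∫ y, K x y * f y ∂ρ

/-- `l` is a lower decay of the kernel `K`. -/
def IsLowerDecay (K : X → X → ℝ) (x₀ : X) (l : ℝ → ℝ) : Prop :=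
  (∀ r s : ℝ, r ≤ s → l s ≤ l r) ∧
    ∀ r : ℝ, 0 < r → ∀ x ∈ closedBall x₀ r, ∀ y ∈ closedBall x₀ r, l r ≤ K x y

/-- `β̃(r)`, as an extended real. -/
def betaTilde (μ : Measure X) (x₀ : X) (m₁ : ℝ) (α : ℝ → ℝ) (r : ℝ) : ℝ≥0∞ :=
  (μ (closedBall x₀ m₁))⁻¹ *
    ⨆ a ∈ Set.Ici r, μ ((closedBall x₀ a)ᶜ) / ENNReal.ofReal (min (α a) 1)

/-- `β(r)`, as an extended real. -/
def betaFun (μ : Measure X) (x₀ : X) (m₁ : ℝ) (αt : ℝ → ℝ) (r : ℝ) : ℝ≥0∞ :=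
  (μ (closedBall x₀ m₁))⁻¹ *
    ((⨆ a ∈ Set.Ici r, μ ((closedBall x₀ a)ᶜ) / ENNReal.ofReal (αt a)) + μ ((closedBall x₀ r)ᶜ))


lemma int_set_nonneg (μ : Measure X) [IsProbabilityMeasure μ] (x₀ : X)
    (m₁ m₂ : ℝ) (hm₁ : 0 < m₁) (hm₁₂ : m₁ ≤ m₂)
    (α αt : ℝ → ℝ) (hα : IsTail α) (hαt : IsTail αt)
    (hα2 : ∀ r : ℝ, m₁ ≤ r → 2 * (μ ((closedBall x₀ r)ᶜ)).toReal ≤ α r)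
    (h : Lp ℝ 2 μ) (hh : h ∈ Gcone μ x₀ m₁ m₂ α αt) (A : Set X) (hA : MeasurableSet A)
    (hA2 : 1 / 2 ≤ μ.real A) : 0 ≤ ∫ x in A, h x ∂μ := by
  have hae : (indicatorConstLp 2 hA (measure_ne_top μ A) (1 : ℝ) : X → ℝ)
      =ᵐ[μ] A.indicator (fun _ => (1 : ℝ)) := indicatorConstLp_coeFn
  have hint : ∫ x, (indicatorConstLp 2 hA (measure_ne_top μ A) (1 : ℝ) : X → ℝ) x ∂μ
      = μ.real A := by
    rw [integral_congr_ae hae, integral_indicator hA]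
    simp
  have hF : indicatorConstLp 2 hA (measure_ne_top μ A) (1 : ℝ) ∈ Fcone μ x₀ m₁ m₂ α αt := by
    refine ⟨?_, ?_, ?_⟩
    · filter_upwards [hae] with x hx _
      rw [hx]
      exact indicator_nonneg (fun _ _ => zero_le_one) x
    · intro r hr
      rw [hint]
      have h1 : ∫ x in (closedBall x₀ r)ᶜ,
          max ((indicatorConstLp 2 hA (measure_ne_top μ A) (1 : ℝ) : X → ℝ) x) 0 ∂μ
          ≤ μ.real ((closedBall x₀ r)ᶜ) := by
        have h2 : ∫ x in (closedBall x₀ r)ᶜ,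
          max ((indicatorConstLp 2 hA (measure_ne_top μ A) (1 : ℝ) : X → ℝ) x) 0 ∂μ
          = ∫ x in (closedBall x₀ r)ᶜ, A.indicator (fun _ => (1 : ℝ)) x ∂μ := by
          apply integral_congr_ae
          filter_upwards [ae_restrict_of_ae hae] with x hx
          rw [hx]
          exact max_eq_left (indicator_nonneg (fun _ _ => zero_le_one) x)
        rw [h2, integral_indicator hA, Measure.restrict_restrict hA]
        simp only [integral_const, smul_eq_mul, mul_one, measureReal_restrict_apply_univ]
        exact measureReal_mono inter_subset_right
      have h3 := hα2 r hr
      have h4 := hα.2.1 r (by linarith)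
      have h5 : (μ ((closedBall x₀ r)ᶜ)).toReal = μ.real ((closedBall x₀ r)ᶜ) := rfl
      nlinarith
    · intro r hr
      rw [hint]
      have h2 : ∫ x in (closedBall x₀ r)ᶜ,
          max (-((indicatorConstLp 2 hA (measure_ne_top μ A) (1 : ℝ) : X → ℝ) x)) 0 ∂μ = 0 := by
        apply integral_eq_zero_of_ae
        filter_upwards [ae_restrict_of_ae hae] with x hx
        rw [hx]
        have : 0 ≤ A.indicator (fun _ => (1 : ℝ)) x := indicator_nonneg (fun _ _ => zero_le_one) x
        simp only [Pi.zero_apply]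
        exact max_eq_right (by linarith)
      rw [h2]
      exact mul_nonneg (hαt.2.1 r (by linarith)) measureReal_nonneg
  have := hh _ hF
  have h6 : ∫ x, (indicatorConstLp 2 hA (measure_ne_top μ A) (1 : ℝ) : X → ℝ) x * h x ∂μ
      = ∫ x in A, h x ∂μ := by
    rw [← integral_indicator hA]
    apply integral_congr_ae
    filter_upwards [hae] with x hx
    rw [hx]
    by_cases hxA : x ∈ A <;> simp [hxA]
  rwa [h6] at this

theorem statement4 (μ : Measure X) [IsProbabilityMeasure μ] (x₀ : X)
    (m₁ m₂ : ℝ) (hm₁ : 0 < m₁) (hm₁₂ : m₁ ≤ m₂)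
    (α αt : ℝ → ℝ) (hα : IsTail α) (hαt : IsTail αt)
    (hαpos : ∀ r : ℝ, 0 < r → 0 < α r)
    (hμm : 0 < μ (closedBall x₀ m₁))
    (hα2 : ∀ r : ℝ, m₁ ≤ r → 2 * (μ ((closedBall x₀ r)ᶜ)).toReal ≤ α r)
    (g g' : Lp ℝ 2 μ)
    (hg : g ∈ Gcone μ x₀ m₁ m₂ α αt) (hg' : g' ∈ Gcone μ x₀ m₁ m₂ α αt)
    (hgpos : ∀ᵐ x ∂μ, 0 ≤ g x) (hg'pos : ∀ᵐ x ∂μ, 0 ≤ g' x)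
    (hgnorm : ∫ x, |g x| ∂μ = 1) (hg'norm : ∫ x, |g' x| ∂μ = 1) :
    ENNReal.ofReal (∫ x, |g x - g' x| ∂μ)
      ≤ 3 * expm1 (hilbertD (Gcone μ x₀ m₁ m₂ α αt) g g') := by
  have ig : Integrable g μ := (Lp.memLp g).integrable (by norm_num)
  have ig' : Integrable g' μ := (Lp.memLp g').integrable (by norm_num)
  have tg : ∫ x, g x ∂μ = 1 := by
    rw [← hgnorm]; apply integral_congr_ae
    filter_upwards [hgpos] with x hx using (abs_of_nonneg hx).symm
  have tg' : ∫ x, g' x ∂μ = 1 := by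
    rw [← hg'norm]; apply integral_congr_ae
    filter_upwards [hg'pos] with x hx using (abs_of_nonneg hx).symm
  have key := int_set_nonneg μ x₀ m₁ m₂ hm₁ hm₁₂ α αt hα hαt hα2
  have keyA : ∀ a : ℝ, g - a • g' ∈ Gcone μ x₀ m₁ m₂ α αt → ∀ A : Set X, MeasurableSet A →
      1 / 2 ≤ μ.real A → a * ∫ x in A, g' x ∂μ ≤ ∫ x in A, g x ∂μ := by
    intro a ha A hA hA2
    have h1 := key _ ha A hA hA2
    have h2 : ∫ x in A, (g - a • g' : Lp ℝ 2 μ) x ∂μ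
        = ∫ x in A, (g x - a * g' x) ∂μ := by
      apply integral_congr_ae
      filter_upwards [ae_restrict_of_ae (Lp.coeFn_sub g (a • g')),
        ae_restrict_of_ae (Lp.coeFn_smul a g')] with x h3 h4
      rw [h3, Pi.sub_apply, h4]; rfl
    rw [h2, integral_sub ig.integrableOn (ig'.integrableOn.const_mul a),
      integral_const_mul] at h1
    linarith
  have keyB : ∀ b : ℝ, b • g' - g ∈ Gcone μ x₀ m₁ m₂ α αt → ∀ A : Set X, MeasurableSet A →
      1 / 2 ≤ μ.real A → ∫ x in A, g x ∂μ ≤ b * ∫ x in A, g' x ∂μ := by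
    intro a ha A hA hA2
    have h1 := key _ ha A hA hA2
    have h2 : ∫ x in A, (a • g' - g : Lp ℝ 2 μ) x ∂μ
        = ∫ x in A, (a * g' x - g x) ∂μ := by
      apply integral_congr_ae
      filter_upwards [ae_restrict_of_ae (Lp.coeFn_sub (a • g') g),
        ae_restrict_of_ae (Lp.coeFn_smul a g')] with x h3 h4
      rw [h3, Pi.sub_apply, h4]; rfl
    rw [h2, integral_sub (ig'.integrableOn.const_mul a) ig.integrableOn,
      integral_const_mul] at h1
    linarith
  have a1 : ∀ a : ℝ, g - a • g' ∈ Gcone μ x₀ m₁ m₂ α αt → a ≤ 1 := by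
    intro a ha
    have := keyA a ha univ MeasurableSet.univ (by simp; norm_num)
    simpa [tg, tg'] using this
  have b1 : ∀ b : ℝ, b • g' - g ∈ Gcone μ x₀ m₁ m₂ α αt → 1 ≤ b := by
    intro a ha
    have := keyB a ha univ MeasurableSet.univ (by simp; norm_num)
    simpa [tg, tg'] using this
  unfold hilbertD
  split_ifs with hs
  swap
  · simp [expm1]
  obtain ⟨⟨⟨a, ha0, ha⟩, ⟨b, hb0, hb⟩⟩, -⟩ := hs
  set M := Msup (Gcone μ x₀ m₁ m₂ α αt) g g' with hM
  set m := minf (Gcone μ x₀ m₁ m₂ α αt) g g' with hm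
  have hM1 : 1 ≤ M := le_csInf ⟨b, hb0, hb⟩ fun c hc => b1 c hc.2
  have hm1 : m ≤ 1 := csSup_le ⟨a, ha0, ha⟩ fun c hc => a1 c hc.2
  have hm0 : 0 < m := ha0.trans_le (le_csSup ⟨1, fun c hc => a1 c hc.2⟩ ⟨ha0, ha⟩)
  have hMm : 1 ≤ M / m := by rw [le_div_iff₀ hm0]; linarith
  set A : Set X := {x | g' x < g x} with hAdef
  have hA : MeasurableSet A :=
    measurableSet_lt (Lp.stronglyMeasurable g').measurable (Lp.stronglyMeasurable g).measurable
  have sg := integral_add_compl hA ig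
  have sg' := integral_add_compl hA ig'
  have sd := integral_add_compl hA (ig.sub ig').abs
  have dA : ∫ x in A, |(⇑g - ⇑g') x| ∂μ = ∫ x in A, g x ∂μ - ∫ x in A, g' x ∂μ := by
    rw [← integral_sub ig.integrableOn ig'.integrableOn]
    apply setIntegral_congr_fun hA
    intro x hx
    exact abs_of_nonneg (sub_nonneg.2 (le_of_lt hx))
  have dAc : ∫ x in Aᶜ, |(⇑g - ⇑g') x| ∂μ = ∫ x in Aᶜ, g' x ∂μ - ∫ x in Aᶜ, g x ∂μ := by
    rw [← integral_sub ig'.integrableOn ig.integrableOn]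
    apply setIntegral_congr_fun hA.compl
    intro x hx
    have : g x ≤ g' x := not_lt.1 hx
    simp only [Pi.sub_apply]
    rw [abs_of_nonpos (by linarith)]; ring
  have pA : 0 ≤ ∫ x in A, g' x ∂μ := integral_nonneg_of_ae (ae_restrict_of_ae hg'pos)
  have pAc : 0 ≤ ∫ x in Aᶜ, g' x ∂μ := integral_nonneg_of_ae (ae_restrict_of_ae hg'pos)
  have sd' : ∫ x, |g x - g' x| ∂μ = ∫ x in A, |(⇑g - ⇑g') x| ∂μ + ∫ x in Aᶜ, |(⇑g - ⇑g') x| ∂μ :=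
    sd.symm
  have main : ∫ x, |g x - g' x| ∂μ ≤ 2 * (M / m - 1) := by
    rw [sd', dA, dAc]
    rcases le_total (1 / 2) (μ.real A) with h | h
    · have h1 : (∫ x in A, g x ∂μ - ∫ x in A, g' x ∂μ) + 1 ≤ M := by
        refine le_csInf ⟨b, hb0, hb⟩ ?_
        intro c hc
        have h2 := keyB c hc.2 A hA h
        have h3 := b1 c hc.2
        nlinarith
      have h4 : M ≤ M / m := by rw [le_div_iff₀ hm0]; nlinarith
      linarith
    · have hc2 : 1 / 2 ≤ μ.real Aᶜ := by
        rw [probReal_compl_eq_one_sub hA]; linarith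
      have h1 : m ≤ 1 - (∫ x in Aᶜ, g' x ∂μ - ∫ x in Aᶜ, g x ∂μ) := by
        refine csSup_le ⟨a, ha0, ha⟩ ?_
        intro c hc
        have h2 := keyA c hc.2 Aᶜ hA.compl hc2
        have h3 := a1 c hc.2
        nlinarith
      have h4 : 2 - m ≤ M / m := by
        rw [le_div_iff₀ hm0]; nlinarith [sq_nonneg (m - 1)]
      linarith
  unfold expm1
  rw [if_neg ENNReal.ofReal_ne_top, ENNReal.toReal_ofReal (Real.log_nonneg hMm),
    Real.exp_log (by linarith)]
  have : (3 : ℝ≥0∞) = ENNReal.ofReal 3 := by simp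
  rw [this, ← ENNReal.ofReal_mul (by norm_num)]
  apply ENNReal.ofReal_le_ofReal
  linarith

end Paper
end
end

section
/- Assume β̃(m₁) < 1. Then for every f ∈ 𝓕^{μ,norm}_{α,α̃} and every g ∈ 𝓖^{μ,norm}_{α,α̃}: (1) ∫_{B_r^c} |f| dμ ≤ α(r) + α̃(r) for all r ≥ m₂; (2) ∫ |f| dμ ≤ 1 + 2·α̃(m₂); (3) ∫_{B_r^c} |g| dμ ≤ (β̃(r) + β(r))/(1 − β̃(m₁)) for all r ≥ m₂; (4) ∫ |g| dμ ≤ 1 + 2·β̃(m₁)/(1 − β̃(m₁)). -/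
open MeasureTheory Metric Set Filter
open scoped ENNReal NNReal Topology

noncomputable section

namespace Paper

variable {X : Type*} [MeasurableSpace X] [MetricSpace X] [PolishSpace X] [BorelSpace X]

theorem aux_test {μ : Measure X} {x₀ : X} {m₁ m₂ : ℝ} {α αt : ℝ → ℝ} {g : Lp ℝ 2 μ}
    (hg : g ∈ Gcone μ x₀ m₁ m₂ α αt) (φ : X → ℝ) (hφ : MemLp φ 2 μ)
    (h1 : ∀ x ∈ closedBall x₀ m₂, 0 ≤ φ x)
    (h2 : ∀ r, m₁ ≤ r → ∫ x in (closedBall x₀ r)ᶜ, max (φ x) 0 ∂μ ≤ α r * ∫ x, φ x ∂μ)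
    (h3 : ∀ r, m₂ ≤ r → ∫ x in (closedBall x₀ r)ᶜ, max (-(φ x)) 0 ∂μ ≤ αt r * ∫ x, φ x ∂μ) :
    0 ≤ ∫ x, φ x * g x ∂μ := by
  have e := hφ.coeFn_toLp
  have ei : ∫ x, (hφ.toLp φ) x ∂μ = ∫ x, φ x ∂μ := integral_congr_ae e
  have key := hg (hφ.toLp φ) ⟨?_, ?_, ?_⟩
  · refine key.trans_eq (integral_congr_ae ?_)
    filter_upwards [e] with x hx
    rw [hx]
  · filter_upwards [e] with x hx hxb
    rw [hx]; exact h1 x hxb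
  · intro r hr
    rw [ei]
    refine le_trans (le_of_eq (integral_congr_ae ?_)) (h2 r hr)
    filter_upwards [ae_restrict_of_ae e] with x hx
    rw [hx]
  · intro r hr
    rw [ei]
    refine le_trans (le_of_eq (integral_congr_ae ?_)) (h3 r hr)
    filter_upwards [ae_restrict_of_ae e] with x hx
    rw [hx]

theorem aux_test2 {μ : Measure X} [IsProbabilityMeasure μ] {x₀ : X} {m₁ m₂ : ℝ}
    {α αt : ℝ → ℝ} {g : Lp ℝ 2 μ} (hm : m₁ ≤ m₂)
    (hg : g ∈ Gcone μ x₀ m₁ m₂ α αt) (A : Set X) (hA : MeasurableSet A) (c s : ℝ) (hc : 0 ≤ c)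
    (hs : 0 ≤ s ∨ A ⊆ (closedBall x₀ m₂)ᶜ)
    (h2 : ∀ r, m₁ ≤ r → max s 0 * μ.real (A ∩ (closedBall x₀ r)ᶜ)
      ≤ α r * (c * μ.real (closedBall x₀ m₁) + s * μ.real A))
    (h3 : ∀ r, m₂ ≤ r → max (-s) 0 * μ.real (A ∩ (closedBall x₀ r)ᶜ)
      ≤ αt r * (c * μ.real (closedBall x₀ m₁) + s * μ.real A)) :
    0 ≤ c * ∫ x in closedBall x₀ m₁, g x ∂μ + s * ∫ x in A, g x ∂μ := by
  classical
  have hB : MeasurableSet (closedBall x₀ m₁) := measurableSet_closedBall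
  have hgi : Integrable (fun x => g x) μ := (Lp.memLp g).integrable (by norm_num)
  set φ : X → ℝ := fun x => (closedBall x₀ m₁).indicator (fun _ => c) x
    + A.indicator (fun _ => s) x with hφd
  have hφ : MemLp φ 2 μ :=
    (memLp_indicator_const 2 hB c (Or.inr (measure_ne_top _ _))).add
      (memLp_indicator_const 2 hA s (Or.inr (measure_ne_top _ _)))
  have hφi : ∫ x, φ x ∂μ = c * μ.real (closedBall x₀ m₁) + s * μ.real A := by
    rw [integral_add ((integrable_const c).indicator hB) ((integrable_const s).indicator hA),
      integral_indicator_const _ hB, integral_indicator_const _ hA]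
    simp [mul_comm]
  have hout : ∀ r, m₁ ≤ r → ∀ x ∈ (closedBall x₀ r)ᶜ, φ x = A.indicator (fun _ => s) x := by
    intro r hr x hx
    have : x ∉ closedBall x₀ m₁ := fun h => hx (closedBall_subset_closedBall hr h)
    simp [hφd, Set.indicator_of_notMem this]
  have hint : ∀ r (t : ℝ), ∫ x in (closedBall x₀ r)ᶜ, A.indicator (fun _ => t) x ∂μ
      = t * μ.real (A ∩ (closedBall x₀ r)ᶜ) := by
    intro r t
    rw [integral_indicator_const _ hA, measureReal_restrict_apply hA]
    simp [mul_comm]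
  have key := aux_test hg φ hφ ?_ ?_ ?_
  · refine key.trans_eq ?_
    have e : ∀ x, φ x * g x = (closedBall x₀ m₁).indicator (fun x => c * g x) x
        + A.indicator (fun x => s * g x) x := by
      intro x
      simp only [hφd, Set.indicator_apply]
      split_ifs <;> ring
    simp_rw [e]
    rw [integral_add ((hgi.const_mul c).indicator hB) ((hgi.const_mul s).indicator hA),
      integral_indicator hB, integral_indicator hA, integral_const_mul, integral_const_mul]
  · intro x hx
    have h0 : 0 ≤ (closedBall x₀ m₁).indicator (fun _ => c) x :=
      Set.indicator_nonneg (fun _ _ => hc) x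
    rcases hs with hs | hs
    · exact add_nonneg h0 (Set.indicator_nonneg (fun _ _ => hs) x)
    · have : x ∉ A := fun h => hs h hx
      simpa [hφd, Set.indicator_of_notMem this] using h0
  · intro r hr
    rw [hφi]
    refine le_trans (le_of_eq ?_) (h2 r hr)
    rw [← hint]
    refine setIntegral_congr_fun measurableSet_closedBall.compl fun x hx => ?_
    simp only [hout r hr x hx, Set.indicator_apply]
    split_ifs <;> simp
  · intro r hr
    rw [hφi]
    refine le_trans (le_of_eq ?_) (h3 r hr)
    rw [← hint]
    refine setIntegral_congr_fun measurableSet_closedBall.compl fun x hx => ?_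
    simp only [hout r (hm.trans hr) x hx, Set.indicator_apply]
    split_ifs <;> simp

theorem aux_enn {p S a : ℝ≥0∞} {x : ℝ} (hp : p ≠ 0) (hp' : p ≠ ⊤) (hx : 0 ≤ x)
    (hfin : p⁻¹ * S ≠ ⊤) (h : a / ENNReal.ofReal x ≤ S) :
    a.toReal ≤ x * ((p⁻¹ * S).toReal * p.toReal) := by
  have hS : S ≠ ⊤ := by
    rintro rfl
    exact hfin (ENNReal.mul_top (ENNReal.inv_ne_zero.2 hp'))
  rw [ENNReal.div_le_iff_le_mul (Or.inr hS) (Or.inl ENNReal.ofReal_ne_top)] at h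
  have h' := ENNReal.toReal_mono (ENNReal.mul_ne_top hS ENNReal.ofReal_ne_top) h
  rw [ENNReal.toReal_mul, ENNReal.toReal_ofReal hx] at h'
  have : (p⁻¹ * S).toReal * p.toReal = S.toReal := by
    rw [← ENNReal.toReal_mul, mul_right_comm, ENNReal.inv_mul_cancel hp hp', one_mul]
  rw [this, mul_comm]; exact h'

theorem aux_abs {μ : Measure X} {g : X → ℝ} (hg : Integrable g μ) (hm : Measurable g)
    (C : Set X) :
    ∫ x in C, |g x| ∂μ = ∫ x in C, g x ∂μ - 2 * ∫ x in {x | g x < 0} ∩ C, g x ∂μ := by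
  have hN : MeasurableSet {x | g x < 0} := measurableSet_lt hm measurable_const
  have e : ∀ x, |g x| = g x - 2 * ({x | g x < 0}.indicator g x) := by
    intro x
    by_cases h : g x < 0
    · rw [Set.indicator_of_mem (by exact h), abs_of_neg h]; ring
    · rw [Set.indicator_of_notMem (by exact h), abs_of_nonneg (not_lt.1 h)]; ring
  simp_rw [e]
  rw [integral_sub hg.integrableOn ((hg.integrableOn.indicator hN).const_mul 2),
    integral_const_mul, integral_indicator hN, Measure.restrict_restrict hN]

theorem statement6 (μ : Measure X) [IsProbabilityMeasure μ] (x₀ : X)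
    (m₁ m₂ : ℝ) (hm₁ : 0 < m₁) (hm₁₂ : m₁ ≤ m₂)
    (α αt : ℝ → ℝ) (hα : IsTail α) (hαt : IsTail αt)
    (hαpos : ∀ r : ℝ, 0 < r → 0 < α r)
    (hμm : 0 < μ (closedBall x₀ m₁))
    (hβ : betaTilde μ x₀ m₁ α m₁ < 1)
    (f : Lp ℝ 2 μ) (hf : f ∈ Fcone μ x₀ m₁ m₂ α αt) (hfnorm : ∫ x, f x ∂μ = 1)
    (g : Lp ℝ 2 μ) (hg : g ∈ Gcone μ x₀ m₁ m₂ α αt) (hgnorm : ∫ x, g x ∂μ = 1) :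
    (∀ r : ℝ, m₂ ≤ r → ∫ x in (closedBall x₀ r)ᶜ, |f x| ∂μ ≤ α r + αt r) ∧
    (∫ x, |f x| ∂μ ≤ 1 + 2 * αt m₂) ∧
    (∀ r : ℝ, m₂ ≤ r →
      ENNReal.ofReal (∫ x in (closedBall x₀ r)ᶜ, |g x| ∂μ)
        ≤ (betaTilde μ x₀ m₁ α r + betaFun μ x₀ m₁ αt r) / (1 - betaTilde μ x₀ m₁ α m₁)) ∧
    (ENNReal.ofReal (∫ x, |g x| ∂μ)
      ≤ 1 + 2 * betaTilde μ x₀ m₁ α m₁ / (1 - betaTilde μ x₀ m₁ α m₁)) := by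
  have hm₂ : 0 < m₂ := hm₁.trans_le hm₁₂
  obtain ⟨hf1, hf2, hf3⟩ := hf
  have hfi : Integrable (fun x => f x) μ := (Lp.memLp f).integrable (by norm_num)
  have hgi : Integrable (fun x => g x) μ := (Lp.memLp g).integrable (by norm_num)
  have hgm : Measurable (fun x => g x) := (Lp.stronglyMeasurable g).measurable
  have hfp : Integrable (fun x => max (f x) 0) μ := hfi.pos_part
  have hfn : Integrable (fun x => max (-(f x)) 0) μ := hfi.neg_part
  have hBm : ∀ r, MeasurableSet (closedBall x₀ r) := fun r => measurableSet_closedBall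
  set N : Set X := {x | g x < 0} with hNd
  have hN : MeasurableSet N := measurableSet_lt hgm measurable_const
  set I := ∫ x in closedBall x₀ m₁, g x ∂μ with hI
  set p := μ.real (closedBall x₀ m₁) with hp
  have hp0 : 0 ≤ p := measureReal_nonneg
  have hmono : ∀ r, m₁ ≤ r → betaTilde μ x₀ m₁ α r ≤ betaTilde μ x₀ m₁ α m₁ := by
    intro r hr
    unfold betaTilde
    refine mul_le_mul_right ?_ _
    exact biSup_mono fun a (ha : r ≤ a) => hr.trans ha
  have hbt_fin : ∀ r, m₁ ≤ r → betaTilde μ x₀ m₁ α r ≠ ⊤ := fun r hr =>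
    ((hmono r hr).trans_lt (hβ.trans ENNReal.one_lt_top)).ne
  set bt : ℝ → ℝ := fun r => (betaTilde μ x₀ m₁ α r).toReal with hbt
  have hbt0 : ∀ r, 0 ≤ bt r := fun r => ENNReal.toReal_nonneg
  have hK1 : ∀ r, m₁ ≤ r → ∀ a, r ≤ a →
      μ.real ((closedBall x₀ a)ᶜ) ≤ α a * (bt r * p) := by
    intro r hr a ha
    have ha0 : 0 < a := hm₁.trans_le (hr.trans ha)
    have h := aux_enn (p := μ (closedBall x₀ m₁))
      (S := ⨆ a ∈ Set.Ici r, μ ((closedBall x₀ a)ᶜ) / ENNReal.ofReal (min (α a) 1))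
      (a := μ ((closedBall x₀ a)ᶜ)) (x := min (α a) 1) hμm.ne' (measure_ne_top _ _)
      (le_min (hαpos a ha0).le zero_le_one) (hbt_fin r hr)
      (le_iSup₂ (f := fun a (_ : a ∈ Set.Ici r) =>
        μ ((closedBall x₀ a)ᶜ) / ENNReal.ofReal (min (α a) 1)) a ha)
    exact h.trans (mul_le_mul_of_nonneg_right (min_le_left _ _) (mul_nonneg (hbt0 r) hp0))
  -- positivity of I
  have hI0 : 0 ≤ I := by
    have := aux_test2 hm₁₂ hg ∅ MeasurableSet.empty 1 0 zero_le_one (Or.inl le_rfl)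
      (fun r hr => by
        simpa using mul_nonneg (hαpos r (hm₁.trans_le hr)).le hp0)
      (fun r hr => by
        simpa using mul_nonneg (hαt.2.1 r (hm₂.trans_le hr)) hp0)
    simpa using this
  -- negative part in the ball
  have hNB : 0 ≤ ∫ x in N ∩ closedBall x₀ m₁, g x ∂μ := by
    have := aux_test2 hm₁₂ hg (N ∩ closedBall x₀ m₁) (hN.inter (hBm _)) 0 1 le_rfl
      (Or.inl zero_le_one)
      (fun r hr => by
        have : N ∩ closedBall x₀ m₁ ∩ (closedBall x₀ r)ᶜ = ∅ := by
          ext x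
          simp only [mem_inter_iff, mem_compl_iff, mem_empty_iff_false, iff_false]
          rintro ⟨⟨_, h⟩, h'⟩
          exact h' (closedBall_subset_closedBall hr h)
        rw [this]
        simpa using mul_nonneg (hαpos r (hm₁.trans_le hr)).le measureReal_nonneg)
      (fun r hr => by
        simpa using mul_nonneg (hαt.2.1 r (hm₂.trans_le hr)) measureReal_nonneg)
    simpa using this
  -- negative part outside
  have hNout : ∀ r, m₁ ≤ r → -(bt r * I) ≤ ∫ x in N ∩ (closedBall x₀ r)ᶜ, g x ∂μ := by
    intro r hr
    have := aux_test2 hm₁₂ hg (N ∩ (closedBall x₀ r)ᶜ) (hN.inter (hBm _).compl) (bt r) 1 (hbt0 r)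
      (Or.inl zero_le_one)
      (fun a ha => by
        have ha0 := hm₁.trans_le ha
        have h1 : μ.real (N ∩ (closedBall x₀ r)ᶜ ∩ (closedBall x₀ a)ᶜ) ≤ α a * (bt r * p) := by
          rcases le_total r a with h | h
          · exact (measureReal_mono inter_subset_right).trans (hK1 r hr a h)
          · refine (measureReal_mono (inter_subset_left.trans inter_subset_right)).trans
              ((hK1 r hr r le_rfl).trans ?_)
            exact mul_le_mul_of_nonneg_right (hα.1 a r ha0 h) (mul_nonneg (hbt0 r) hp0)
        have h2 : 0 ≤ α a * μ.real (N ∩ (closedBall x₀ r)ᶜ) :=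
          mul_nonneg (hαpos a ha0).le measureReal_nonneg
        rw [max_eq_left zero_le_one]
        linarith)
      (fun a ha => by
        have h2 : 0 ≤ αt a * (bt r * p + 1 * μ.real (N ∩ (closedBall x₀ r)ᶜ)) :=
          mul_nonneg (hαt.2.1 a (hm₂.trans_le ha))
            (add_nonneg (mul_nonneg (hbt0 r) hp0) (by simp))
        rw [max_eq_right (by norm_num)]
        simpa using h2)
    linarith
  -- positive part outside
  have hPout : ∀ r, m₂ ≤ r → betaFun μ x₀ m₁ αt r ≠ ⊤ →
      ∫ x in Nᶜ ∩ (closedBall x₀ r)ᶜ, g x ∂μ ≤ (betaFun μ x₀ m₁ αt r).toReal * I := by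
    intro r hr hfin
    set b := (betaFun μ x₀ m₁ αt r).toReal with hb
    set S := ⨆ a ∈ Set.Ici r, μ ((closedBall x₀ a)ᶜ) / ENNReal.ofReal (αt a) with hS
    have hpinv : (μ (closedBall x₀ m₁))⁻¹ ≠ 0 := ENNReal.inv_ne_zero.2 (measure_ne_top _ _)
    have hSfin' : (μ (closedBall x₀ m₁))⁻¹ * S ≠ ⊤ := by
      refine ne_top_of_le_ne_top hfin ?_
      unfold betaFun
      gcongr
      exact le_self_add
    have hSfin : S ≠ ⊤ := by
      intro h
      rw [h] at hSfin'
      exact hSfin' (ENNReal.mul_top hpinv)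
    have hpp : p ≠ 0 := (ENNReal.toReal_pos hμm.ne' (measure_ne_top _ _)).ne'
    have hbp : b * p = S.toReal + μ.real ((closedBall x₀ r)ᶜ) := by
      have : b = p⁻¹ * (S.toReal + μ.real ((closedBall x₀ r)ᶜ)) := by
        rw [hb, betaFun, ENNReal.toReal_mul, ENNReal.toReal_inv,
          ENNReal.toReal_add hSfin (measure_ne_top _ _)]
        rfl
      rw [this]
      field_simp
    have hS' : ((μ (closedBall x₀ m₁))⁻¹ * S).toReal * (μ (closedBall x₀ m₁)).toReal
        = S.toReal := by
      rw [← ENNReal.toReal_mul, mul_right_comm,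
        ENNReal.inv_mul_cancel hμm.ne' (measure_ne_top _ _), one_mul]
    have hK : ∀ a, r ≤ a → μ.real ((closedBall x₀ a)ᶜ) ≤ αt a * S.toReal := by
      intro a ha
      have := aux_enn (p := μ (closedBall x₀ m₁)) (S := S)
        (a := μ ((closedBall x₀ a)ᶜ)) (x := αt a) hμm.ne' (measure_ne_top _ _)
        (hαt.2.1 a (hm₂.trans_le (hr.trans ha))) hSfin'
        (le_iSup₂ (f := fun a (_ : a ∈ Set.Ici r) =>
          μ ((closedBall x₀ a)ᶜ) / ENNReal.ofReal (αt a)) a ha)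
      rw [hS'] at this
      exact this
    set A := Nᶜ ∩ (closedBall x₀ r)ᶜ with hA
    have hAle : μ.real A ≤ μ.real ((closedBall x₀ r)ᶜ) := measureReal_mono inter_subset_right
    have hge : S.toReal ≤ b * p + (-1) * μ.real A := by linarith
    have := aux_test2 hm₁₂ hg A (hN.compl.inter (hBm _).compl) b (-1) ENNReal.toReal_nonneg
      (Or.inr (inter_subset_right.trans
        (compl_subset_compl.2 (closedBall_subset_closedBall hr))))
      (fun a ha => by
        rw [max_eq_right (by norm_num), zero_mul]
        exact mul_nonneg (hαpos a (hm₁.trans_le ha)).le (ENNReal.toReal_nonneg.trans hge))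
      (fun a ha => by
        have ha0 := hm₂.trans_le ha
        rw [neg_neg, max_eq_left zero_le_one, one_mul]
        refine le_trans ?_ (mul_le_mul_of_nonneg_left hge (hαt.2.1 a ha0))
        rcases le_total r a with h | h
        · exact (measureReal_mono inter_subset_right).trans (hK a h)
        · refine (measureReal_mono inter_subset_left).trans (hAle.trans
              ((hK r le_rfl).trans ?_))
          exact mul_le_mul_of_nonneg_right (hαt.1 a r ha0 h) ENNReal.toReal_nonneg)
    linarith
  have hsplit : ∀ C : Set X, ∫ x in C, g x ∂μ
      = ∫ x in N ∩ C, g x ∂μ + ∫ x in Nᶜ ∩ C, g x ∂μ := by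
    intro C
    rw [← integral_add_compl hN hgi.integrableOn, Measure.restrict_restrict hN,
      Measure.restrict_restrict hN.compl]
  have hPnn : ∀ C : Set X, MeasurableSet C → 0 ≤ ∫ x in Nᶜ ∩ C, g x ∂μ := fun C hC =>
    setIntegral_nonneg (hN.compl.inter hC) fun x hx => not_lt.1 hx.1
  have hb1 : bt m₁ < 1 := by
    have := (ENNReal.toReal_lt_toReal (hbt_fin m₁ le_rfl) ENNReal.one_ne_top).2 hβ
    simpa using this
  have hIle : I ≤ 1 / (1 - bt m₁) := by
    have h1 : I + ∫ x in (closedBall x₀ m₁)ᶜ, g x ∂μ = 1 := by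
      rw [← hgnorm]; exact integral_add_compl (hBm _) hgi
    have h2 := hsplit (closedBall x₀ m₁)ᶜ
    have h3 := hPnn _ (hBm m₁).compl
    have h4 := hNout m₁ le_rfl
    rw [le_div_iff₀ (by linarith)]
    linarith
  have hden : (1 : ℝ≥0∞) - betaTilde μ x₀ m₁ α m₁ = ENNReal.ofReal (1 - bt m₁) := by
    rw [ENNReal.ofReal_sub _ (hbt0 _), ENNReal.ofReal_one, ENNReal.ofReal_toReal (hbt_fin _ le_rfl)]
  have hdpos : 0 < 1 - bt m₁ := by linarith
  have habs : ∀ x, |f x| = max (f x) 0 + max (-(f x)) 0 := by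
    intro x
    rcases le_total 0 (f x) with h | h
    · rw [abs_of_nonneg h, max_eq_left h, max_eq_right (by linarith)]; ring
    · rw [abs_of_nonpos h, max_eq_right h, max_eq_left (by linarith)]; ring
  have habs' : ∀ x, |f x| = f x + 2 * max (-(f x)) 0 := by
    intro x
    rcases le_total 0 (f x) with h | h
    · rw [abs_of_nonneg h, max_eq_right (by linarith)]; ring
    · rw [abs_of_nonpos h, max_eq_left (by linarith)]; ring
  refine ⟨?_, ?_, ?_, ?_⟩
  · intro r hr
    have h2 := hf2 r (hm₁₂.trans hr)
    have h3 := hf3 r hr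
    rw [hfnorm, mul_one] at h2 h3
    simp_rw [habs]
    rw [integral_add hfp.integrableOn hfn.integrableOn]
    linarith
  · have h3 := hf3 m₂ le_rfl
    rw [hfnorm, mul_one] at h3
    simp_rw [habs']
    rw [integral_add hfi (hfn.const_mul 2), integral_const_mul, hfnorm,
      ← integral_add_compl (hBm m₂) hfn]
    have h0 : ∫ x in closedBall x₀ m₂, max (-(f x)) 0 ∂μ = 0 := by
      refine setIntegral_eq_zero_of_ae_eq_zero ?_
      filter_upwards [hf1] with x hx hxb
      exact max_eq_right (by linarith [hx hxb])
    linarith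
  · intro r hr
    by_cases hfin : betaFun μ x₀ m₁ αt r = ⊤
    · rw [hfin, hden, add_top, ENNReal.top_div_of_ne_top ENNReal.ofReal_ne_top]
      exact le_top
    have hr1 := hm₁₂.trans hr
    rw [hden, ← ENNReal.ofReal_toReal (hbt_fin r hr1), ← ENNReal.ofReal_toReal hfin,
      ← ENNReal.ofReal_add ENNReal.toReal_nonneg ENNReal.toReal_nonneg,
      ← ENNReal.ofReal_div_of_pos hdpos]
    refine ENNReal.ofReal_le_ofReal ?_
    rw [aux_abs hgi hgm]
    have h1 := hNout r hr1
    have h2 := hPout r hr hfin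
    have h3 := hsplit (closedBall x₀ r)ᶜ
    have h4 := mul_le_mul_of_nonneg_left hIle
      (add_nonneg (hbt0 r) (ENNReal.toReal_nonneg (a := betaFun μ x₀ m₁ αt r)))
    rw [mul_one_div] at h4
    refine le_trans ?_ h4
    linarith
  · have e3 : 1 + 2 * betaTilde μ x₀ m₁ α m₁ / (1 - betaTilde μ x₀ m₁ α m₁)
        = ENNReal.ofReal (1 + 2 * bt m₁ / (1 - bt m₁)) := by
      have e2 : (2 : ℝ≥0∞) = ENNReal.ofReal 2 := by simp
      rw [ENNReal.ofReal_add zero_le_one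
        (div_nonneg (mul_nonneg (by norm_num) (hbt0 _)) hdpos.le), ENNReal.ofReal_div_of_pos hdpos,
        ENNReal.ofReal_mul (by norm_num), ENNReal.ofReal_one, hden, ← e2,
        ENNReal.ofReal_toReal (hbt_fin m₁ le_rfl)]
    rw [e3]
    refine ENNReal.ofReal_le_ofReal ?_
    have h0 := aux_abs hgi hgm univ
    simp only [setIntegral_univ, inter_univ] at h0
    rw [h0, hgnorm]
    have h1 : ∫ x in N, g x ∂μ = ∫ x in N ∩ closedBall x₀ m₁, g x ∂μ
        + ∫ x in N ∩ (closedBall x₀ m₁)ᶜ, g x ∂μ := by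
      rw [← integral_add_compl (hBm m₁) hgi.integrableOn, Measure.restrict_restrict (hBm _),
        Measure.restrict_restrict (hBm _).compl, inter_comm, inter_comm _ N]
    have h2 := hNout m₁ le_rfl
    have h4 := mul_le_mul_of_nonneg_left hIle (mul_nonneg zero_le_two (hbt0 m₁))
    rw [mul_one_div] at h4
    change 1 - 2 * ∫ x in N, g x ∂μ ≤ 1 + 2 * bt m₁ / (1 - bt m₁)
    linarith

end Paper
end
end

section
/- Let μ, ν be Borel probability measures on 𝒳 with μ(B_{m₁}) > 0, ν(B_{m₁}) > 0, (α₁,α̃₁), (α₂,α̃₂) pairs of tail functions with α₁, α₂ strictly positive, and K : 𝒳×𝒳 → (0,1] measurable with lower decay l. Then for every f ∈ 𝓕^{μ,norm}_{α₁,α̃₁}, every g ∈ 𝓖^{ν,norm}_{α₂,α̃₂} and every r > 0: ∫ L_{K^⊤,ν}(g)·f dμ ≥ (1+l(r))/2 − ((1−l(r))/2)·(∫_{B_r} |f| dμ)·(∫_{B_r} |g| dν) − (∫ |f| dμ)·(∫_{B_r^c} |g| dν) − (∫_{B_r^c} |f| dμ)·(∫_{B_r} |g| dν), and ∫ L_{K^⊤,ν}(g)·f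 dμ ≤ (∫ |f| dμ)·(∫ |g| dν). -/
open MeasureTheory Metric Set Filter
open scoped ENNReal NNReal Topology

noncomputable section

namespace Paper

variable {X : Type*} [MeasurableSpace X] [MetricSpace X] [PolishSpace X] [BorelSpace X]

theorem aux9 (μ ν : Measure X) [IsProbabilityMeasure μ] [IsProbabilityMeasure ν]
    (B : Set X) (hB : MeasurableSet B)
    (K : X → X → ℝ) (hKmeas : Measurable (Function.uncurry K))
    (hKpos : ∀ x y, 0 < K x y) (hKle : ∀ x y, K x y ≤ 1)
    (c : ℝ) (hc0 : 0 ≤ c) (hc1 : c ≤ 1) (hc : ∀ x ∈ B, ∀ y ∈ B, c ≤ K x y)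
    (f g : X → ℝ) (hf : Integrable f μ) (hg : Integrable g ν)
    (hfnorm : ∫ x, f x ∂μ = 1) (hgnorm : ∫ x, g x ∂ν = 1) :
    ((1 + c) / 2
      - (1 - c) / 2 * (∫ x in B, |f x| ∂μ) * (∫ x in B, |g x| ∂ν)
      - (∫ x, |f x| ∂μ) * (∫ x in Bᶜ, |g x| ∂ν)
      - (∫ x in Bᶜ, |f x| ∂μ) * (∫ x in B, |g x| ∂ν)
      ≤ ∫ x, Lker (fun a b => K b a) ν g x * f x ∂μ) ∧
    (∫ x, Lker (fun a b => K b a) ν g x * f x ∂μ ≤ (∫ x, |f x| ∂μ) * (∫ x, |g x| ∂ν)) := by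
  have hfg : Integrable (fun p : X × X => f p.1 * g p.2) (μ.prod ν) := hf.mul_prod hg
  have hm : Measurable (fun p : X × X => K p.2 p.1) := hKmeas.comp measurable_swap
  have hI : Integrable (fun p : X × X => K p.2 p.1 * (f p.1 * g p.2)) (μ.prod ν) := by
    refine hfg.bdd_mul (c := 1) hm.aestronglyMeasurable (ae_of_all _ fun p => ?_)
    rw [Real.norm_eq_abs, abs_of_pos (hKpos _ _)]
    exact hKle _ _
  have hEq : ∫ x, Lker (fun a b => K b a) ν g x * f x ∂μ
      = ∫ p : X × X, K p.2 p.1 * (f p.1 * g p.2) ∂(μ.prod ν) := by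
    rw [integral_prod _ hI]
    refine integral_congr_ae (ae_of_all _ fun x => ?_)
    simp only [Lker]
    rw [← integral_mul_const]
    refine integral_congr_ae (ae_of_all _ fun y => ?_)
    simp only
    ring
  have hfa := hf.abs
  have hga := hg.abs
  have hfB := hfa.indicator hB
  have hgB := hga.indicator hB
  have hfC := hfa.indicator hB.compl
  have hgC := hga.indicator hB.compl
  rw [hEq]
  constructor
  · have i0 := hfg.const_mul ((1 + c) / 2)
    have i1 := (hfB.mul_prod hgB).const_mul ((1 - c) / 2)
    have i2 := hfa.mul_prod hgC
    have i3 := hfC.mul_prod hgB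
    have key := integral_mono (((i0.sub i1).sub i2).sub i3) hI (fun p => by
      obtain ⟨x, y⟩ := p
      have k0 := hKpos y x
      have k1 := hKle y x
      have a1 := neg_abs_le (f x * g y)
      have a2 := le_abs_self (f x * g y)
      have a3 := abs_nonneg (f x * g y)
      have e := abs_mul (f x) (g y)
      by_cases hx : x ∈ B <;> by_cases hy : y ∈ B <;>
        simp only [Pi.sub_apply, Set.indicator, Set.mem_compl_iff, hx, hy, not_true_eq_false,
          not_false_eq_true, if_true, if_false, mul_zero, zero_mul, sub_zero, ← e]
      · have := hc y hy x hx
        rcases abs_cases (f x * g y) with ⟨h, h'⟩ | ⟨h, h'⟩ <;> rw [h] <;> nlinarith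
      all_goals
        rcases abs_cases (f x * g y) with ⟨h, h'⟩ | ⟨h, h'⟩ <;> rw [h] <;> nlinarith)
    have e3 : ∫ p : X × X, |f p.1| * Bᶜ.indicator (fun a => |g a|) p.2 ∂(μ.prod ν)
        = (∫ x, |f x| ∂μ) * ∫ y, Bᶜ.indicator (fun a => |g a|) y ∂ν :=
      integral_prod_mul (fun x => |f x|) _
    rw [integral_sub' ((i0.sub i1).sub i2) i3, integral_sub' (i0.sub i1) i2, integral_sub' i0 i1,
      integral_const_mul, integral_const_mul, e3, integral_prod_mul, integral_prod_mul,
      integral_prod_mul, integral_indicator hB, integral_indicator hB,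
      integral_indicator hB.compl, integral_indicator hB.compl, hfnorm, hgnorm] at key
    linarith
  · rw [← integral_prod_mul]
    refine integral_mono hI (hfa.mul_prod hga) fun p => ?_
    simp only
    rw [← abs_mul]
    have k0 := hKpos p.2 p.1
    have k1 := hKle p.2 p.1
    rcases abs_cases (f p.1 * g p.2) with ⟨h, h'⟩ | ⟨h, h'⟩ <;> rw [h] <;> nlinarith

theorem statement9 (μ ν : Measure X) [IsProbabilityMeasure μ] [IsProbabilityMeasure ν]
    (x₀ : X) (m₁ m₂ : ℝ) (hm₁ : 0 < m₁) (hm₁₂ : m₁ ≤ m₂)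
    (α₁ αt₁ α₂ αt₂ : ℝ → ℝ)
    (h1 : IsTail α₁) (h2 : IsTail αt₁) (h3 : IsTail α₂) (h4 : IsTail αt₂)
    (hα₁pos : ∀ r : ℝ, 0 < r → 0 < α₁ r) (hα₂pos : ∀ r : ℝ, 0 < r → 0 < α₂ r)
    (hμm : 0 < μ (closedBall x₀ m₁)) (hνm : 0 < ν (closedBall x₀ m₁))
    (K : X → X → ℝ) (hKmeas : Measurable (Function.uncurry K))
    (hKpos : ∀ x y, 0 < K x y) (hKle : ∀ x y, K x y ≤ 1)
    (l : ℝ → ℝ) (hl : IsLowerDecay K x₀ l)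
    (f : Lp ℝ 2 μ) (hf : f ∈ Fcone μ x₀ m₁ m₂ α₁ αt₁) (hfnorm : ∫ x, f x ∂μ = 1)
    (g : Lp ℝ 2 ν) (hg : g ∈ Gcone ν x₀ m₁ m₂ α₂ αt₂) (hgnorm : ∫ x, g x ∂ν = 1)
    (r : ℝ) (hr : 0 < r) :
    ((1 + l r) / 2
      - (1 - l r) / 2 * (∫ x in closedBall x₀ r, |f x| ∂μ) * (∫ x in closedBall x₀ r, |g x| ∂ν)
      - (∫ x, |f x| ∂μ) * (∫ x in (closedBall x₀ r)ᶜ, |g x| ∂ν)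
      - (∫ x in (closedBall x₀ r)ᶜ, |f x| ∂μ) * (∫ x in closedBall x₀ r, |g x| ∂ν)
      ≤ ∫ x, Lker (fun a b => K b a) ν (⇑g) x * f x ∂μ) ∧
    (∫ x, Lker (fun a b => K b a) ν (⇑g) x * f x ∂μ ≤ (∫ x, |f x| ∂μ) * (∫ x, |g x| ∂ν)) := by
  have hfi : Integrable (fun x => f x) μ := (Lp.memLp f).integrable (by norm_num)
  have hgi : Integrable (fun x => g x) ν := (Lp.memLp g).integrable (by norm_num)
  have hx0 : x₀ ∈ closedBall x₀ r := mem_closedBall_self hr.le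
  have hl1 : l r ≤ 1 := (hl.2 r hr x₀ hx0 x₀ hx0).trans (hKle _ _)
  have key := aux9 μ ν (closedBall x₀ r) measurableSet_closedBall K hKmeas hKpos hKle
    (max (l r) 0) (le_max_right _ _) (max_le hl1 zero_le_one)
    (fun x hx y hy => max_le (hl.2 r hr x hx y hy) (hKpos x y).le) f g hfi hgi hfnorm hgnorm
  refine ⟨le_trans ?_ key.1, key.2⟩
  have hA : 0 ≤ ∫ x in closedBall x₀ r, |f x| ∂μ := integral_nonneg fun _ => abs_nonneg _
  have hB : 0 ≤ ∫ x in closedBall x₀ r, |g x| ∂ν := integral_nonneg fun _ => abs_nonneg _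
  have hAB := mul_nonneg hA hB
  have hle : l r ≤ max (l r) 0 := le_max_left _ _
  have := mul_nonneg (sub_nonneg.2 hle) hAB
  nlinarith

end Paper
end
end

section
/- Let μ, ν be Borel probability measures on 𝒳 with μ(B_{m₁}) > 0, ν(B_{m₁}) > 0, (α₁,α̃₁), (α₂,α̃₂) pairs of tail functions with α₁, α₂ strictly positive, and K : 𝒳×𝒳 → (0,1] measurable with lower decay l. Let β₂, β̃₂ be the functions β, β̃ built from ν and (α₂,α̃₂). If α̃₁(m₂) ≤ 1/2, β̃₂(m₁) ≤ 1/2, r ≥ m₂ and l(r) ≤ 1, then for every f ∈ 𝓕^{μ,norm}_{α₁,α̃₁} and every g ∈ 𝓖^{ν,norm}_{α₂,α̃₂}: ∫ L_{K^⊤,ν}(g)·f dμ ≥ l(r) − α̃₁(m₂) − 4·β̃₂(m₁) − 4·α₁(r) − 4·α̃₁(r) − 5·β₂(r) − 5·β̃₂(r). -/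
open MeasureTheory Metric Set Filter
open scoped ENNReal NNReal Topology

noncomputable section

namespace Paper

variable {X : Type*} [MeasurableSpace X] [MetricSpace X] [PolishSpace X] [BorelSpace X]

theorem G_test (ν : Measure X) [IsProbabilityMeasure ν] (x₀ : X) (m₁ m₂ : ℝ) (α αt : ℝ → ℝ)
    (g : Lp ℝ 2 ν) (hg : g ∈ Gcone ν x₀ m₁ m₂ α αt) (φ : X → ℝ) (hφ : MemLp φ 2 ν)
    (c1 : ∀ x ∈ closedBall x₀ m₂, 0 ≤ φ x)
    (c2 : ∀ r, m₁ ≤ r → ∫ x in (closedBall x₀ r)ᶜ, max (φ x) 0 ∂ν ≤ α r * ∫ x, φ x ∂ν)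
    (c3 : ∀ r, m₂ ≤ r → ∫ x in (closedBall x₀ r)ᶜ, max (-(φ x)) 0 ∂ν ≤ αt r * ∫ x, φ x ∂ν) :
    0 ≤ ∫ x, φ x * g x ∂ν := by
  have hae := hφ.coeFn_toLp
  have hI : ∫ x, hφ.toLp φ x ∂ν = ∫ x, φ x ∂ν := integral_congr_ae hae
  have := hg (hφ.toLp φ) ⟨?_, ?_, ?_⟩
  · refine this.trans_eq (integral_congr_ae ?_)
    filter_upwards [hae] with x hx
    rw [hx]
  · filter_upwards [hae] with x hx hxb
    rw [hx]; exact c1 x hxb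
  · intro r hr
    rw [hI]
    refine le_of_eq_of_le (integral_congr_ae ?_) (c2 r hr)
    filter_upwards [ae_restrict_of_ae hae] with x hx
    rw [hx]
  · intro r hr
    rw [hI]
    refine le_of_eq_of_le (integral_congr_ae ?_) (c3 r hr)
    filter_upwards [ae_restrict_of_ae hae] with x hx
    rw [hx]

theorem betaTilde_use (ν : Measure X) [IsProbabilityMeasure ν] (x₀ : X) (m₁ r : ℝ) (α : ℝ → ℝ)
    (hp : 0 < ν (closedBall x₀ m₁)) (hb : betaTilde ν x₀ m₁ α r ≠ ⊤) (a : ℝ) (ha : r ≤ a)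
    (hα : 0 < α a) :
    ν.real (closedBall x₀ a)ᶜ ≤
      α a * ((betaTilde ν x₀ m₁ α r).toReal * ν.real (closedBall x₀ m₁)) := by
  have hpt : ν (closedBall x₀ m₁) ≠ ⊤ := measure_ne_top _ _
  have h1 : ν ((closedBall x₀ a)ᶜ) / ENNReal.ofReal (min (α a) 1)
      ≤ ν (closedBall x₀ m₁) * betaTilde ν x₀ m₁ α r := by
    unfold betaTilde
    rw [← mul_assoc, ENNReal.mul_inv_cancel hp.ne' hpt, one_mul]
    exact le_iSup₂ (f := fun a (_ : a ∈ Set.Ici r) =>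
      ν ((closedBall x₀ a)ᶜ) / ENNReal.ofReal (min (α a) 1)) a ha
  have hne : ν (closedBall x₀ m₁) * betaTilde ν x₀ m₁ α r ≠ ⊤ := ENNReal.mul_ne_top hpt hb
  rw [ENNReal.div_le_iff_le_mul (Or.inr hne) (Or.inl ENNReal.ofReal_ne_top)] at h1
  have h2 := ENNReal.toReal_mono (ENNReal.mul_ne_top hne ENNReal.ofReal_ne_top) h1
  rw [ENNReal.toReal_mul, ENNReal.toReal_mul, ENNReal.toReal_ofReal (by positivity)] at h2
  have h3 : 0 ≤ (ν (closedBall x₀ m₁)).toReal * (betaTilde ν x₀ m₁ α r).toReal := by positivity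
  have h4 := mul_le_mul_of_nonneg_left (min_le_left (α a) 1) h3
  simp only [Measure.real]
  linarith

theorem betaFun_use (ν : Measure X) [IsProbabilityMeasure ν] (x₀ : X) (m₁ r : ℝ) (α : ℝ → ℝ)
    (hp : 0 < ν (closedBall x₀ m₁)) (hb : betaFun ν x₀ m₁ α r ≠ ⊤) (a : ℝ) (ha : r ≤ a)
    (hα : 0 ≤ α a) :
    ν.real (closedBall x₀ a)ᶜ ≤
      α a * ((betaFun ν x₀ m₁ α r).toReal * ν.real (closedBall x₀ m₁)
        - ν.real (closedBall x₀ r)ᶜ) := by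
  have hpt : ν (closedBall x₀ m₁) ≠ ⊤ := measure_ne_top _ _
  set S := ⨆ a ∈ Set.Ici r, ν ((closedBall x₀ a)ᶜ) / ENNReal.ofReal (α a) with hS
  have h0 : ν (closedBall x₀ m₁) * betaFun ν x₀ m₁ α r = S + ν ((closedBall x₀ r)ᶜ) := by
    unfold betaFun
    rw [← mul_assoc, ENNReal.mul_inv_cancel hp.ne' hpt, one_mul]
  have hne : S + ν ((closedBall x₀ r)ᶜ) ≠ ⊤ := h0 ▸ ENNReal.mul_ne_top hpt hb
  have hSt : S ≠ ⊤ := (ENNReal.add_ne_top.1 hne).1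
  have h1 : ν ((closedBall x₀ a)ᶜ) / ENNReal.ofReal (α a) ≤ S :=
    le_iSup₂ (f := fun a (_ : a ∈ Set.Ici r) =>
      ν ((closedBall x₀ a)ᶜ) / ENNReal.ofReal (α a)) a ha
  rw [ENNReal.div_le_iff_le_mul (Or.inr hSt) (Or.inl ENNReal.ofReal_ne_top)] at h1
  have h2 := ENNReal.toReal_mono (ENNReal.mul_ne_top hSt ENNReal.ofReal_ne_top) h1
  rw [ENNReal.toReal_mul, ENNReal.toReal_ofReal hα] at h2
  have h5 := congrArg ENNReal.toReal h0
  rw [ENNReal.toReal_mul, ENNReal.toReal_add hSt (measure_ne_top _ _)] at h5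
  simp only [Measure.real]
  have : (betaFun ν x₀ m₁ α r).toReal * (ν (closedBall x₀ m₁)).toReal
    - (ν (closedBall x₀ r)ᶜ).toReal = S.toReal := by linarith
  rw [this]; linarith

theorem gneg (ν : Measure X) [IsProbabilityMeasure ν] (x₀ : X) (m₁ m₂ : ℝ) (hm₁ : 0 < m₁)
    (α αt : ℝ → ℝ) (h3 : IsTail α) (h4 : IsTail αt) (hm : m₁ ≤ m₂)
    (hα : ∀ r : ℝ, 0 < r → 0 < α r)
    (hp : 0 < ν (closedBall x₀ m₁)) (hb : betaTilde ν x₀ m₁ α m₁ ≠ ⊤)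
    (g : Lp ℝ 2 ν) (hg : g ∈ Gcone ν x₀ m₁ m₂ α αt) :
    ∫ x, max (-(g x)) 0 ∂ν ≤
      (betaTilde ν x₀ m₁ α m₁).toReal * ∫ x in closedBall x₀ m₁, g x ∂ν := by
  have hgi : Integrable g ν := (Lp.memLp g).integrable (by norm_num)
  set b := (betaTilde ν x₀ m₁ α m₁).toReal with hbdef
  have hb0 : 0 ≤ b := ENNReal.toReal_nonneg
  set S : Set X := {x | g x < 0} with hS
  have hSm : MeasurableSet S := (Lp.stronglyMeasurable g).measurable measurableSet_Iio
  have hBm : MeasurableSet (closedBall x₀ m₁) := isClosed_closedBall.measurableSet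
  set φ : X → ℝ := fun x => (closedBall x₀ m₁).indicator (fun _ => b) x + S.indicator (fun _ => 1) x
    with hφ
  have hφ0 : ∀ x, 0 ≤ φ x := fun x =>
    add_nonneg (indicator_nonneg (fun _ _ => hb0) x) (indicator_nonneg (fun _ _ => zero_le_one) x)
  have i1 : Integrable ((closedBall x₀ m₁).indicator (fun _ => b)) ν :=
    (integrable_const b).indicator hBm
  have i2 : Integrable (S.indicator (fun _ => (1:ℝ))) ν := (integrable_const 1).indicator hSm
  have hint : ∫ x, φ x ∂ν = b * ν.real (closedBall x₀ m₁) + ν.real S := by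
    rw [hφ, integral_add i1 i2, integral_indicator_const _ hBm, integral_indicator_const _ hSm]
    simp [mul_comm]
  have key := G_test ν x₀ m₁ m₂ α αt g hg φ
    ((memLp_indicator_const 2 hBm b (Or.inr (measure_ne_top _ _))).add
      (memLp_indicator_const 2 hSm 1 (Or.inr (measure_ne_top _ _)))) (fun x _ => hφ0 x) ?_ ?_
  · have e : ∀ x, φ x * g x = (closedBall x₀ m₁).indicator (fun y => b * g y) x
        - max (-(g x)) 0 := by
      intro x
      simp only [hφ, add_mul]
      have : S.indicator (fun _ => (1:ℝ)) x * g x = - max (-(g x)) 0 := by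
        by_cases h : g x < 0
        · rw [indicator_of_mem (show x ∈ S from h), max_eq_left (by linarith)]; ring
        · rw [indicator_of_notMem (show x ∉ S from h), max_eq_right (by linarith)]; ring
      rw [this]
      by_cases h : x ∈ closedBall x₀ m₁ <;> simp [h] <;> ring
    simp_rw [e] at key
    rw [integral_sub ((hgi.const_mul b).indicator hBm) hgi.neg_part, integral_indicator hBm,
      integral_const_mul] at key
    linarith
  · intro a ha
    have ha0 : 0 < a := hm₁.trans_le ha
    have hu := betaTilde_use ν x₀ m₁ m₁ α hp hb a ha (hα a ha0)
    have hCm : MeasurableSet (closedBall x₀ a)ᶜ := isClosed_closedBall.measurableSet.compl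
    have : ∫ x in (closedBall x₀ a)ᶜ, max (φ x) 0 ∂ν ≤ ∫ x in (closedBall x₀ a)ᶜ, 1 ∂ν := by
      refine setIntegral_mono_on (i1.add i2).pos_part.integrableOn (integrable_const _).integrableOn hCm ?_
      intro x hx
      have hx1 : x ∉ closedBall x₀ m₁ := fun h => hx (closedBall_subset_closedBall ha h)
      rw [max_eq_left (hφ0 x)]
      simp only [hφ, indicator_of_notMem hx1, zero_add]
      exact indicator_le_self' (fun _ _ => zero_le_one) x
    rw [setIntegral_const, smul_eq_mul, mul_one] at this
    rw [hint]
    have : 0 ≤ α a * ν.real S := mul_nonneg (hα a ha0).le measureReal_nonneg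
    linarith
  · intro a ha
    have : ∀ x, max (-(φ x)) 0 = 0 := fun x => max_eq_right (by linarith [hφ0 x])
    simp_rw [this]
    rw [integral_zero]
    exact mul_nonneg (h4.2.1 a (by linarith)) (integral_nonneg hφ0)

theorem gpos (ν : Measure X) [IsProbabilityMeasure ν] (x₀ : X) (m₁ m₂ r : ℝ) (hm₁ : 0 < m₁)
    (α αt : ℝ → ℝ) (h3 : IsTail α) (h4 : IsTail αt) (hm : m₁ ≤ m₂) (hr : m₂ ≤ r)
    (hp : 0 < ν (closedBall x₀ m₁)) (hb : betaFun ν x₀ m₁ αt r ≠ ⊤)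
    (g : Lp ℝ 2 ν) (hg : g ∈ Gcone ν x₀ m₁ m₂ α αt) :
    ∫ x in (closedBall x₀ r)ᶜ, max (g x) 0 ∂ν ≤
      (betaFun ν x₀ m₁ αt r).toReal * ∫ x in closedBall x₀ m₁, g x ∂ν := by
  have hgi : Integrable g ν := (Lp.memLp g).integrable (by norm_num)
  have hr0 : 0 < r := by linarith
  set b := (betaFun ν x₀ m₁ αt r).toReal with hbdef
  have hb0 : 0 ≤ b := ENNReal.toReal_nonneg
  have hBm : ∀ a, MeasurableSet (closedBall x₀ a) := fun a => isClosed_closedBall.measurableSet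
  set S : Set X := {x | 0 < g x} ∩ (closedBall x₀ r)ᶜ with hS
  have hSm : MeasurableSet S :=
    ((Lp.stronglyMeasurable g).measurable measurableSet_Ioi).inter (hBm r).compl
  set φ : X → ℝ := fun x => (closedBall x₀ m₁).indicator (fun _ => b) x - S.indicator (fun _ => 1) x
    with hφ
  have hSr : ∀ x ∈ closedBall x₀ r, x ∉ S := fun x hx h => h.2 hx
  have i1 : Integrable ((closedBall x₀ m₁).indicator (fun _ => b)) ν :=
    (integrable_const b).indicator (hBm _)
  have i2 : Integrable (S.indicator (fun _ => (1:ℝ))) ν := (integrable_const 1).indicator hSm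
  have hint : ∫ x, φ x ∂ν = b * ν.real (closedBall x₀ m₁) - ν.real S := by
    rw [hφ, integral_sub i1 i2, integral_indicator_const _ (hBm _), integral_indicator_const _ hSm]
    simp [mul_comm]
  have hSle : ν.real S ≤ ν.real (closedBall x₀ r)ᶜ := measureReal_mono inter_subset_right
  have hD : 0 ≤ b * ν.real (closedBall x₀ m₁) - ν.real (closedBall x₀ r)ᶜ := by
    have h0 : ν (closedBall x₀ m₁) * betaFun ν x₀ m₁ αt r ≥ ν ((closedBall x₀ r)ᶜ) := by
      unfold betaFun
      rw [← mul_assoc, ENNReal.mul_inv_cancel hp.ne' (measure_ne_top _ _), one_mul]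
      exact le_add_self
    have h1 := ENNReal.toReal_mono (ENNReal.mul_ne_top (measure_ne_top _ _) hb) h0
    rw [ENNReal.toReal_mul] at h1
    simp only [Measure.real]
    linarith
  have key := G_test ν x₀ m₁ m₂ α αt g hg φ
    ((memLp_indicator_const 2 (hBm _) b (Or.inr (measure_ne_top _ _))).sub
      (memLp_indicator_const 2 hSm 1 (Or.inr (measure_ne_top _ _)))) ?_ ?_ ?_
  · have e : ∀ x, φ x * g x = (closedBall x₀ m₁).indicator (fun y => b * g y) x
        - (closedBall x₀ r)ᶜ.indicator (fun y => max (g y) 0) x := by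
      intro x
      simp only [hφ, sub_mul]
      have : S.indicator (fun _ => (1:ℝ)) x * g x =
          (closedBall x₀ r)ᶜ.indicator (fun y => max (g y) 0) x := by
        by_cases hx : x ∈ closedBall x₀ r
        · rw [indicator_of_notMem (hSr x hx), indicator_of_notMem (show x ∉ (closedBall x₀ r)ᶜ from fun h => h hx)]; ring
        · rw [indicator_of_mem (show x ∈ (closedBall x₀ r)ᶜ from hx)]
          by_cases h : 0 < g x
          · rw [indicator_of_mem (show x ∈ S from ⟨h, hx⟩), max_eq_left h.le]; ring
          · rw [indicator_of_notMem (show x ∉ S from fun h' => h h'.1), max_eq_right (by linarith)]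
            ring
      rw [this]
      by_cases h : x ∈ closedBall x₀ m₁ <;> simp [h]
    simp_rw [e] at key
    rw [integral_sub ((hgi.const_mul b).indicator (hBm _)) (hgi.pos_part.indicator (hBm _).compl),
      integral_indicator (hBm _), integral_indicator (hBm _).compl, integral_const_mul] at key
    linarith
  · intro x hx
    simp only [hφ, indicator_of_notMem (hSr x (closedBall_subset_closedBall hr hx)), sub_zero]
    exact indicator_nonneg (fun _ _ => hb0) x
  · intro a ha
    have : ∫ x in (closedBall x₀ a)ᶜ, max (φ x) 0 ∂ν = 0 := by
      refine setIntegral_eq_zero_of_forall_eq_zero fun x hx => ?_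
      have hx1 : x ∉ closedBall x₀ m₁ := fun h => hx (closedBall_subset_closedBall ha h)
      simp only [hφ, indicator_of_notMem hx1, zero_sub]
      exact max_eq_right (neg_nonpos.2 (indicator_nonneg (fun _ _ => zero_le_one) x))
    rw [this, hint]
    exact mul_nonneg (h3.2.1 a (by linarith)) (by linarith)
  · intro a ha
    have ha0 : 0 < a := by linarith
    have hu := betaFun_use ν x₀ m₁ r αt hp hb (max a r) (le_max_right _ _)
      (h4.2.1 _ (lt_max_of_lt_left ha0))
    have hmono := h4.1 a (max a r) ha0 (le_max_left _ _)
    have hle : ∫ x in (closedBall x₀ a)ᶜ, max (-(φ x)) 0 ∂ν ≤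
        ∫ x in (closedBall x₀ a)ᶜ, (closedBall x₀ (max a r))ᶜ.indicator (fun _ => (1:ℝ)) x ∂ν := by
      refine setIntegral_mono_on (i1.sub i2).neg_part.integrableOn
        ((integrable_const _).indicator (hBm _).compl).integrableOn (hBm a).compl ?_
      intro x hx
      have hx1 : x ∉ closedBall x₀ m₁ :=
        fun h => hx (closedBall_subset_closedBall (hm.trans ha) h)
      simp only [hφ, indicator_of_notMem hx1, zero_sub, neg_neg]
      rw [max_eq_left (indicator_nonneg (fun _ _ => zero_le_one) x)]
      by_cases h : x ∈ S
      · have h' : x ∈ (closedBall x₀ (max a r))ᶜ := by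
          intro h'
          rw [mem_closedBall, le_max_iff] at h'
          rcases h' with h' | h'
          · exact hx h'
          · exact h.2 h'
        rw [indicator_of_mem h, indicator_of_mem h']
      · rw [indicator_of_notMem h]
        exact indicator_nonneg (fun _ _ => zero_le_one) x
    have hle2 : ∫ x in (closedBall x₀ a)ᶜ,
        (closedBall x₀ (max a r))ᶜ.indicator (fun _ => (1:ℝ)) x ∂ν
        ≤ ν.real (closedBall x₀ (max a r))ᶜ := by
      refine (setIntegral_le_integral ((integrable_const _).indicator (hBm _).compl)
        (Eventually.of_forall fun x => indicator_nonneg (fun _ _ => zero_le_one) x)).trans_eq ?_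
      rw [integral_indicator_const _ (hBm _).compl]; simp
    rw [hint]
    calc _ ≤ _ := hle.trans (hle2.trans hu)
      _ ≤ αt a * (b * ν.real (closedBall x₀ m₁) - ν.real (closedBall x₀ r)ᶜ) :=
        mul_le_mul_of_nonneg_right hmono hD
      _ ≤ _ := mul_le_mul_of_nonneg_left (by linarith) (h4.2.1 a ha0)

theorem real_bound (μ ν : Measure X) [IsProbabilityMeasure μ] [IsProbabilityMeasure ν]
    (x₀ : X) (r L : ℝ) (hL0 : 0 ≤ L)
    (K : X → X → ℝ) (hKmeas : Measurable (Function.uncurry K))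
    (hKpos : ∀ x y, 0 < K x y) (hKle : ∀ x y, K x y ≤ 1)
    (hK : ∀ x ∈ closedBall x₀ r, ∀ y ∈ closedBall x₀ r, L ≤ K x y)
    (f : X → ℝ) (hf : Integrable f μ) (g : X → ℝ) (hgm : StronglyMeasurable g)
    (hg : Integrable g ν) :
    L * (∫ y in closedBall x₀ r, max (g y) 0 ∂ν) * (∫ x in closedBall x₀ r, max (f x) 0 ∂μ)
      - (∫ y, max (-(g y)) 0 ∂ν) * (∫ x, max (f x) 0 ∂μ)
      - (∫ y, max (g y) 0 ∂ν) * (∫ x, max (-(f x)) 0 ∂μ)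
      ≤ ∫ x, Lker (fun a b => K b a) ν g x * f x ∂μ := by
  have hBm : MeasurableSet (closedBall x₀ r) := isClosed_closedBall.measurableSet
  set N := ∫ y, max (-(g y)) 0 ∂ν with hN
  set Q := ∫ y, max (g y) 0 ∂ν with hQ
  set q := ∫ y in closedBall x₀ r, max (g y) 0 ∂ν with hq
  set h : X → ℝ := Lker (fun a b => K b a) ν g with hh
  have hN0 : 0 ≤ N := integral_nonneg fun y => le_max_right _ _
  have hQ0 : 0 ≤ Q := integral_nonneg fun y => le_max_right _ _
  have hq0 : 0 ≤ q := integral_nonneg fun y => le_max_right _ _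
  have hKg : ∀ x, Integrable (fun y => K y x * g y) ν := by
    intro x
    refine hg.bdd_mul (c := 1) ?_ ?_
    · exact (hKmeas.comp (measurable_id.prodMk measurable_const)).aestronglyMeasurable
    · exact Eventually.of_forall fun y => by
        rw [Real.norm_eq_abs, abs_of_pos (hKpos y x)]; exact hKle y x
  have hhm : StronglyMeasurable h := by
    have : StronglyMeasurable (fun p : X × X => K p.2 p.1 * g p.2) :=
      (hKmeas.comp measurable_swap).stronglyMeasurable.mul (hgm.comp_measurable measurable_snd)
    exact this.integral_prod_right
  have hup : ∀ x, h x ≤ Q := by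
    intro x
    refine integral_mono (hKg x) hg.pos_part fun y => ?_
    have := hKpos y x
    have := hKle y x
    have := le_max_left (g y) 0
    have := le_max_right (g y) 0
    simp only
    nlinarith
  have hlow : ∀ x, -N ≤ h x := by
    intro x
    rw [hN, ← integral_neg]
    refine integral_mono hg.neg_part.neg (hKg x) fun y => ?_
    have := hKpos y x
    have := hKle y x
    have := le_max_left (-(g y)) 0
    have := le_max_right (-(g y)) 0
    simp only
    nlinarith
  have hlow2 : ∀ x ∈ closedBall x₀ r, L * q - N ≤ h x := by
    intro x hx
    have e : L * q - N = ∫ y, ((closedBall x₀ r).indicator (fun y => L * max (g y) 0) y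
        - max (-(g y)) 0) ∂ν := by
      rw [integral_sub ((hg.pos_part.const_mul L).indicator hBm) hg.neg_part,
        integral_indicator hBm, integral_const_mul]
    rw [e]
    refine integral_mono (((hg.pos_part.const_mul L).indicator hBm).sub hg.neg_part) (hKg x)
      fun y => ?_
    have h1 := hKpos y x
    have h2 := hKle y x
    have e2 : g y = max (g y) 0 - max (-(g y)) 0 := by
      rcases le_total (g y) 0 with h | h
      · rw [max_eq_right h, max_eq_left (by linarith)]; ring
      · rw [max_eq_left h, max_eq_right (by linarith)]; ring
    have h3 := le_max_right (g y) 0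
    have h4 := le_max_right (-(g y)) 0
    have e3 : K y x * g y = K y x * max (g y) 0 - K y x * max (-(g y)) 0 := by
      rw [← mul_sub, ← e2]
    have h5 : K y x * max (-(g y)) 0 ≤ 1 * max (-(g y)) 0 := mul_le_mul_of_nonneg_right h2 h4
    simp only
    rw [e3]
    by_cases hy : y ∈ closedBall x₀ r
    · rw [indicator_of_mem hy]
      have := mul_le_mul_of_nonneg_right (hK y hy x hx) h3
      linarith
    · rw [indicator_of_notMem hy]
      have := mul_nonneg h1.le h3
      linarith
  have hhf : Integrable (fun x => h x * f x) μ := by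
    refine hf.bdd_mul (c := max N Q) hhm.aestronglyMeasurable (Eventually.of_forall fun x => ?_)
    rw [Real.norm_eq_abs, abs_le]
    exact ⟨by linarith [hlow x, le_max_left N Q], (hup x).trans (le_max_right _ _)⟩
  have e : L * q * (∫ x in closedBall x₀ r, max (f x) 0 ∂μ) - N * (∫ x, max (f x) 0 ∂μ)
      - Q * (∫ x, max (-(f x)) 0 ∂μ) = ∫ x, ((closedBall x₀ r).indicator
        (fun x => L * q * max (f x) 0) x - N * max (f x) 0 - Q * max (-(f x)) 0) ∂μ := by
    have j1 : Integrable (fun x => (closedBall x₀ r).indicator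
        (fun x => L * q * max (f x) 0) x) μ := (hf.pos_part.const_mul _).indicator hBm
    have j2 : Integrable (fun x => N * max (f x) 0) μ := hf.pos_part.const_mul _
    have j3 : Integrable (fun x => Q * max (-(f x)) 0) μ := hf.neg_part.const_mul _
    have j4 : Integrable (fun x => (closedBall x₀ r).indicator
        (fun x => L * q * max (f x) 0) x - N * max (f x) 0) μ := j1.sub j2
    rw [integral_sub j4 j3, integral_sub j1 j2, integral_indicator hBm, integral_const_mul,
      integral_const_mul, integral_const_mul]
  rw [e]
  refine integral_mono ((((hf.pos_part.const_mul _).indicator hBm).sub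
    (hf.pos_part.const_mul _)).sub (hf.neg_part.const_mul _)) hhf fun x => ?_
  simp only
  have e2 : f x = max (f x) 0 - max (-(f x)) 0 := by
    rcases le_total (f x) 0 with h | h
    · rw [max_eq_right h, max_eq_left (by linarith)]; ring
    · rw [max_eq_left h, max_eq_right (by linarith)]; ring
  have h3 := le_max_right (f x) 0
  have h4 := le_max_right (-(f x)) 0
  have e3 : h x * f x = h x * max (f x) 0 - h x * max (-(f x)) 0 := by
    rw [← mul_sub, ← e2]
  have h5 := mul_le_mul_of_nonneg_right (hup x) h4
  rw [e3]
  by_cases hx : x ∈ closedBall x₀ r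
  · rw [indicator_of_mem hx]
    have := mul_le_mul_of_nonneg_right (hlow2 x hx) h3
    linarith
  · rw [indicator_of_notMem hx]
    have := mul_le_mul_of_nonneg_right (hlow x) h3
    linarith

theorem pos_sub_neg {Y : Type*} [MeasurableSpace Y] {μ : Measure Y} (f : Y → ℝ)
    (hf : Integrable f μ) :
    ∫ x, max (f x) 0 ∂μ - ∫ x, max (-(f x)) 0 ∂μ = ∫ x, f x ∂μ := by
  rw [← integral_sub hf.pos_part hf.neg_part]
  congr 1
  ext x
  rcases le_total (f x) 0 with h | h
  · rw [max_eq_right h, max_eq_left (by linarith)]; ring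
  · rw [max_eq_left h, max_eq_right (by linarith)]; ring

theorem arith (l L P F N Q G a b A B x y A' B' I : ℝ)
    (hl1 : l ≤ 1) (hL : L = max l 0) (hP : P - F = 1) (hQ : Q - N = 1) (hF0 : 0 ≤ F) (hFa : F ≤ a)
    (ha : a ≤ 1/2) (hb0 : 0 ≤ b) (hb : b ≤ 1/2) (hN0 : 0 ≤ N) (hN : N ≤ b * G) (hG : G ≤ Q)
    (hx : x + A' = P) (hy : y + B' = Q) (hA0 : 0 ≤ A') (hA : A' ≤ A) (hB0 : 0 ≤ B')
    (hB : B' ≤ B * G) (hBn : 0 ≤ B)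
    (hI : L * y * x - N * P - Q * F ≤ I) :
    l - a - 4 * b - 2 * A - 3 * B ≤ I := by
  have hG2 : G ≤ 2 := by
    by_contra h
    push Not at h
    nlinarith
  have hN2 : N ≤ 2 * b := by nlinarith
  have hB2 : B' ≤ 2 * B := by nlinarith
  have hNP : N * P ≤ 3 * b := by
    have : N * P ≤ N * (3/2) := mul_le_mul_of_nonneg_left (by linarith) hN0
    linarith
  have hQF : Q * F ≤ a + b := by
    have h1 : N * F ≤ N * (1/2) := mul_le_mul_of_nonneg_left (by linarith) hN0
    have : Q * F = F + N * F := by rw [show Q = 1 + N by linarith]; ring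
    linarith
  have hyx : 1 - 2 * A - 3 * B ≤ y * x := by
    have e : y * x = P * Q - A' * Q - B' * P + A' * B' := by
      rw [← hx, ← hy]; ring
    have h1 : 1 ≤ P * Q := by nlinarith
    have h2 : A' * Q ≤ A' * 2 := mul_le_mul_of_nonneg_left (by linarith) hA0
    have h3 : B' * P ≤ B' * (3/2) := mul_le_mul_of_nonneg_left (by linarith) hB0
    have h4 := mul_nonneg hA0 hB0
    linarith
  have hLl : l ≤ L := hL ▸ le_max_left _ _
  have hL0 : 0 ≤ L := hL ▸ le_max_right _ _
  have hL1 : L ≤ 1 := hL ▸ max_le hl1 zero_le_one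
  have h6 : L * (1 - 2 * A - 3 * B) ≤ L * (y * x) := mul_le_mul_of_nonneg_left hyx hL0
  have h7 : L * (2 * A + 3 * B) ≤ 1 * (2 * A + 3 * B) :=
    mul_le_mul_of_nonneg_right hL1 (by linarith)
  nlinarith

theorem statement10 (μ ν : Measure X) [IsProbabilityMeasure μ] [IsProbabilityMeasure ν]
    (x₀ : X) (m₁ m₂ : ℝ) (hm₁ : 0 < m₁) (hm₁₂ : m₁ ≤ m₂)
    (α₁ αt₁ α₂ αt₂ : ℝ → ℝ)
    (h1 : IsTail α₁) (h2 : IsTail αt₁) (h3 : IsTail α₂) (h4 : IsTail αt₂)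
    (hα₁pos : ∀ r : ℝ, 0 < r → 0 < α₁ r) (hα₂pos : ∀ r : ℝ, 0 < r → 0 < α₂ r)
    (hμm : 0 < μ (closedBall x₀ m₁)) (hνm : 0 < ν (closedBall x₀ m₁))
    (K : X → X → ℝ) (hKmeas : Measurable (Function.uncurry K))
    (hKpos : ∀ x y, 0 < K x y) (hKle : ∀ x y, K x y ≤ 1)
    (l : ℝ → ℝ) (hl : IsLowerDecay K x₀ l)
    (hαt₁half : αt₁ m₂ ≤ 1 / 2)
    (hβ₂half : betaTilde ν x₀ m₁ α₂ m₁ ≤ 1 / 2)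
    (r : ℝ) (hr : m₂ ≤ r) (hlr : l r ≤ 1)
    (f : Lp ℝ 2 μ) (hf : f ∈ Fcone μ x₀ m₁ m₂ α₁ αt₁) (hfnorm : ∫ x, f x ∂μ = 1)
    (g : Lp ℝ 2 ν) (hg : g ∈ Gcone ν x₀ m₁ m₂ α₂ αt₂) (hgnorm : ∫ x, g x ∂ν = 1) :
    ((l r : ℝ) : EReal) - ((αt₁ m₂ : ℝ) : EReal)
      - ((4 : ℝ) : EReal) * (betaTilde ν x₀ m₁ α₂ m₁ : EReal)
      - ((4 : ℝ) : EReal) * ((α₁ r : ℝ) : EReal)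
      - ((4 : ℝ) : EReal) * ((αt₁ r : ℝ) : EReal)
      - ((5 : ℝ) : EReal) * (betaFun ν x₀ m₁ αt₂ r : EReal)
      - ((5 : ℝ) : EReal) * (betaTilde ν x₀ m₁ α₂ r : EReal)
      ≤ ((∫ x, Lker (fun a b => K b a) ν (⇑g) x * f x ∂μ : ℝ) : EReal) := by
  have hm₂ : 0 < m₂ := by linarith
  have hr0 : 0 < r := by linarith
  have hfi : Integrable f μ := (Lp.memLp f).integrable (by norm_num)
  have hgi : Integrable g ν := (Lp.memLp g).integrable (by norm_num)
  have hBm : ∀ a, MeasurableSet (closedBall x₀ a) := fun a => isClosed_closedBall.measurableSet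
  have hbt : betaTilde ν x₀ m₁ α₂ m₁ ≠ ⊤ := ne_top_of_le_ne_top (by simp) hβ₂half
  have hbt2 : betaTilde ν x₀ m₁ α₂ r ≠ ⊤ := by
    refine ne_top_of_le_ne_top hbt ?_
    unfold betaTilde
    refine mul_le_mul_right ?_ _
    exact biSup_mono fun a ha => le_trans (hm₁₂.trans hr) ha
  by_cases hbf : betaFun ν x₀ m₁ αt₂ r = ⊤
  · rw [hbf, EReal.coe_ennreal_top, EReal.coe_mul_top_of_pos (by norm_num), EReal.sub_top]
    simp [sub_eq_add_neg]
  have c1 : (betaTilde ν x₀ m₁ α₂ m₁ : EReal) = ((betaTilde ν x₀ m₁ α₂ m₁).toReal : EReal) :=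
    (EReal.coe_ennreal_toReal hbt).symm
  have c2 : (betaTilde ν x₀ m₁ α₂ r : EReal) = ((betaTilde ν x₀ m₁ α₂ r).toReal : EReal) :=
    (EReal.coe_ennreal_toReal hbt2).symm
  have c3 : (betaFun ν x₀ m₁ αt₂ r : EReal) = ((betaFun ν x₀ m₁ αt₂ r).toReal : EReal) :=
    (EReal.coe_ennreal_toReal hbf).symm
  rw [c1, c2, c3]
  norm_cast
  have hb0 : 0 ≤ (betaTilde ν x₀ m₁ α₂ r).toReal := ENNReal.toReal_nonneg
  have hb1 : 0 ≤ (betaTilde ν x₀ m₁ α₂ m₁).toReal := ENNReal.toReal_nonneg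
  have hb2 : 0 ≤ (betaFun ν x₀ m₁ αt₂ r).toReal := ENNReal.toReal_nonneg
  have hbh : (betaTilde ν x₀ m₁ α₂ m₁).toReal ≤ 1 / 2 := by
    have := ENNReal.toReal_mono (by simp) hβ₂half
    simpa using this
  have hI := real_bound μ ν x₀ r (max (l r) 0) (le_max_right _ _) K hKmeas hKpos hKle
    (fun x hx y hy => max_le (hl.2 r hr0 x hx y hy) (hKpos x y).le) f hfi g
    (Lp.stronglyMeasurable g) hgi
  have hFa : ∫ x, max (-(f x)) 0 ∂μ ≤ αt₁ m₂ := by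
    have h := hf.2.2 m₂ le_rfl
    rw [hfnorm, mul_one] at h
    refine le_of_eq_of_le ?_ h
    rw [← integral_indicator (hBm _).compl]
    refine integral_congr_ae ?_
    filter_upwards [hf.1] with x hx
    by_cases hxb : x ∈ closedBall x₀ m₂
    · rw [indicator_of_notMem (show x ∉ (closedBall x₀ m₂)ᶜ from fun h => h hxb)]
      exact max_eq_right (by linarith [hx hxb])
    · rw [indicator_of_mem (show x ∈ (closedBall x₀ m₂)ᶜ from hxb)]
  have hA := hf.2.1 r (hm₁₂.trans hr)
  rw [hfnorm, mul_one] at hA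
  have hGQ : ∫ x in closedBall x₀ m₁, g x ∂ν ≤ ∫ x, max (g x) 0 ∂ν := by
    refine (setIntegral_mono hgi.integrableOn hgi.pos_part.integrableOn
      (fun x => le_max_left (g x) 0)).trans ?_
    exact setIntegral_le_integral hgi.pos_part (Eventually.of_forall fun x => le_max_right _ _)
  have hfin := arith (l r) (max (l r) 0) _ _ _ _ _ (αt₁ m₂) _ (α₁ r) _ _ _ _ _ _ hlr rfl
    ((pos_sub_neg f hfi).trans hfnorm) ((pos_sub_neg g hgi).trans hgnorm)
    (integral_nonneg fun y => le_max_right _ _) hFa hαt₁half hb1 hbh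
    (integral_nonneg fun y => le_max_right _ _)
    (gneg ν x₀ m₁ m₂ hm₁ α₂ αt₂ h3 h4 hm₁₂ hα₂pos hνm hbt g hg) hGQ
    (integral_add_compl (hBm r) hfi.pos_part) (integral_add_compl (hBm r) hgi.pos_part)
    (integral_nonneg fun y => le_max_right _ _) hA
    (integral_nonneg fun y => le_max_right _ _)
    (gpos ν x₀ m₁ m₂ r hm₁ α₂ αt₂ h3 h4 hm₁₂ hr hνm hbf g hg) hb2 hI
  have := h1.2.1 r hr0
  have := h2.2.1 r hr0
  linarith

end Paper
end
end

section
/- Let K : 𝒳×𝒳 → (0,1] be measurable with lower decay l, let (α₁,α̃₁) be a pair of tail functions with α₁ strictly positive, let β₁ be the function β built from μ and (α₁,α̃₁), and define ι₁(r) := l(max(r, m₂))/(1 + β₁(m₂)). Then for every g ∈ 𝓖^μ_{α₁,α̃₁} with g ≥ 0 μ-a.s. and ∫ g dμ > 0, setting λ := ∫ g dμ > 0, the function g̃ := λ⁻¹·L_{K^⊤,μ}(g) satisfies ι₁(r) ≤ g̃(x) ≤ 1 for all r ≥ 0 and all x ∈ B_r; in particular, every non-zero element of 𝒜 := {L_{K^⊤,μ}(g)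 : g ∈ 𝓖^μ_{α₁,α̃₁}, g ≥ 0 μ-a.s.} is of the form λ·g̃ with λ > 0 and ι₁(r) ≤ g̃ ≤ 1 on B_r for all r ≥ 0. -/
open MeasureTheory Metric Set Filter
open scoped ENNReal NNReal Topology

noncomputable section

namespace Paper

variable {X : Type*} [MeasurableSpace X] [MetricSpace X] [PolishSpace X] [BorelSpace X]

lemma key_ineq (μ : Measure X) [IsProbabilityMeasure μ] (x₀ : X)
    (m₁ m₂ : ℝ) (hm₁ : 0 < m₁) (hm₁₂ : m₁ ≤ m₂)
    (α₁ αt₁ : ℝ → ℝ) (h2 : IsTail αt₁)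
    (hα₁pos : ∀ r : ℝ, 0 < r → 0 < α₁ r)
    (hμm : 0 < μ (closedBall x₀ m₁))
    (g : Lp ℝ 2 μ) (hg : g ∈ Gcone μ x₀ m₁ m₂ α₁ αt₁)
    (hgpos : ∀ᵐ x ∂μ, 0 ≤ g x) (hgi : Integrable (⇑g) μ)
    (hb : betaFun μ x₀ m₁ αt₁ m₂ ≠ ⊤) :
    ∫ x, g x ∂μ ≤ (1 + (betaFun μ x₀ m₁ αt₁ m₂).toReal) *
      ∫ x in closedBall x₀ m₂, g x ∂μ := by
  set b := (betaFun μ x₀ m₁ αt₁ m₂).toReal with hbdef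
  have hb0 : 0 ≤ b := ENNReal.toReal_nonneg
  set S : ℝ≥0∞ := ⨆ a ∈ Set.Ici m₂, μ ((closedBall x₀ a)ᶜ) / ENNReal.ofReal (αt₁ a) with hS
  have hmt : μ (closedBall x₀ m₁) ≠ ⊤ := measure_ne_top _ _
  have hbS : betaFun μ x₀ m₁ αt₁ m₂ * μ (closedBall x₀ m₁) = S + μ ((closedBall x₀ m₂)ᶜ) := by
    unfold betaFun
    rw [mul_comm, ← mul_assoc, ENNReal.mul_inv_cancel hμm.ne' hmt, one_mul]
  have hSt : S ≠ ⊤ := by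
    have h : S + μ ((closedBall x₀ m₂)ᶜ) ≠ ⊤ := by
      rw [← hbS]; exact ENNReal.mul_ne_top hb hmt
    exact (ENNReal.add_ne_top.1 h).1
  have hbS' : b * μ.real (closedBall x₀ m₁) = S.toReal + μ.real ((closedBall x₀ m₂)ᶜ) := by
    have := congrArg ENNReal.toReal hbS
    rwa [ENNReal.toReal_mul, ENNReal.toReal_add hSt (measure_ne_top _ _)] at this
  have hSa : ∀ a, m₂ ≤ a → μ.real ((closedBall x₀ a)ᶜ) ≤ αt₁ a * S.toReal := by
    intro a ha
    have h0 : μ ((closedBall x₀ a)ᶜ) / ENNReal.ofReal (αt₁ a) ≤ S :=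
      le_iSup₂_of_le a ha le_rfl
    have h3 : μ ((closedBall x₀ a)ᶜ) ≤ S * ENNReal.ofReal (αt₁ a) :=
      (ENNReal.div_le_iff_le_mul (Or.inr hSt) (Or.inl ENNReal.ofReal_ne_top)).1 h0
    have h4 := ENNReal.toReal_mono (ENNReal.mul_ne_top hSt ENNReal.ofReal_ne_top) h3
    rw [ENNReal.toReal_mul, ENNReal.toReal_ofReal (h2.2.1 a (by linarith))] at h4
    rw [mul_comm]; exact h4
  have hB : ∀ r, MeasurableSet (closedBall x₀ r) := fun r => measurableSet_closedBall
  let F : X → ℝ := (closedBall x₀ m₁).indicator (fun _ => b) -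
    ((closedBall x₀ m₂)ᶜ).indicator (fun _ => (1:ℝ))
  have hF1 : MemLp ((closedBall x₀ m₁).indicator (fun _ => b)) 2 μ :=
    memLp_indicator_const 2 (hB _) b (Or.inr hmt)
  have hF2 : MemLp (((closedBall x₀ m₂)ᶜ).indicator (fun _ => (1:ℝ))) 2 μ :=
    memLp_indicator_const 2 (hB _).compl 1 (Or.inr (measure_ne_top _ _))
  have hF : MemLp F 2 μ := hF1.sub hF2
  have hsub : closedBall x₀ m₁ ⊆ closedBall x₀ m₂ := closedBall_subset_closedBall hm₁₂
  have hae : ⇑(hF.toLp F) =ᵐ[μ] F := hF.coeFn_toLp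
  have hintF : ∫ x, F x ∂μ = S.toReal := by
    have : ∫ x, F x ∂μ = b * μ.real (closedBall x₀ m₁) - μ.real ((closedBall x₀ m₂)ᶜ) := by
      simp only [F, Pi.sub_apply]
      rw [integral_sub (hF1.integrable one_le_two) (hF2.integrable one_le_two),
        integral_indicator (hB _), integral_indicator (hB _).compl]
      simp [mul_comm]
    rw [this, hbS']; ring
  have hmem : hF.toLp F ∈ Fcone μ x₀ m₁ m₂ α₁ αt₁ := by
    have hi : ∫ x, (hF.toLp F) x ∂μ = S.toReal := by rw [integral_congr_ae hae, hintF]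
    refine ⟨?_, ?_, ?_⟩
    · filter_upwards [hae] with x hx hxm
      rw [hx]
      simp only [F, Pi.sub_apply]
      rw [indicator_of_notMem (s := (closedBall x₀ m₂)ᶜ) (by simpa using hxm), sub_zero]
      exact indicator_nonneg (fun _ _ => hb0) x
    · intro r hr
      rw [hi]
      have : ∫ x in (closedBall x₀ r)ᶜ, max ((hF.toLp F) x) 0 ∂μ = 0 := by
        apply integral_eq_zero_of_ae
        filter_upwards [ae_restrict_of_ae hae, ae_restrict_mem (hB r).compl] with x hx hxr
        rw [hx]
        simp only [F, Pi.sub_apply, Pi.zero_apply]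
        rw [indicator_of_notMem (s := (closedBall x₀ m₁))
          (fun h => hxr (closedBall_subset_closedBall hr h))]
        apply max_eq_right
        have : 0 ≤ ((closedBall x₀ m₂)ᶜ).indicator (fun _ => (1:ℝ)) x :=
          indicator_nonneg (fun _ _ => zero_le_one) x
        linarith
      rw [this]
      exact mul_nonneg (hα₁pos r (by linarith)).le ENNReal.toReal_nonneg
    · intro r hr
      rw [hi]
      have : ∫ x in (closedBall x₀ r)ᶜ, max (-(hF.toLp F) x) 0 ∂μ
          = ∫ x in (closedBall x₀ r)ᶜ, (1:ℝ) ∂μ := by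
        apply integral_congr_ae
        filter_upwards [ae_restrict_of_ae hae, ae_restrict_mem (hB r).compl] with x hx hxr
        rw [hx]
        simp only [F, Pi.sub_apply]
        have hx2 : x ∈ (closedBall x₀ m₂)ᶜ := fun h => hxr (closedBall_subset_closedBall hr h)
        rw [indicator_of_notMem (s := (closedBall x₀ m₁)) (fun h => hx2 (hsub h)),
          indicator_of_mem hx2]
        norm_num
      rw [this]
      simpa using hSa r hr
  have hfg := hg _ hmem
  have hfg2 : ∫ x, (hF.toLp F) x * g x ∂μ =
      b * ∫ x in closedBall x₀ m₁, g x ∂μ - ∫ x in (closedBall x₀ m₂)ᶜ, g x ∂μ := by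
    have : ∫ x, (hF.toLp F) x * g x ∂μ =
        ∫ x, ((closedBall x₀ m₁).indicator (fun x => b * g x) x -
          ((closedBall x₀ m₂)ᶜ).indicator (⇑g) x) ∂μ := by
      apply integral_congr_ae
      filter_upwards [hae] with x hx
      rw [hx]
      simp only [F, Pi.sub_apply]
      by_cases c1 : x ∈ closedBall x₀ m₁ <;> by_cases c2 : x ∈ (closedBall x₀ m₂)ᶜ <;>
        simp only [indicator_of_mem, indicator_of_notMem, c1, c2, not_false_eq_true] <;> ring
    rw [this, integral_sub ((hgi.const_mul b).indicator (hB _)) (hgi.indicator (hB _).compl),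
      integral_indicator (hB _), integral_indicator (hB _).compl, integral_const_mul]
  have hmono : ∫ x in closedBall x₀ m₁, g x ∂μ ≤ ∫ x in closedBall x₀ m₂, g x ∂μ :=
    setIntegral_mono_set hgi.integrableOn (ae_restrict_of_ae hgpos) hsub.eventuallyLE
  have hadd := integral_add_compl (hB m₂) hgi
  have := mul_le_mul_of_nonneg_left hmono hb0
  rw [hfg2] at hfg
  linarith

theorem statement15 (μ : Measure X) [IsProbabilityMeasure μ] (x₀ : X)
    (m₁ m₂ : ℝ) (hm₁ : 0 < m₁) (hm₁₂ : m₁ ≤ m₂)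
    (α₁ αt₁ : ℝ → ℝ) (h1 : IsTail α₁) (h2 : IsTail αt₁)
    (hα₁pos : ∀ r : ℝ, 0 < r → 0 < α₁ r)
    (hμm : 0 < μ (closedBall x₀ m₁))
    (K : X → X → ℝ) (hKmeas : Measurable (Function.uncurry K))
    (hKpos : ∀ x y, 0 < K x y) (hKle : ∀ x y, K x y ≤ 1)
    (l : ℝ → ℝ) (hl : IsLowerDecay K x₀ l) (hlnn : ∀ r, 0 ≤ l r)
    (g : Lp ℝ 2 μ) (hg : g ∈ Gcone μ x₀ m₁ m₂ α₁ αt₁)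
    (hgpos : ∀ᵐ x ∂μ, 0 ≤ g x) (hgint : 0 < ∫ x, g x ∂μ) :
    ∀ r : ℝ, 0 ≤ r → ∀ x ∈ closedBall x₀ r,
      ENNReal.ofReal (l (max r m₂)) / (1 + betaFun μ x₀ m₁ αt₁ m₂)
          ≤ ENNReal.ofReal ((∫ x', g x' ∂μ)⁻¹ * Lker (fun a b => K b a) μ (⇑g) x) ∧
        (∫ x', g x' ∂μ)⁻¹ * Lker (fun a b => K b a) μ (⇑g) x ≤ 1 := by
  have hgi : Integrable (⇑g) μ := (Lp.memLp g).integrable one_le_two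
  intro r hr x hx
  set I := ∫ x', g x' ∂μ with hI
  have hKm : Measurable (fun y => K y x) := hKmeas.comp (measurable_id.prodMk measurable_const)
  have hKi : Integrable (fun y => K y x * g y) μ := by
    refine hgi.bdd_mul (c := 1) hKm.aestronglyMeasurable (Eventually.of_forall fun y => ?_)
    rw [Real.norm_eq_abs, abs_of_pos (hKpos y x)]
    exact hKle y x
  have hL : Lker (fun a b => K b a) μ (⇑g) x = ∫ y, K y x * g y ∂μ := rfl
  rw [hL]
  constructor
  · by_cases hb : betaFun μ x₀ m₁ αt₁ m₂ = ⊤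
    · rw [hb]; simp
    have key := key_ineq μ x₀ m₁ m₂ hm₁ hm₁₂ α₁ αt₁ h2 hα₁pos hμm g hg hgpos hgi hb
    set b := (betaFun μ x₀ m₁ αt₁ m₂).toReal with hbdef
    have hb0 : 0 ≤ b := ENNReal.toReal_nonneg
    have hbe : 1 + betaFun μ x₀ m₁ αt₁ m₂ = ENNReal.ofReal (1 + b) := by
      rw [ENNReal.ofReal_add zero_le_one hb0, ENNReal.ofReal_one, hbdef, ENNReal.ofReal_toReal hb]
    rw [hbe, ← ENNReal.ofReal_div_of_pos (by linarith)]
    apply ENNReal.ofReal_le_ofReal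
    have hB : MeasurableSet (closedBall x₀ m₂) := measurableSet_closedBall
    have e1 : l (max r m₂) * ∫ y in closedBall x₀ m₂, g y ∂μ ≤ ∫ y, K y x * g y ∂μ := by
      rw [← integral_const_mul]
      calc _ ≤ ∫ y in closedBall x₀ m₂, K y x * g y ∂μ := by
            apply integral_mono_ae (hgi.integrableOn.const_mul _) hKi.integrableOn
            filter_upwards [ae_restrict_of_ae hgpos, ae_restrict_mem hB] with y hy hyB
            apply mul_le_mul_of_nonneg_right _ hy
            exact hl.2 _ (lt_of_lt_of_le (by linarith) (le_max_right r m₂)) y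
              (closedBall_subset_closedBall (le_max_right _ _) hyB) x
              (closedBall_subset_closedBall (le_max_left _ _) hx)
        _ ≤ _ := setIntegral_le_integral hKi (by
            filter_upwards [hgpos] with y hy
            exact mul_nonneg (hKpos y x).le hy)
    rw [inv_mul_eq_div, div_le_div_iff₀ (by linarith) hgint]
    have := mul_le_mul_of_nonneg_left key (hlnn (max r m₂))
    have := mul_le_mul_of_nonneg_right e1 (by linarith : 0 ≤ 1 + b)
    linarith
  · rw [inv_mul_le_iff₀ hgint, mul_one]
    apply integral_mono_ae hKi hgi
    filter_upwards [hgpos] with y hy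
    exact mul_le_of_le_one_left hy (hKle y x)

end Paper
end
end

section
/- Let μ, ν be Borel probability measures on 𝒳, c : 𝒳×𝒳 → [0,∞) measurable with ∫ c d(μ⊗ν) < ∞, ε > 0, and K(x,y) := exp(−c(x,y)/ε). Assume there exist p > 0 and δ > 0 such that lim_{r→∞} ( sup_{x,y ∈ B_r} c(x,y) )/r^p = 0 and lim_{r→∞} max{μ(B_r^c), ν(B_r^c)}/exp(−r^{p+δ}) = 0. Assume there exist measurable g₁*, g₂* : 𝒳 → (0,∞) solving the Schrödinger system g₁*(x) = ( ∫ K(x,y)·g₂*(y) ν(dy) )⁻¹ for all x and g₂*(y) = ( ∫ K(x,y)·g₁*(x) μ(dx) )⁻¹ for all y. Define the Sinkhorn iterations by g₁⁽⁰⁾ ≡ g₂⁽⁰⁾ ≡ 1 and, for n ≥ 0, g₁⁽ⁿ⁺¹⁾(x) := ( ∫ K(x,y)·g₂⁽ⁿ⁾(y) ν(dy) )⁻¹ and g₂⁽ⁿ⁺¹⁾(y) := ( ∫ K(x,y)·g₁⁽ⁿ⁺¹⁾(x) μ(dx) )⁻¹, assuming all these integrals are finite and positive so the iterates are well defined. Let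 π* and π⁽ⁿ⁾ be the measures on 𝒳×𝒳 with densities dπ*/d(μ⊗ν)(x,y) = g₁*(x)·g₂*(y)·K(x,y) and dπ⁽ⁿ⁾/d(μ⊗ν)(x,y) = g₁⁽ⁿ⁾(x)·g₂⁽ⁿ⁾(y)·K(x,y). Then there exist C > 0 and ρ ∈ (0,1) such that for all n ∈ ℕ: ‖π⁽ⁿ⁾ − π*‖_TV ≤ C·ρⁿ, where ‖π⁽ⁿ⁾ − π*‖_TV = ∫ |g₁⁽ⁿ⁾(x)·g₂⁽ⁿ⁾(y) − g₁*(x)·g₂*(y)|·K(x,y) (μ⊗ν)(dx,dy) is the L¹(μ⊗ν)-distance of the densities. -/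
open MeasureTheory Metric Set Filter
open scoped ENNReal NNReal Topology

noncomputable section

namespace Paper

variable {X : Type*} [MeasurableSpace X] [MetricSpace X] [PolishSpace X] [BorelSpace X]

section Core

set_option linter.unusedSectionVars false

variable {S T : Type*} [MeasurableSpace S] [MeasurableSpace T]

/-- coupling with density `k` -/
def cpl (μ : Measure S) (ν : Measure T) (k : S → T → ℝ) : Measure (S × T) :=
  (μ.prod ν).withDensity (fun q => ENNReal.ofReal (k q.1 q.2))

/-- doubly stochastic density -/
structure DS (μ : Measure S) (ν : Measure T) (k : S → T → ℝ) : Prop where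
  meas : Measurable (Function.uncurry k)
  nn : ∀ x y, 0 ≤ k x y
  one1 : ∀ x, ∫ y, k x y ∂ν = 1
  one2 : ∀ y, ∫ x, k x y ∂μ = 1

variable {μ : Measure S} {ν : Measure T} [IsProbabilityMeasure μ] [IsProbabilityMeasure ν]
  {k : S → T → ℝ}

lemma DS.swap (h : DS μ ν k) : DS ν μ (fun y x => k x y) where
  meas := h.meas.comp measurable_swap
  nn := fun y x => h.nn x y
  one1 := h.one2
  one2 := h.one1

lemma DS.i1 (h : DS μ ν k) (x : S) : Integrable (fun y => k x y) ν := by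
  by_contra hc
  have := integral_undef hc
  rw [h.one1] at this
  exact one_ne_zero this

lemma DS.i2 (h : DS μ ν k) (y : T) : Integrable (fun x => k x y) μ := h.swap.i1 y

lemma DS.measE (h : DS μ ν k) : Measurable (fun q : S × T => ENNReal.ofReal (k q.1 q.2)) :=
  h.meas.ennreal_ofReal

lemma DS.integral_eq (h : DS μ ν k) (F : S × T → ℝ) :
    ∫ q, F q ∂(cpl μ ν k) = ∫ q, k q.1 q.2 * F q ∂(μ.prod ν) := by
  unfold cpl
  rw [integral_withDensity_eq_integral_toReal_smul h.measE (by simp)]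
  refine integral_congr_ae (Eventually.of_forall fun q => ?_)
  simp [ENNReal.toReal_ofReal (h.nn q.1 q.2)]

lemma DS.integrable_iff (h : DS μ ν k) (F : S × T → ℝ) :
    Integrable F (cpl μ ν k) ↔ Integrable (fun q => k q.1 q.2 * F q) (μ.prod ν) := by
  unfold cpl
  rw [integrable_withDensity_iff_integrable_smul' h.measE (by simp)]
  refine integrable_congr (Eventually.of_forall fun q => ?_)
  simp [ENNReal.toReal_ofReal (h.nn q.1 q.2)]

lemma DS.lone1 (h : DS μ ν k) (x : S) : ∫⁻ y, ENNReal.ofReal (k x y) ∂ν = 1 := by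
  rw [← ofReal_integral_eq_lintegral_ofReal (h.i1 x) (Eventually.of_forall (h.nn x)), h.one1]
  simp

lemma DS.mp1 (h : DS μ ν k) : MeasurePreserving Prod.fst (cpl μ ν k) μ := by
  refine ⟨measurable_fst, ?_⟩
  ext s hs
  rw [Measure.map_apply measurable_fst hs, cpl, withDensity_apply _ (measurable_fst hs)]
  have : (Prod.fst ⁻¹' s : Set (S × T)) = s ×ˢ univ := by ext; simp
  rw [this, ← Measure.prod_restrict, Measure.restrict_univ, lintegral_prod _ h.measE.aemeasurable]
  simp [h.lone1]

lemma DS.mp2 (h : DS μ ν k) : MeasurePreserving Prod.snd (cpl μ ν k) ν := by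
  refine ⟨measurable_snd, ?_⟩
  ext s hs
  rw [Measure.map_apply measurable_snd hs, cpl, withDensity_apply _ (measurable_snd hs)]
  have : (Prod.snd ⁻¹' s : Set (S × T)) = univ ×ˢ s := by ext; simp
  rw [this, ← Measure.prod_restrict, Measure.restrict_univ,
    lintegral_prod_symm _ h.measE.aemeasurable]
  simp [h.swap.lone1]

lemma DS.prob (h : DS μ ν k) : IsProbabilityMeasure (cpl μ ν k) := by
  refine ⟨?_⟩
  have := h.mp1.measure_preimage (s := univ) MeasurableSet.univ.nullMeasurableSet
  simpa using this

lemma DS.e1 (h : DS μ ν k) {f : S → ℝ} (hf : Measurable f) :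
    ∫ q, f q.1 ∂(cpl μ ν k) = ∫ x, f x ∂μ := by
  have := integral_map (μ := cpl μ ν k) h.mp1.measurable.aemeasurable
    (hf.aestronglyMeasurable (μ := (cpl μ ν k).map Prod.fst))
  rw [h.mp1.map_eq] at this
  exact this.symm

lemma DS.e2 (h : DS μ ν k) {f : T → ℝ} (hf : Measurable f) :
    ∫ q, f q.2 ∂(cpl μ ν k) = ∫ x, f x ∂ν := by
  have := integral_map (μ := cpl μ ν k) h.mp2.measurable.aemeasurable
    (hf.aestronglyMeasurable (μ := (cpl μ ν k).map Prod.snd))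
  rw [h.mp2.map_eq] at this
  exact this.symm

lemma DS.ii1 (h : DS μ ν k) {f : S → ℝ} (hf : Integrable f μ) :
    Integrable (fun q : S × T => f q.1) (cpl μ ν k) :=
  h.mp1.integrable_comp_of_integrable hf

lemma DS.ii2 (h : DS μ ν k) {f : T → ℝ} (hf : Integrable f ν) :
    Integrable (fun q : S × T => f q.2) (cpl μ ν k) :=
  h.mp2.integrable_comp_of_integrable hf

/-- conditional expectation property -/
lemma DS.condA (h : DS μ ν k) {φ a : S → ℝ} {b : T → ℝ}
    (hab : ∀ x, a x = ∫ y, k x y * b y ∂ν)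
    (hi : Integrable (fun q : S × T => φ q.1 * b q.2) (cpl μ ν k)) :
    ∫ q, φ q.1 * b q.2 ∂(cpl μ ν k) = ∫ x, φ x * a x ∂μ := by
  rw [h.integral_eq, integral_prod _ ((h.integrable_iff _).1 hi)]
  refine integral_congr_ae (Eventually.of_forall fun x => ?_)
  simp only [hab, ← integral_const_mul]
  refine integral_congr_ae (Eventually.of_forall fun y => ?_)
  simp only; ring

lemma DS.condB (h : DS μ ν k) {φ b : T → ℝ} {a : S → ℝ}
    (hab : ∀ y, b y = ∫ x, k x y * a x ∂μ)
    (hi : Integrable (fun q : S × T => φ q.2 * a q.1) (cpl μ ν k)) :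
    ∫ q, φ q.2 * a q.1 ∂(cpl μ ν k) = ∫ y, φ y * b y ∂ν := by
  rw [h.integral_eq, integral_prod_symm _ ((h.integrable_iff _).1 hi)]
  refine integral_congr_ae (Eventually.of_forall fun x => ?_)
  simp only [hab, ← integral_const_mul]
  refine integral_congr_ae (Eventually.of_forall fun y => ?_)
  simp only; ring

lemma DS.pint (h : DS μ ν k) {u : T → ℝ} (hum : Measurable u) (hu : Integrable u ν) :
    Integrable (fun x => ∫ y, k x y * u y ∂ν) μ ∧
    ∫ x, (∫ y, k x y * u y ∂ν) ∂μ = ∫ y, u y ∂ν ∧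
    ∀ᵐ x ∂μ, Integrable (fun y => k x y * u y) ν := by
  have h1 := (h.integrable_iff _).1 (h.ii2 hu)
  refine ⟨h1.integral_prod_left, ?_, h1.prod_right_ae⟩
  rw [← h.e2 hum, h.integral_eq, integral_prod _ h1]

/-- measurability of the image -/
lemma DS.pmeas (h : DS μ ν k) {u : T → ℝ} (hum : Measurable u) :
    Measurable (fun x => ∫ y, k x y * u y ∂ν) := by
  have : StronglyMeasurable (Function.uncurry fun x y => k x y * u y) :=
    (h.meas.mul (hum.comp measurable_snd)).stronglyMeasurable
  exact this.integral_prod_right.measurable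

/-- Jensen type inequality -/
lemma DS.jensen (h : DS μ ν k) {u : T → ℝ} {v : S → ℝ} (hum : Measurable u) (hvm : Measurable v)
    (hv0 : ∀ x, 0 ≤ v x)
    (hu : Integrable u ν) (hle : ∀ x, Integrable (fun y => k x y * u y) ν →
      v x ≤ ∫ y, k x y * u y ∂ν) : Integrable v μ ∧ ∫ x, v x ∂μ ≤ ∫ y, u y ∂ν := by
  obtain ⟨h1, h2, h3⟩ := h.pint hum hu
  have hae : ∀ᵐ x ∂μ, v x ≤ ∫ y, k x y * u y ∂ν := by
    filter_upwards [h3] with x hx using hle x hx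
  have hvi : Integrable v μ := by
    refine h1.mono' hvm.aestronglyMeasurable ?_
    filter_upwards [hae] with x hx
    rwa [Real.norm_eq_abs, abs_of_nonneg (hv0 x)]
  exact ⟨hvi, h2 ▸ integral_mono_ae hvi h1 hae⟩



lemma int3 {Ω : Type*} [MeasurableSpace Ω] {P : Measure Ω} {F G H : Ω → ℝ} {c : ℝ}
    (hF : Integrable F P) (hG : Integrable G P) (hH : Integrable H P) :
    ∫ x, (F x - c * G x + H x) ∂P = ∫ x, F x ∂P - c * ∫ x, G x ∂P + ∫ x, H x ∂P := by
  have h1 : Integrable (fun x => F x - c * G x) P := hF.sub (hG.const_mul c)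
  rw [integral_add h1 hH, integral_sub hF (hG.const_mul c), integral_const_mul]

lemma tangent1 {t b : ℝ} (ht : 0 < t) (hb : 0 < b) :
    3 * t⁻¹ ^ 2 - 2 * t⁻¹ ^ 3 * b ≤ b⁻¹ ^ 2 := by
  have h1 : b⁻¹ ^ 2 - (3 * t⁻¹ ^ 2 - 2 * t⁻¹ ^ 3 * b)
      = (b - t) ^ 2 * (2 * b + t) * (b⁻¹ ^ 2 * t⁻¹ ^ 3) := by
    field_simp; ring
  have : 0 ≤ (b - t) ^ 2 * (2 * b + t) * (b⁻¹ ^ 2 * t⁻¹ ^ 3) := by positivity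
  linarith

lemma integrable_of_bdd {Ω : Type*} [MeasurableSpace Ω] {P : Measure Ω} [IsFiniteMeasure P]
    {f : Ω → ℝ} (hf : Measurable f) (C : ℝ) (h : ∀ x, |f x| ≤ C) : Integrable f P :=
  (integrable_const C).mono' hf.aestronglyMeasurable (Eventually.of_forall h)

lemma integrable_of_sq {Ω : Type*} [MeasurableSpace Ω] {P : Measure Ω} [IsFiniteMeasure P]
    {f : Ω → ℝ} (hf : Measurable f) (h : Integrable (fun x => f x ^ 2) P) : Integrable f P := by
  refine (h.add (integrable_const 1)).mono' hf.aestronglyMeasurable (Eventually.of_forall fun x => ?_)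
  simp only [Real.norm_eq_abs, Pi.add_apply]
  nlinarith [sq_nonneg (|f x| - 1), sq_abs (f x)]

lemma DS.kb (h : DS μ ν k) {b : T → ℝ} (hbm : Measurable b) {C : ℝ} (hb : ∀ y, |b y| ≤ C) (x : S) :
    Integrable (fun y => k x y * b y) ν := by
  refine ((h.i1 x).mul_const C).mono' ?_ (Eventually.of_forall fun y => ?_)
  · exact ((h.meas.comp measurable_prodMk_left).mul hbm).aestronglyMeasurable
  · rw [norm_mul, Real.norm_eq_abs, Real.norm_eq_abs, abs_of_nonneg (h.nn x y)]
    exact mul_le_mul_of_nonneg_left (hb y) (h.nn x y)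

lemma DS.step1 (h : DS μ ν k) {b : T → ℝ} {a : S → ℝ} {C : ℝ} (hbm : Measurable b)
    (hb0 : ∀ y, 0 < b y) (hbC : ∀ y, b y ≤ C) (ha0 : ∀ x, 0 < a x)
    (hab : ∀ x, a x = ∫ y, k x y * b y ∂ν) (hb2 : Integrable (fun y => (b y)⁻¹ ^ 2) ν) :
    Measurable a ∧ (∀ x, a x ≤ C) ∧ Integrable (fun x => (a x)⁻¹ ^ 2) μ ∧
    ∫ x, (a x)⁻¹ ^ 2 ∂μ ≤ ∫ y, (b y)⁻¹ ^ 2 ∂ν ∧ ∫ x, a x ∂μ = ∫ y, b y ∂ν ∧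
    Integrable (fun q : S × T => (b q.2 - a q.1) ^ 2 * (b q.2)⁻¹ * (a q.1)⁻¹ ^ 2) (cpl μ ν k) ∧
    ∫ q, (b q.2 - a q.1) ^ 2 * (b q.2)⁻¹ * (a q.1)⁻¹ ^ 2 ∂(cpl μ ν k) =
      ∫ y, (b y)⁻¹ ∂ν - ∫ x, (a x)⁻¹ ∂μ := by
  have hP := h.prob
  have hbabs : ∀ y, |b y| ≤ C := fun y => by rw [abs_of_pos (hb0 y)]; exact hbC y
  have ham : Measurable a := by
    have : a = fun x => ∫ y, k x y * b y ∂ν := funext hab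
    rw [this]; exact h.pmeas hbm
  have haC : ∀ x, a x ≤ C := fun x => by
    rw [hab]
    calc ∫ y, k x y * b y ∂ν ≤ ∫ y, k x y * C ∂ν :=
          integral_mono (h.kb hbm hbabs x) ((h.i1 x).mul_const C)
            (fun y => mul_le_mul_of_nonneg_left (hbC y) (h.nn x y))
      _ = C := by rw [integral_mul_const, h.one1, one_mul]
  have hbi : Integrable b ν := integrable_of_bdd hbm C hbabs
  obtain ⟨ha2, ha2le⟩ := h.jensen (u := fun y => (b y)⁻¹ ^ 2) (v := fun x => (a x)⁻¹ ^ 2)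
    (hbm.inv.pow_const 2) (ham.inv.pow_const 2) (fun x => by positivity) hb2 (fun x hx => by
      calc (a x)⁻¹ ^ 2 = ∫ y, (k x y * (3 * (a x)⁻¹ ^ 2) - 2 * (a x)⁻¹ ^ 3 * (k x y * b y)) ∂ν := by
            rw [integral_sub ((h.i1 x).mul_const _) ((h.kb hbm hbabs x).const_mul _),
              integral_mul_const, integral_const_mul, ← hab, h.one1]
            have := (ha0 x).ne'
            field_simp; ring
        _ ≤ _ := by
            refine integral_mono (((h.i1 x).mul_const _).sub ((h.kb hbm hbabs x).const_mul _)) hx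
              (fun y => ?_)
            have := mul_le_mul_of_nonneg_left (tangent1 (ha0 x) (hb0 y)) (h.nn x y)
            simp only
            linarith)
  have ha1 : Integrable (fun x => (a x)⁻¹) μ := integrable_of_sq ham.inv ha2
  have hb1 : Integrable (fun x => (b x)⁻¹) ν := integrable_of_sq hbm.inv hb2
  have hea : ∫ x, a x ∂μ = ∫ y, b y ∂ν := by
    simp only [hab]; exact (h.pint hbm hbi).2.1
  have i1 : Integrable (fun q : S × T => (a q.1)⁻¹ ^ 2 * b q.2) (cpl μ ν k) := by
    refine ((h.ii1 ha2).mul_const C).mono' ?_ (Eventually.of_forall fun q => ?_)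
    · exact (((ham.comp measurable_fst).inv.pow_const 2).mul
        (hbm.comp measurable_snd)).aestronglyMeasurable
    · rw [Real.norm_eq_abs, abs_mul, abs_of_nonneg (by positivity)]
      exact mul_le_mul_of_nonneg_left (hbabs _) (by positivity)
  have i2 := h.ii1 ha1
  have i3 := h.ii2 hb1
  have e1 : ∫ q, (a q.1)⁻¹ ^ 2 * b q.2 ∂(cpl μ ν k) = ∫ x, (a x)⁻¹ ∂μ := by
    rw [h.condA (φ := fun x => (a x)⁻¹ ^ 2) hab i1]
    refine integral_congr_ae (Eventually.of_forall fun x => ?_)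
    have := (ha0 x).ne'
    simp only; field_simp
  have key : (fun q : S × T => (b q.2 - a q.1) ^ 2 * (b q.2)⁻¹ * (a q.1)⁻¹ ^ 2) =
      fun q => (a q.1)⁻¹ ^ 2 * b q.2 - 2 * (a q.1)⁻¹ + (b q.2)⁻¹ := by
    funext q
    have := (ha0 q.1).ne'
    have := (hb0 q.2).ne'
    field_simp; ring
  refine ⟨ham, haC, ha2, ha2le, hea, ?_, ?_⟩
  · rw [key]; exact (i1.sub (i2.const_mul 2)).add i3
  · rw [key, int3 i1 i2 i3, e1, h.e1 (f := fun x => (a x)⁻¹) ham.inv,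
      h.e2 (f := fun x => (b x)⁻¹) hbm.inv]
    ring

lemma DS.step2 (h : DS μ ν k) {b : T → ℝ} {a : S → ℝ} {C : ℝ} (ham : Measurable a)
    (ha0 : ∀ y, 0 < a y) (haC : ∀ y, a y ≤ C) (hb0 : ∀ x, 0 < b x)
    (hab : ∀ y, (b y)⁻¹ = ∫ x, k x y * (a x)⁻¹ ∂μ) (ha2 : Integrable (fun y => (a y)⁻¹ ^ 2) μ)
    (hint : ∀ y, Integrable (fun x => k x y * (a x)⁻¹) μ) :
    Measurable b ∧ (∀ x, b x ≤ C) ∧ Integrable (fun x => (b x)⁻¹ ^ 2) ν ∧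
    ∫ x, (b x)⁻¹ ^ 2 ∂ν ≤ ∫ y, (a y)⁻¹ ^ 2 ∂μ ∧ ∫ x, (b x)⁻¹ ∂ν = ∫ y, (a y)⁻¹ ∂μ ∧
    Integrable (fun q : S × T => (b q.2 - a q.1) ^ 2 * (a q.1)⁻¹) (cpl μ ν k) ∧
    ∫ q, (b q.2 - a q.1) ^ 2 * (a q.1)⁻¹ ∂(cpl μ ν k) = ∫ x, a x ∂μ - ∫ y, b y ∂ν := by
  have hP := h.prob
  have hbim : Measurable (fun y => (b y)⁻¹) := by
    have : (fun y => (b y)⁻¹) = fun y => ∫ x, k x y * (a x)⁻¹ ∂μ := funext hab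
    rw [this]; exact h.swap.pmeas ham.inv
  have hbm : Measurable b := by
    have := hbim.inv
    have h2 : (fun y => (b y)⁻¹)⁻¹ = b := by funext y; simp
    rwa [h2] at this
  have hbC : ∀ x, b x ≤ C := fun y => by
    have hC : 0 < C := by
      by_contra hC
      have : ∀ x : S, False := fun x => by linarith [ha0 x, haC x]
      have h2 : μ = 0 := by
        have : IsEmpty S := ⟨this⟩
        exact Measure.eq_zero_of_isEmpty μ
      exact IsProbabilityMeasure.ne_zero μ h2
    have : C⁻¹ ≤ (b y)⁻¹ := by
      rw [hab]
      calc C⁻¹ = ∫ x, k x y * C⁻¹ ∂μ := by rw [integral_mul_const, h.one2, one_mul]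
        _ ≤ _ := integral_mono ((h.i2 y).mul_const _) (hint y)
            (fun x => mul_le_mul_of_nonneg_left (inv_anti₀ (ha0 x) (haC x)) (h.nn x y))
    exact (inv_le_inv₀ hC (hb0 y)).1 this
  obtain ⟨hb2, hb2le⟩ := h.swap.jensen (u := fun y => (a y)⁻¹ ^ 2) (v := fun x => (b x)⁻¹ ^ 2)
    (ham.inv.pow_const 2) (hbm.inv.pow_const 2) (fun x => by positivity) ha2 (fun y hy => by
      calc (b y)⁻¹ ^ 2 = ∫ x, (2 * (b y)⁻¹ * (k x y * (a x)⁻¹) - k x y * (b y)⁻¹ ^ 2) ∂μ := by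
            rw [integral_sub ((hint y).const_mul _) ((h.i2 y).mul_const _),
              integral_mul_const, integral_const_mul, ← hab, h.one2]
            ring
        _ ≤ _ := by
            refine integral_mono (((hint y).const_mul _).sub ((h.i2 y).mul_const _)) hy
              (fun x => ?_)
            have := mul_nonneg (h.nn x y) (sq_nonneg ((a x)⁻¹ - (b y)⁻¹))
            simp only
            linarith)
  have ha1 : Integrable (fun x => (a x)⁻¹) μ := integrable_of_sq ham.inv ha2
  have habs : ∀ y, |a y| ≤ C := fun y => by rw [abs_of_pos (ha0 y)]; exact haC y
  have hbabs : ∀ y, |b y| ≤ C := fun y => by rw [abs_of_pos (hb0 y)]; exact hbC y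
  have hea : ∫ x, (b x)⁻¹ ∂ν = ∫ y, (a y)⁻¹ ∂μ := by
    simp only [hab]; exact (h.swap.pint ham.inv ha1).2.1
  have i1 : Integrable (fun q : S × T => b q.2 ^ 2 * (a q.1)⁻¹) (cpl μ ν k) := by
    refine ((h.ii1 ha1).const_mul (C ^ 2)).mono' ?_ (Eventually.of_forall fun q => ?_)
    · exact (((hbm.comp measurable_snd).pow_const 2).mul
        (ham.comp measurable_fst).inv).aestronglyMeasurable
    · have := (ha0 q.1)
      have h3 := hb0 q.2
      rw [Real.norm_eq_abs, abs_of_nonneg (by positivity)]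
      gcongr
      exact hbC _
  have i2 := h.ii2 (integrable_of_bdd (P := ν) hbm C hbabs)
  have i3 := h.ii1 (integrable_of_bdd (P := μ) ham C habs)
  have e1 : ∫ q, b q.2 ^ 2 * (a q.1)⁻¹ ∂(cpl μ ν k) = ∫ x, b x ∂ν := by
    rw [h.condB (φ := fun x => (b x) ^ 2) (a := fun x => (a x)⁻¹) hab i1]
    refine integral_congr_ae (Eventually.of_forall fun x => ?_)
    have := (hb0 x).ne'
    simp only; field_simp
  have key : (fun q : S × T => (b q.2 - a q.1) ^ 2 * (a q.1)⁻¹) =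
      fun q => b q.2 ^ 2 * (a q.1)⁻¹ - 2 * b q.2 + a q.1 := by
    funext q
    have := (ha0 q.1).ne'
    field_simp; ring
  refine ⟨hbm, hbC, hb2, hb2le, hea, ?_, ?_⟩
  · rw [key]; exact (i1.sub (i2.const_mul 2)).add i3
  · rw [key, int3 i1 i2 i3, e1, h.e1 ham, h.e2 hbm]
    ring

lemma cs {Ω : Type*} [MeasurableSpace Ω] {P : Measure Ω}
    {f g : Ω → ℝ} (hf : Measurable f) (hg : Measurable g) (hf0 : ∀ x, 0 ≤ f x) (hg0 : ∀ x, 0 ≤ g x)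
    (hf2 : Integrable (fun x => f x ^ 2) P) (hg2 : Integrable (fun x => g x ^ 2) P) :
    (∫ x, f x * g x ∂P) ^ 2 ≤ (∫ x, f x ^ 2 ∂P) * ∫ x, g x ^ 2 ∂P := by
  have hi : Integrable (fun x => f x * g x) P := by
    refine (hf2.add hg2).mono' (hf.mul hg).aestronglyMeasurable (Eventually.of_forall fun x => ?_)
    have := hf0 x
    have := hg0 x
    rw [Real.norm_eq_abs, abs_of_nonneg (by positivity), Pi.add_apply]
    nlinarith [sq_nonneg (f x - g x)]
  have := discrim_le_zero (a := ∫ x, f x ^ 2 ∂P) (b := 2 * ∫ x, f x * g x ∂P)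
    (c := ∫ x, g x ^ 2 ∂P) (fun t => by
      have e : ∫ x, (t * f x + g x) ^ 2 ∂P = (∫ x, f x ^ 2 ∂P) * (t * t) +
          2 * (∫ x, f x * g x ∂P) * t + ∫ x, g x ^ 2 ∂P := by
        have : (fun x => (t * f x + g x) ^ 2) =
            fun x => f x ^ 2 * (t * t) - (-(2 * t)) * (f x * g x) + g x ^ 2 := by
          funext x; ring
        rw [this, int3 (hf2.mul_const _) hi hg2, integral_mul_const]
        ring
      rw [← e]
      exact integral_nonneg fun x => sq_nonneg _)
  unfold discrim at this
  linarith



lemma sqsum (x y : ℝ) : (x + y) ^ 2 ≤ 2 * x ^ 2 + 2 * y ^ 2 := by nlinarith [sq_nonneg (x - y)]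

lemma sqsum3 (x y z : ℝ) : (x - z) ^ 2 ≤ 2 * (x - y) ^ 2 + 2 * (y - z) ^ 2 := by
  have := sqsum (x - y) (y - z)
  simpa using this

lemma young (x y : ℝ) : x * y ≤ x ^ 2 + y ^ 2 := by
  nlinarith [sq_nonneg (x - y), sq_nonneg x, sq_nonneg y]

set_option maxHeartbeats 4000000 in
lemma DS.poincare (h : DS μ ν k) {u : S → ℝ} {v : T → ℝ} (hum : Measurable u) (hvm : Measurable v)
    (hu0 : ∀ x, 0 < u x) (hv0 : ∀ y, 0 < v y) (hkuv : ∀ x y, k x y ≤ u x * v y)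
    (hu2 : Integrable (fun x => u x ^ 2) μ)
    (hu3 : Integrable (fun x => u x ^ 3) μ) (hv2 : Integrable (fun y => v y ^ 2) ν)
    {A : Set S} {B : Set T} (hB : MeasurableSet B) (hμA : μ A ≠ 0)
    {c₀ : ℝ} (hc₀ : 0 < c₀) (hk : ∀ x ∈ A, ∀ y ∈ B, c₀ ≤ k x y)
    (hτ : 8 * (∫ y in Bᶜ, v y ^ 2 ∂ν) * (∫ x, u x ^ 2 ∂μ) ≤ 1) (C M : ℝ) (hC : 0 < C) :
    ∃ κ : ℝ, 0 < κ ∧ ∀ (b : T → ℝ) (a : S → ℝ), Measurable b → (∀ y, 0 < b y) →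
      (∀ y, b y ≤ C) → (∀ x, 0 < a x) → (∀ x, a x = ∫ y, k x y * b y ∂ν) →
      Integrable (fun y => (b y)⁻¹ ^ 2) ν → ∫ y, (b y)⁻¹ ^ 2 ∂ν ≤ M →
      κ * (∫ y, b y ∂ν - (∫ y, (b y)⁻¹ ∂ν)⁻¹) ≤ ∫ y, (b y)⁻¹ ∂ν - ∫ x, (a x)⁻¹ ∂μ := by
  have hP := h.prob
  set H := ∫ y, v y ^ 2 ∂ν with hH
  set G1 := ∫ x, u x ^ 2 ∂μ with hG1
  set G3 := ∫ x, u x ^ 3 ∂μ with hG3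
  set τ := ∫ y in Bᶜ, v y ^ 2 ∂ν with hτdef
  set m := μ.real A with hm
  have hm0 : 0 < m := ENNReal.toReal_pos hμA (measure_ne_top _ _)
  have hH0 : 0 ≤ H := integral_nonneg fun y => by positivity
  have hG10 : 0 ≤ G1 := integral_nonneg fun y => by positivity
  have hG30 : 0 ≤ G3 := integral_nonneg fun y => by have := hu0 y; positivity
  have hτ0 : 0 ≤ τ := integral_nonneg fun y => by positivity
  -- the constants
  set E1 := 2 * (2 * H * (m⁻¹ * c₀⁻¹) + 4 * τ) with hE1
  set E2 := 2 + 2 * (E1 * C) * (G3 * (H + |M|)) with hE2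
  have hE10 : 0 ≤ E1 := by positivity
  have hE20 : 0 < E2 := by positivity
  refine ⟨(E2 * C ^ 2)⁻¹, by positivity, ?_⟩
  intro b a hbm hb0 hbC ha0 hab hb2 hbM
  obtain ⟨ham, haC, ha2, -, hea, hgi, hgap⟩ := h.step1 hbm hb0 hbC ha0 hab hb2
  rw [← hgap]
  have hbabs : ∀ y, |b y| ≤ C := fun y => by rw [abs_of_pos (hb0 y)]; exact hbC y
  have hb1 : Integrable (fun x => (b x)⁻¹) ν := integrable_of_sq hbm.inv hb2
  have hbi : Integrable b ν := integrable_of_bdd hbm C hbabs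
  have hbm' : Measurable (fun q : S × T => b q.2) := hbm.comp measurable_snd
  have ham' : Measurable (fun q : S × T => a q.1) := ham.comp measurable_fst
  have hba : ∀ x y, |b y - a x| ≤ C := fun x y => by
    rw [abs_le]; constructor <;> linarith [hb0 y, ha0 x, hbC y, haC x]
  have hba2 : ∀ x y, (b y - a x) ^ 2 ≤ C ^ 2 := fun x y => by
    rw [← sq_abs]; exact pow_le_pow_left₀ (abs_nonneg _) (hba x y) 2
  have hSi : Integrable (fun q : S × T => (b q.2 - a q.1) ^ 2) (cpl μ ν k) := by
    refine integrable_of_bdd ((hbm'.sub ham').pow_const 2) (C ^ 2) fun q => ?_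
    rw [abs_of_nonneg (by positivity)]; exact hba2 _ _
  have hWi : Integrable (fun q : S × T => (b q.2 - a q.1) ^ 2 * (b q.2)⁻¹) (cpl μ ν k) := by
    refine ((h.ii2 hb1).const_mul (C ^ 2)).mono'
      (((hbm'.sub ham').pow_const 2).mul hbm'.inv).aestronglyMeasurable
      (Eventually.of_forall fun q => ?_)
    have := hb0 q.2
    rw [Real.norm_eq_abs, abs_of_nonneg (by positivity)]
    exact mul_le_mul_of_nonneg_right (hba2 _ _) (by positivity)
  set W := ∫ q, (b q.2 - a q.1) ^ 2 * (b q.2)⁻¹ ∂(cpl μ ν k) with hW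
  set SS := ∫ q, (b q.2 - a q.1) ^ 2 ∂(cpl μ ν k) with hSS
  have hSS0 : 0 ≤ SS := integral_nonneg fun q => by positivity
  have hSW : SS ≤ C * W := by
    rw [hW, ← integral_const_mul]
    refine integral_mono hSi (hWi.const_mul C) fun q => ?_
    have h1 := hb0 q.2
    have h2 := hbC q.2
    simp only
    have : 1 ≤ C * (b q.2)⁻¹ := by rw [← div_eq_mul_inv, le_div_iff₀ h1]; linarith
    calc (b q.2 - a q.1) ^ 2 ≤ (b q.2 - a q.1) ^ 2 * (C * (b q.2)⁻¹) :=
          le_mul_of_one_le_right (sq_nonneg _) this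
      _ = _ := by ring
  have hWg : W ≤ C ^ 2 * ∫ q, (b q.2 - a q.1) ^ 2 * (b q.2)⁻¹ * (a q.1)⁻¹ ^ 2 ∂(cpl μ ν k) := by
    rw [← integral_const_mul]
    refine integral_mono hWi (hgi.const_mul _) fun q => ?_
    have h1 := hb0 q.2
    have h2 := haC q.1
    have h3 := ha0 q.1
    simp only
    have h4 : 1 ≤ C * (a q.1)⁻¹ := by rw [← div_eq_mul_inv, le_div_iff₀ h3]; linarith
    have h5 : 1 ≤ (C * (a q.1)⁻¹) ^ 2 := one_le_pow₀ h4
    have h6 : 0 ≤ (b q.2 - a q.1) ^ 2 * (b q.2)⁻¹ := by positivity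
    calc (b q.2 - a q.1) ^ 2 * (b q.2)⁻¹ ≤ (b q.2 - a q.1) ^ 2 * (b q.2)⁻¹ * (C * (a q.1)⁻¹) ^ 2 :=
          le_mul_of_one_le_right h6 h5
      _ = _ := by ring
  -- choice of the centre
  obtain ⟨z, hzA, hz⟩ : ∃ z ∈ A, ∫ y in B, (b y - a z) ^ 2 ∂ν ≤ m⁻¹ * c₀⁻¹ * SS := by
    have hpi := (h.integrable_iff _).1 hSi
    have hSSe : SS = ∫ x, (∫ y, k x y * (b y - a x) ^ 2 ∂ν) ∂μ := by
      rw [hSS, h.integral_eq, integral_prod _ hpi]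
    have hφi : Integrable (fun x => ∫ y, k x y * (b y - a x) ^ 2 ∂ν) μ := hpi.integral_prod_left
    obtain ⟨z, hzA, hz⟩ := exists_le_setAverage hμA (measure_ne_top _ _) hφi.integrableOn (s := A)
    refine ⟨z, hzA, ?_⟩
    rw [setAverage_eq, smul_eq_mul] at hz
    have h1 : ∫ x in A, (∫ y, k x y * (b y - a x) ^ 2 ∂ν) ∂μ ≤ SS := by
      rw [hSSe]
      refine setIntegral_le_integral hφi (Eventually.of_forall fun x => ?_)
      exact integral_nonneg fun y => mul_nonneg (h.nn x y) (sq_nonneg _)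
    have hsqm : Measurable (fun y => (b y - a z) ^ 2) := (hbm.sub_const _).pow_const 2
    have hsqb : ∀ y, |(b y - a z) ^ 2| ≤ C ^ 2 := fun y => by
      rw [abs_of_nonneg (by positivity)]; exact hba2 _ _
    have hsqi : Integrable (fun y => (b y - a z) ^ 2) ν := integrable_of_bdd hsqm (C ^ 2) hsqb
    have hki : Integrable (fun y => k z y * (b y - a z) ^ 2) ν := h.kb hsqm hsqb z
    have h2 : c₀ * ∫ y in B, (b y - a z) ^ 2 ∂ν ≤ ∫ y, k z y * (b y - a z) ^ 2 ∂ν := by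
      rw [← integral_const_mul]
      calc ∫ y in B, c₀ * (b y - a z) ^ 2 ∂ν ≤ ∫ y in B, k z y * (b y - a z) ^ 2 ∂ν := by
            refine setIntegral_mono_on (hsqi.const_mul _).integrableOn hki.integrableOn hB
              fun y hy => ?_
            exact mul_le_mul_of_nonneg_right (hk z hzA y hy) (sq_nonneg _)
        _ ≤ _ := setIntegral_le_integral hki (Eventually.of_forall fun y =>
            mul_nonneg (h.nn z y) (sq_nonneg _))
    have h3 : c₀ * ∫ y in B, (b y - a z) ^ 2 ∂ν ≤ m⁻¹ * SS :=
      h2.trans (hz.trans (mul_le_mul_of_nonneg_left h1 (by positivity)))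
    calc ∫ y in B, (b y - a z) ^ 2 ∂ν = c₀⁻¹ * (c₀ * ∫ y in B, (b y - a z) ^ 2 ∂ν) := by
          field_simp
      _ ≤ c₀⁻¹ * (m⁻¹ * SS) := mul_le_mul_of_nonneg_left h3 (by positivity)
      _ = _ := by ring
  set l := a z with hl
  have hfm : Measurable (fun y => |b y - l|) := (hbm.sub_const _).abs
  have hf2i : Integrable (fun y => |b y - l| ^ 2) ν := by
    refine integrable_of_bdd (hfm.pow_const 2) (C ^ 2) fun y => ?_
    rw [abs_of_nonneg (by positivity), sq_abs]; exact hba2 _ _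
  have hvi : Integrable v ν := integrable_of_sq hvm hv2
  have hfvi : Integrable (fun y => |b y - l| * v y) ν := by
    refine (hvi.const_mul C).mono' (hfm.mul hvm).aestronglyMeasurable
      (Eventually.of_forall fun y => ?_)
    have := hv0 y
    rw [Real.norm_eq_abs, abs_of_nonneg (by positivity)]
    exact mul_le_mul_of_nonneg_right (hba _ _) this.le
  set N := ∫ y, |b y - l| * v y ∂ν with hN
  have hN1 : N ^ 2 ≤ 2 * H * (m⁻¹ * c₀⁻¹ * SS) + 2 * τ * ∫ y, |b y - l| ^ 2 ∂ν := by
    have e : N = ∫ y in B, |b y - l| * v y ∂ν + ∫ y in Bᶜ, |b y - l| * v y ∂ν :=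
      (integral_add_compl hB hfvi).symm
    have c1 := cs (P := ν.restrict B) hfm hvm (fun y => abs_nonneg _) (fun y => (hv0 y).le)
      hf2i.integrableOn hv2.integrableOn
    have c2 := cs (P := ν.restrict Bᶜ) hfm hvm (fun y => abs_nonneg _) (fun y => (hv0 y).le)
      hf2i.integrableOn hv2.integrableOn
    have d1 : ∫ y in B, v y ^ 2 ∂ν ≤ H :=
      setIntegral_le_integral hv2 (Eventually.of_forall fun y => sq_nonneg _)
    have d2 : ∫ y in Bᶜ, |b y - l| ^ 2 ∂ν ≤ ∫ y, |b y - l| ^ 2 ∂ν :=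
      setIntegral_le_integral hf2i (Eventually.of_forall fun y => sq_nonneg _)
    have d3 : ∫ y in B, |b y - l| ^ 2 ∂ν ≤ m⁻¹ * c₀⁻¹ * SS := by simpa only [sq_abs] using hz
    have d4 : 0 ≤ ∫ y in B, v y ^ 2 ∂ν := integral_nonneg fun y => sq_nonneg _
    have d5 : (∫ y in B, |b y - l| ^ 2 ∂ν) * ∫ y in B, v y ^ 2 ∂ν ≤ (m⁻¹ * c₀⁻¹ * SS) * H :=
      mul_le_mul d3 d1 d4 (by positivity)
    have d6 : (∫ y in Bᶜ, |b y - l| ^ 2 ∂ν) * τ ≤ (∫ y, |b y - l| ^ 2 ∂ν) * τ :=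
      mul_le_mul_of_nonneg_right d2 hτ0
    rw [e]
    have d7 := sqsum (∫ y in B, |b y - l| * v y ∂ν) (∫ y in Bᶜ, |b y - l| * v y ∂ν)
    linarith
  have hal : ∀ x, (a x - l) ^ 2 ≤ N ^ 2 * u x ^ 2 := fun x => by
    have e : a x - l = ∫ y, k x y * (b y - l) ∂ν := by
      have : (fun y => k x y * (b y - l)) = fun y => k x y * b y - k x y * l := by
        funext y; ring
      rw [this, integral_sub (h.kb hbm hbabs x) ((h.i1 x).mul_const l), ← hab, integral_mul_const,
        h.one1, one_mul]
    have : |a x - l| ≤ u x * N := by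
      rw [e, hN, ← integral_const_mul, ← Real.norm_eq_abs]
      refine norm_integral_le_of_norm_le (hfvi.const_mul _) (Eventually.of_forall fun y => ?_)
      rw [norm_mul, Real.norm_eq_abs, Real.norm_eq_abs, abs_of_nonneg (h.nn x y)]
      have := mul_le_mul_of_nonneg_right (hkuv x y) (abs_nonneg (b y - l))
      linarith
    calc (a x - l) ^ 2 = |a x - l| ^ 2 := (sq_abs _).symm
      _ ≤ (u x * N) ^ 2 := pow_le_pow_left₀ (abs_nonneg _) this 2
      _ = _ := by ring
  clear_value N l E1 E2
  have hf2 : ∫ y, |b y - l| ^ 2 ∂ν ≤ 2 * SS + 2 * (N ^ 2 * G1) := by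
    have j1 : Integrable (fun q : S × T => 2 * (b q.2 - a q.1) ^ 2) (cpl μ ν k) := hSi.const_mul 2
    have j2 : Integrable (fun q : S × T => 2 * (N ^ 2 * u q.1 ^ 2)) (cpl μ ν k) :=
      ((h.ii1 (f := fun x => u x ^ 2) hu2).const_mul (N ^ 2)).const_mul 2
    have e2 : ∫ q : S × T, 2 * (N ^ 2 * u q.1 ^ 2) ∂(cpl μ ν k) = 2 * (N ^ 2 * G1) := by
      rw [integral_const_mul, integral_const_mul, h.e1 (f := fun x => u x ^ 2) (hum.pow_const 2)]
    have e3 : ∫ q : S × T, 2 * (b q.2 - a q.1) ^ 2 ∂(cpl μ ν k) = 2 * SS := by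
      rw [integral_const_mul]
    have j3 : Integrable (fun q : S × T => |b q.2 - l| ^ 2) (cpl μ ν k) := h.ii2 (f := fun y => |b y - l| ^ 2) hf2i
    have j4 : Integrable (fun q : S × T => 2 * (b q.2 - a q.1) ^ 2 + 2 * (N ^ 2 * u q.1 ^ 2))
      (cpl μ ν k) := j1.add j2
    have j5 : ∀ q : S × T, |b q.2 - l| ^ 2 ≤ 2 * (b q.2 - a q.1) ^ 2 + 2 * (N ^ 2 * u q.1 ^ 2) := by
      intro q
      have := hal q.1
      rw [sq_abs]
      have h7 := sqsum3 (b q.2) (a q.1) l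
      linarith
    have e4 : ∫ y, |b y - l| ^ 2 ∂ν = ∫ q : S × T, |b q.2 - l| ^ 2 ∂(cpl μ ν k) :=
      (h.e2 (f := fun y => |b y - l| ^ 2) (hfm.pow_const 2)).symm
    rw [e4, ← e2, ← e3, ← integral_add j1 j2]
    exact integral_mono j3 j4 j5
  have hN2 : N ^ 2 ≤ E1 * SS := by
    have h1 : 2 * τ * ∫ y, |b y - l| ^ 2 ∂ν ≤ 2 * τ * (2 * SS + 2 * (N ^ 2 * G1)) :=
      mul_le_mul_of_nonneg_left hf2 (by positivity)
    have h2 : 8 * τ * G1 * N ^ 2 ≤ 1 * N ^ 2 := mul_le_mul_of_nonneg_right hτ (sq_nonneg _)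
    rw [hE1]
    linarith
  -- weighted part
  have hvb : Integrable (fun y => v y * (b y)⁻¹) ν := by
    refine (hv2.add hb2).mono' (hvm.mul hbm.inv).aestronglyMeasurable
      (Eventually.of_forall fun y => ?_)
    have := hv0 y
    have := hb0 y
    rw [Real.norm_eq_abs, abs_of_nonneg (by positivity), Pi.add_apply]
    exact young _ _
  have hvbM : ∫ y, v y * (b y)⁻¹ ∂ν ≤ H + |M| := by
    calc ∫ y, v y * (b y)⁻¹ ∂ν ≤ ∫ y, (v y ^ 2 + (b y)⁻¹ ^ 2) ∂ν :=
          integral_mono hvb (hv2.add hb2) fun y => by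
            simp only
            exact young _ _
      _ = H + ∫ y, (b y)⁻¹ ^ 2 ∂ν := integral_add hv2 hb2
      _ ≤ _ := by linarith [le_abs_self M]
  have hprod : Integrable (fun q : S × T => u q.1 ^ 3 * (v q.2 * (b q.2)⁻¹)) (μ.prod ν) :=
    hu3.mul_prod hvb
  have hku : ∀ q : S × T, k q.1 q.2 * (u q.1 ^ 2 * (b q.2)⁻¹) ≤ u q.1 ^ 3 * (v q.2 * (b q.2)⁻¹) :=
    fun q => by
      have h1 := hb0 q.2
      have h2 := hkuv q.1 q.2
      calc _ ≤ (u q.1 * v q.2) * (u q.1 ^ 2 * (b q.2)⁻¹) :=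
            mul_le_mul_of_nonneg_right h2 (by positivity)
        _ = _ := by ring
  have hubi' : Integrable (fun q : S × T => k q.1 q.2 * (u q.1 ^ 2 * (b q.2)⁻¹)) (μ.prod ν) := by
    refine hprod.mono' ?_ (Eventually.of_forall fun q => ?_)
    · exact (h.meas.mul (((hum.comp measurable_fst).pow_const 2).mul hbm'.inv)).aestronglyMeasurable
    · have h1 := hb0 q.2
      have := h.nn q.1 q.2
      rw [Real.norm_eq_abs, abs_of_nonneg (by positivity)]
      exact hku q
  have hubi : Integrable (fun q : S × T => u q.1 ^ 2 * (b q.2)⁻¹) (cpl μ ν k) :=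
    (h.integrable_iff _).2 hubi'
  have hub : ∫ q, u q.1 ^ 2 * (b q.2)⁻¹ ∂(cpl μ ν k) ≤ G3 * (H + |M|) := by
    rw [h.integral_eq]
    calc _ ≤ ∫ q, u q.1 ^ 3 * (v q.2 * (b q.2)⁻¹) ∂(μ.prod ν) := integral_mono hubi' hprod hku
      _ = G3 * ∫ y, v y * (b y)⁻¹ ∂ν :=
          integral_prod_mul (fun x => u x ^ 3) (fun y => v y * (b y)⁻¹)
      _ ≤ _ := mul_le_mul_of_nonneg_left hvbM hG30
  have keyf : (fun y => (b y - l) ^ 2 * (b y)⁻¹) = fun y => b y - (2 * l) * 1 + l ^ 2 * (b y)⁻¹ := by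
    funext y
    have := (hb0 y).ne'
    field_simp; ring
  have hwi : Integrable (fun y => (b y - l) ^ 2 * (b y)⁻¹) ν := by
    rw [keyf]
    exact (hbi.sub (integrable_const _)).add (hb1.const_mul _)
  have hwm : Measurable (fun y => (b y - l) ^ 2 * (b y)⁻¹) :=
    ((hbm.sub_const _).pow_const 2).mul hbm.inv
  have hfin : ∫ y, (b y - l) ^ 2 * (b y)⁻¹ ∂ν ≤ 2 * W + 2 * (N ^ 2 * (G3 * (H + |M|))) := by
    calc _ ≤ 2 * W + 2 * (N ^ 2 * ∫ q, u q.1 ^ 2 * (b q.2)⁻¹ ∂(cpl μ ν k)) := by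
          have j1 : Integrable (fun q : S × T => 2 * ((b q.2 - a q.1) ^ 2 * (b q.2)⁻¹))
            (cpl μ ν k) := hWi.const_mul 2
          have j2 : Integrable (fun q : S × T => 2 * (N ^ 2 * (u q.1 ^ 2 * (b q.2)⁻¹)))
            (cpl μ ν k) := (hubi.const_mul (N ^ 2)).const_mul 2
          have e2 : ∫ q : S × T, 2 * (N ^ 2 * (u q.1 ^ 2 * (b q.2)⁻¹)) ∂(cpl μ ν k) =
              2 * (N ^ 2 * ∫ q, u q.1 ^ 2 * (b q.2)⁻¹ ∂(cpl μ ν k)) := by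
            rw [integral_const_mul, integral_const_mul]
          have e3 : ∫ q : S × T, 2 * ((b q.2 - a q.1) ^ 2 * (b q.2)⁻¹) ∂(cpl μ ν k) = 2 * W := by
            rw [integral_const_mul]
          have j3 : Integrable (fun q : S × T => (b q.2 - l) ^ 2 * (b q.2)⁻¹) (cpl μ ν k) :=
            h.ii2 (f := fun y => (b y - l) ^ 2 * (b y)⁻¹) hwi
          have j4 : Integrable (fun q : S × T => 2 * ((b q.2 - a q.1) ^ 2 * (b q.2)⁻¹) +
            2 * (N ^ 2 * (u q.1 ^ 2 * (b q.2)⁻¹))) (cpl μ ν k) := j1.add j2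
          have j5 : ∀ q : S × T, (b q.2 - l) ^ 2 * (b q.2)⁻¹ ≤
              2 * ((b q.2 - a q.1) ^ 2 * (b q.2)⁻¹) + 2 * (N ^ 2 * (u q.1 ^ 2 * (b q.2)⁻¹)) := by
            intro q
            have h1 := hal q.1
            have h2 := hb0 q.2
            have h3 : (b q.2 - l) ^ 2 ≤ 2 * (b q.2 - a q.1) ^ 2 + 2 * (N ^ 2 * u q.1 ^ 2) := by
              have h7 := sqsum3 (b q.2) (a q.1) l
              linarith
            have h4 := mul_le_mul_of_nonneg_right h3 (inv_nonneg.2 h2.le)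
            linarith
          have e4 : ∫ y, (b y - l) ^ 2 * (b y)⁻¹ ∂ν =
              ∫ q : S × T, (b q.2 - l) ^ 2 * (b q.2)⁻¹ ∂(cpl μ ν k) :=
            (h.e2 (f := fun y => (b y - l) ^ 2 * (b y)⁻¹) hwm).symm
          rw [e4, ← e2, ← e3, ← integral_add j1 j2]
          exact integral_mono j3 j4 j5
      _ ≤ _ := by gcongr
  have hlow : ∫ y, b y ∂ν - (∫ y, (b y)⁻¹ ∂ν)⁻¹ ≤ ∫ y, (b y - l) ^ 2 * (b y)⁻¹ ∂ν := by
    rw [keyf, int3 hbi (integrable_const 1) (hb1.const_mul _), integral_const_mul]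
    have hI : 0 < ∫ y, (b y)⁻¹ ∂ν := by
      rw [integral_pos_iff_support_of_nonneg (fun y => (inv_pos.2 (hb0 y)).le) hb1]
      have : Function.support (fun y => (b y)⁻¹) = univ := by
        ext y; simpa using (hb0 y).ne'
      rw [this]; simp
    set I := ∫ y, (b y)⁻¹ ∂ν
    have : l ^ 2 * I - 2 * l + I⁻¹ = (l * I - 1) ^ 2 * I⁻¹ := by
      field_simp; ring
    have h2 : 0 ≤ (l * I - 1) ^ 2 * I⁻¹ := by positivity
    simp
    linarith
  have hW0 : 0 ≤ W := integral_nonneg fun q => by have := hb0 q.2; positivity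
  have hE : ∫ y, b y ∂ν - (∫ y, (b y)⁻¹ ∂ν)⁻¹ ≤ E2 * W := by
    have h0 : 0 ≤ G3 * (H + |M|) := by positivity
    have h1 : N ^ 2 ≤ E1 * (C * W) := hN2.trans (mul_le_mul_of_nonneg_left hSW hE10)
    have h2 := mul_le_mul_of_nonneg_right h1 h0
    rw [hE2]
    linarith
  calc _ ≤ (E2 * C ^ 2)⁻¹ * (E2 * (C ^ 2 *
        ∫ q, (b q.2 - a q.1) ^ 2 * (b q.2)⁻¹ * (a q.1)⁻¹ ^ 2 ∂(cpl μ ν k))) := by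
        refine mul_le_mul_of_nonneg_left (hE.trans ?_) (by positivity)
        exact mul_le_mul_of_nonneg_left hWg hE20.le
    _ = _ := by field_simp



lemma seq_decay (I J V : ℕ → ℝ) (κ : ℝ) (hκ : 0 < κ) (hI : ∀ n, 0 < I n)
    (hIJ : ∀ n, (I n)⁻¹ ≤ J n) (hdI : ∀ n, κ * (J n - (I n)⁻¹) ≤ I n - I (n + 1))
    (hdJ : ∀ n, J (n + 1) ≤ J n) (hV0 : ∀ n, 0 ≤ V n)
    (hV : ∀ n, V n ^ 2 ≤ (J n - J (n + 1)) * I (n + 1)) :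
    ∃ C ρ : ℝ, 0 < C ∧ 0 < ρ ∧ ρ < 1 ∧ ∀ n, V n ≤ C * ρ ^ n := by
  have hImono : ∀ n, I (n + 1) ≤ I n := fun n => by
    have := mul_nonneg hκ.le (sub_nonneg.2 (hIJ n))
    linarith [hdI n]
  have hI0 : ∀ n, I n ≤ I 0 := fun n => by
    induction n with
    | zero => exact le_rfl
    | succ n ih => exact (hImono n).trans ih
  set F : ℕ → ℝ := fun n => I n * (J n - (I n)⁻¹) with hF
  have hF0 : ∀ n, 0 ≤ F n := fun n => mul_nonneg (hI n).le (sub_nonneg.2 (hIJ n))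
  set θ := κ * (I 0)⁻¹ ^ 2 with hθ
  have hθ0 : 0 < θ := by have := hI 0; positivity
  set r := max (1 - θ) (1 / 2) with hr
  have hr0 : 0 < r := lt_max_of_lt_right (by norm_num)
  have hr1 : r < 1 := max_lt (by linarith) (by norm_num)
  have hstep : ∀ n, F (n + 1) ≤ r * F n := fun n => by
    have h1 : F (n + 1) ≤ (1 - θ) * F n := by
      have a1 : F (n + 1) = I (n + 1) * J (n + 1) - 1 := by
        have := (hI (n + 1)).ne'
        simp only [hF]; field_simp
      have a2 : F n = I n * J n - 1 := by
        have := (hI n).ne'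
        simp only [hF]; field_simp
      have hJn : 0 < J n := (inv_pos.2 (hI n)).trans_le (hIJ n)
      have a3 : I (n + 1) * J (n + 1) ≤ (I n - κ * (J n - (I n)⁻¹)) * J n := by
        have b1 : I (n + 1) * J (n + 1) ≤ I (n + 1) * J n :=
          mul_le_mul_of_nonneg_left (hdJ n) (hI _).le
        have b2 : I (n + 1) * J n ≤ (I n - κ * (J n - (I n)⁻¹)) * J n :=
          mul_le_mul_of_nonneg_right (by linarith [hdI n]) hJn.le
        linarith
      have a4 : θ * F n ≤ κ * (J n - (I n)⁻¹) * J n := by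
        have b1 : J n - (I n)⁻¹ = (I n)⁻¹ * F n := by
          have := (hI n).ne'
          simp only [hF]; field_simp
        have b2 : (I 0)⁻¹ ≤ (I n)⁻¹ := inv_anti₀ (hI n) (hI0 n)
        have b3 : (I 0)⁻¹ ^ 2 ≤ (I n)⁻¹ * J n := by
          have : 0 < (I 0)⁻¹ := inv_pos.2 (hI 0)
          rw [sq]
          exact mul_le_mul b2 (b2.trans (hIJ n)) this.le (this.le.trans b2)
        rw [b1, hθ]
        have := mul_le_mul_of_nonneg_left b3 (mul_nonneg hκ.le (hF0 n))
        linarith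
      linarith
    exact h1.trans (mul_le_mul_of_nonneg_right (le_max_left _ _) (hF0 n))
  have hFn : ∀ n, F n ≤ F 0 * r ^ n := fun n => by
    induction n with
    | zero => simp
    | succ n ih =>
      calc F (n + 1) ≤ r * F n := hstep n
        _ ≤ r * (F 0 * r ^ n) := mul_le_mul_of_nonneg_left ih hr0.le
        _ = _ := by ring
  have hVF : ∀ n, V n ^ 2 ≤ F n := fun n => by
    have h1 : (I n)⁻¹ ≤ (I (n + 1))⁻¹ := inv_anti₀ (hI _) (hImono n)
    have h2 : J n - J (n + 1) ≤ J n - (I n)⁻¹ := by linarith [hIJ (n + 1)]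
    calc V n ^ 2 ≤ (J n - J (n + 1)) * I (n + 1) := hV n
      _ ≤ (J n - (I n)⁻¹) * I n :=
          mul_le_mul h2 (hImono n) (hI _).le (sub_nonneg.2 (hIJ n))
      _ = F n := by simp only [hF]; ring
  refine ⟨√(F 0) + 1, √r, by positivity, by positivity, ?_, fun n => ?_⟩
  · rw [Real.sqrt_lt' one_pos]; simpa using hr1
  · have : V n ≤ √(F 0) * √r ^ n := by
      rw [← pow_le_pow_iff_left₀ (hV0 n) (by positivity) two_ne_zero]
      rw [mul_pow, Real.sq_sqrt (hF0 0), ← pow_mul, mul_comm n 2, pow_mul, Real.sq_sqrt hr0.le]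
      exact (hVF n).trans (hFn n)
    refine this.trans (mul_le_mul_of_nonneg_right (by linarith) (by positivity))

lemma int_inv_pos {b : T → ℝ} (hb0 : ∀ y, 0 < b y) (hb1 : Integrable b ν) : 0 < ∫ y, b y ∂ν := by
  rw [integral_pos_iff_support_of_nonneg (fun y => (hb0 y).le) hb1]
  have : Function.support b = univ := by
    ext y; simpa using (hb0 y).ne'
  rw [this]; simp

lemma inv_le_int {b : T → ℝ} (hb0 : ∀ y, 0 < b y) (hbi : Integrable b ν)
    (hb1 : Integrable (fun y => (b y)⁻¹) ν) : (∫ y, (b y)⁻¹ ∂ν)⁻¹ ≤ ∫ y, b y ∂ν := by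
  have hI : 0 < ∫ y, (b y)⁻¹ ∂ν := int_inv_pos (fun y => inv_pos.2 (hb0 y)) hb1
  set l := (∫ y, (b y)⁻¹ ∂ν)⁻¹ with hl
  have keyf : (fun y => (b y - l) ^ 2 * (b y)⁻¹) = fun y => b y - (2 * l) * 1 + l ^ 2 * (b y)⁻¹ := by
    funext y
    have := (hb0 y).ne'
    field_simp; ring
  have h0 : 0 ≤ ∫ y, (b y - l) ^ 2 * (b y)⁻¹ ∂ν :=
    integral_nonneg fun y => mul_nonneg (sq_nonneg _) (inv_pos.2 (hb0 y)).le
  rw [keyf, int3 hbi (integrable_const 1) (hb1.const_mul _), integral_const_mul] at h0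
  have h2 : l ^ 2 * ∫ y, (b y)⁻¹ ∂ν = l := by
    rw [hl]; field_simp
  rw [h2] at h0
  simp at h0
  linarith

lemma DS.converge (h : DS μ ν k) (a : ℕ → S → ℝ) (b : ℕ → T → ℝ) (C M κ : ℝ) (hκ : 0 < κ)
    (ha0 : ∀ n x, 0 < a n x) (hb0 : ∀ n y, 0 < b n y)
    (hab : ∀ n x, a n x = ∫ y, k x y * b n y ∂ν)
    (hba : ∀ n y, (b (n + 1) y)⁻¹ = ∫ x, k x y * (a n x)⁻¹ ∂μ)
    (hint : ∀ n y, Integrable (fun x => k x y * (a n x)⁻¹) μ)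
    (hbm : Measurable (b 0)) (hbC : ∀ y, b 0 y ≤ C)
    (hb2 : Integrable (fun y => (b 0 y)⁻¹ ^ 2) ν) (hbM : ∫ y, (b 0 y)⁻¹ ^ 2 ∂ν ≤ M)
    (hp : ∀ (b : T → ℝ) (a : S → ℝ), Measurable b → (∀ y, 0 < b y) →
      (∀ y, b y ≤ C) → (∀ x, 0 < a x) → (∀ x, a x = ∫ y, k x y * b y ∂ν) →
      Integrable (fun y => (b y)⁻¹ ^ 2) ν → ∫ y, (b y)⁻¹ ^ 2 ∂ν ≤ M →
      κ * (∫ y, b y ∂ν - (∫ y, (b y)⁻¹ ∂ν)⁻¹) ≤ ∫ y, (b y)⁻¹ ∂ν - ∫ x, (a x)⁻¹ ∂μ) :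
    ∃ C' ρ : ℝ, 0 < C' ∧ 0 < ρ ∧ ρ < 1 ∧ ∀ n,
      ∫ q, |b (n + 1) q.2 * (a n q.1)⁻¹ - 1| ∂(cpl μ ν k) ≤ C' * ρ ^ n := by
  have hP := h.prob
  have inv : ∀ n, Measurable (b n) ∧ (∀ y, b n y ≤ C) ∧ Integrable (fun y => (b n y)⁻¹ ^ 2) ν ∧
      ∫ y, (b n y)⁻¹ ^ 2 ∂ν ≤ M := fun n => by
    induction n with
    | zero => exact ⟨hbm, hbC, hb2, hbM⟩
    | succ n ih =>
      obtain ⟨i1, i2, i3, i4⟩ := ih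
      obtain ⟨j1, j2, j3, j4, -⟩ := h.step1 i1 (hb0 n) i2 (ha0 n) (hab n) i3
      obtain ⟨l1, l2, l3, l4, -⟩ := h.step2 j1 (ha0 n) j2 (hb0 (n + 1)) (hba n) j3 (hint n)
      exact ⟨l1, l2, l3, l4.trans (j4.trans i4)⟩
  have hbi : ∀ n, Integrable (b n) ν := fun n =>
    integrable_of_bdd (inv n).1 C fun y => by rw [abs_of_pos (hb0 n y)]; exact (inv n).2.1 y
  have hbi1 : ∀ n, Integrable (fun y => (b n y)⁻¹) ν := fun n =>
    integrable_of_sq (inv n).1.inv (inv n).2.2.1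
  refine seq_decay (fun n => ∫ y, (b n y)⁻¹ ∂ν) (fun n => ∫ y, b n y ∂ν) _ κ hκ
    (fun n => int_inv_pos (fun y => inv_pos.2 (hb0 n y)) (hbi1 n))
    (fun n => inv_le_int (hb0 n) (hbi n) (hbi1 n)) (fun n => ?_) (fun n => ?_)
    (fun n => integral_nonneg fun q => abs_nonneg _) (fun n => ?_)
  all_goals
    obtain ⟨i1, i2, i3, i4⟩ := inv n
    obtain ⟨j1, j2, j3, j4, j5, -⟩ := h.step1 i1 (hb0 n) i2 (ha0 n) (hab n) i3
    obtain ⟨l1, l2, l3, l4, l5, l6, l7⟩ :=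
      h.step2 j1 (ha0 n) j2 (hb0 (n + 1)) (hba n) j3 (hint n)
  · rw [l5]
    exact hp (b n) (a n) i1 (hb0 n) i2 (ha0 n) (hab n) i3 i4
  · have : 0 ≤ ∫ q, (b (n + 1) q.2 - a n q.1) ^ 2 * (a n q.1)⁻¹ ∂(cpl μ ν k) :=
      integral_nonneg fun q => mul_nonneg (sq_nonneg _) (inv_pos.2 (ha0 n q.1)).le
    linarith
  · have hai : Integrable (fun x => (a n x)⁻¹) μ := integrable_of_sq j1.inv j3
    have am : Measurable (fun q : S × T => a n q.1) := j1.comp measurable_fst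
    have bm : Measurable (fun q : S × T => b (n + 1) q.2) := l1.comp measurable_snd
    have e1 : (fun q : S × T => (|b (n + 1) q.2 - a n q.1| * √(a n q.1)⁻¹) ^ 2) =
        fun q => (b (n + 1) q.2 - a n q.1) ^ 2 * (a n q.1)⁻¹ := by
      funext q
      rw [mul_pow, sq_abs, Real.sq_sqrt (inv_pos.2 (ha0 n q.1)).le]
    have e2 : (fun q : S × T => √(a n q.1)⁻¹ ^ 2) = fun q => (a n q.1)⁻¹ := by
      funext q
      rw [Real.sq_sqrt (inv_pos.2 (ha0 n q.1)).le]
    have e3 : (fun q : S × T => |b (n + 1) q.2 * (a n q.1)⁻¹ - 1|) =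
        fun q => |b (n + 1) q.2 - a n q.1| * √(a n q.1)⁻¹ * √(a n q.1)⁻¹ := by
      funext q
      have h1 := ha0 n q.1
      rw [mul_assoc, Real.mul_self_sqrt (inv_pos.2 h1).le]
      conv_rhs => rw [← abs_of_pos (inv_pos.2 h1), ← abs_mul]
      congr 1
      field_simp
    have := cs (P := cpl μ ν k) (f := fun q => |b (n + 1) q.2 - a n q.1| * √(a n q.1)⁻¹)
      (g := fun q => √(a n q.1)⁻¹) ((bm.sub am).abs.mul am.inv.sqrt) am.inv.sqrt
      (fun q => by positivity) (fun q => by positivity) (by rw [e1]; exact l6)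
      (by rw [e2]; exact h.ii1 hai)
    rw [e1, e2, l7, h.e1 (f := fun x => (a n x)⁻¹) j1.inv, j5, ← l5] at this
    rw [e3]
    exact this


end Core


section Ana

variable {Z : Type*} [MeasurableSpace Z] [MetricSpace Z] [BorelSpace Z]

lemma expmom (ρ : Measure Z) [IsProbabilityMeasure ρ] (x₀ : Z) (p δ : ℝ) (hp : 0 < p) (hδ : 0 < δ)
    (ht : ∀ᶠ r : ℝ in atTop, (ρ ((closedBall x₀ r)ᶜ)).toReal ≤ Real.exp (-r ^ (p + δ)))
    (κ : ℝ) (hκ : 0 < κ) : Integrable (fun x => Real.exp (κ * dist x x₀ ^ p)) ρ := by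
  have hfm : Measurable (fun x => Real.exp (κ * dist x x₀ ^ p)) :=
    (((continuous_id.dist continuous_const).measurable.pow_const p).const_mul κ).exp
  have hrt : Tendsto (fun t : ℝ => (Real.log t / κ) ^ (1 / p)) atTop atTop :=
    (tendsto_rpow_atTop (by positivity)).comp (Real.tendsto_log_atTop.atTop_div_const hκ)
  have hev : ∀ᶠ t : ℝ in atTop, ρ {x | t < Real.exp (κ * dist x x₀ ^ p)} ≤
      ENNReal.ofReal (t ^ (-2 : ℝ)) := by
    have h1 := hrt.eventually ht
    have h2 := hrt.eventually ((tendsto_rpow_atTop hδ).eventually_ge_atTop (2 * κ))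
    have h3 := hrt.eventually (eventually_gt_atTop 0)
    filter_upwards [h1, h2, h3, eventually_gt_atTop 1] with t h1 h2 h3 h4
    set r := (Real.log t / κ) ^ (1 / p) with hr
    have hlog : 0 < Real.log t := Real.log_pos h4
    have hrp : r ^ p = Real.log t / κ := by
      rw [hr, ← Real.rpow_mul (by positivity), one_div_mul_cancel hp.ne', Real.rpow_one]
    have hsub : {x | t < Real.exp (κ * dist x x₀ ^ p)} ⊆ (closedBall x₀ r)ᶜ := by
      intro x hx hxr
      simp only [mem_ofPred_eq, mem_closedBall] at hx hxr
      have h5 : Real.log t < κ * dist x x₀ ^ p := (Real.log_lt_iff_lt_exp (by linarith)).2 hx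
      have h6 : dist x x₀ ^ p ≤ r ^ p := Real.rpow_le_rpow dist_nonneg hxr hp.le
      rw [hrp, le_div_iff₀ hκ] at h6
      linarith
    refine (measure_mono hsub).trans ?_
    rw [← ENNReal.ofReal_toReal (measure_ne_top ρ (closedBall x₀ r)ᶜ)]
    refine ENNReal.ofReal_le_ofReal (h1.trans ?_)
    rw [Real.rpow_def_of_pos (by linarith : (0 : ℝ) < t), Real.exp_le_exp, Real.rpow_add h3, hrp]
    have : Real.log t / κ * (2 * κ) ≤ Real.log t / κ * r ^ δ :=
      mul_le_mul_of_nonneg_left h2 (by positivity)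
    have e : Real.log t / κ * (2 * κ) = 2 * Real.log t := by field_simp
    linarith
  obtain ⟨T₀, hT₀⟩ := eventually_atTop.1 hev
  set T := max T₀ 1 with hT
  have hT1 : 0 < T := lt_of_lt_of_le one_pos (le_max_right _ _)
  refine ⟨hfm.aestronglyMeasurable, ?_⟩
  rw [hasFiniteIntegral_iff_ofReal (Eventually.of_forall fun x => (Real.exp_pos _).le),
    lintegral_eq_lintegral_meas_lt ρ (Eventually.of_forall fun x => (Real.exp_pos _).le)
      hfm.aemeasurable, ← Ioc_union_Ioi_eq_Ioi hT1.le]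
  refine (lintegral_union_le _ _ _).trans_lt (ENNReal.add_lt_top.2 ⟨?_, ?_⟩)
  · calc ∫⁻ t in Ioc 0 T, ρ {x | t < Real.exp (κ * dist x x₀ ^ p)} ≤ ∫⁻ t in Ioc 0 T, 1 :=
          lintegral_mono fun t => prob_le_one
      _ < ⊤ := by simp
  · have hi := (integrableOn_Ioi_rpow_of_lt (a := -2) (by norm_num) hT1)
    calc ∫⁻ t in Ioi T, ρ {x | t < Real.exp (κ * dist x x₀ ^ p)} ≤
          ∫⁻ t in Ioi T, ENNReal.ofReal (t ^ (-2 : ℝ)) :=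
          setLIntegral_mono' measurableSet_Ioi fun t ht =>
            hT₀ t ((le_max_left _ _).trans (le_of_lt ht))
      _ < ⊤ := hi.lintegral_lt_top

lemma exists_ball (ρ : Measure Z) [IsProbabilityMeasure ρ] (x₀ : Z) :
    ∀ᶠ n : ℕ in atTop, ρ (closedBall x₀ (n : ℝ)) ≠ 0 := by
  have hm : Monotone (fun n : ℕ => closedBall x₀ (n : ℝ)) := fun i j hij =>
    closedBall_subset_closedBall (by exact_mod_cast hij)
  have h := tendsto_measure_iUnion_atTop (μ := ρ) hm
  rw [iUnion_closedBall_nat, measure_univ] at h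
  exact h.eventually_ne one_ne_zero

lemma tail_small (ρ : Measure Z) (x₀ : Z) {f : Z → ℝ} (hf : Integrable f ρ) :
    Tendsto (fun n : ℕ => ∫ x in (closedBall x₀ (n : ℝ))ᶜ, f x ∂ρ) atTop (𝓝 0) := by
  have h := tendsto_setIntegral_of_antitone (μ := ρ) (f := f)
    (s := fun n : ℕ => (closedBall x₀ (n : ℝ))ᶜ) (fun n => measurableSet_closedBall.compl)
    (fun i j hij => compl_subset_compl.2 (closedBall_subset_closedBall (by exact_mod_cast hij)))
    ⟨0, hf.integrableOn⟩
  have e : ⋂ n : ℕ, (closedBall x₀ (n : ℝ))ᶜ = ∅ := by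
    rw [← compl_iUnion, iUnion_closedBall_nat, compl_univ]
  rw [e] at h
  simpa using h

lemma upper (ν : Measure Z) [IsProbabilityMeasure ν] (x₀ : Z) (c : Z → Z → ℝ)
    (hcm : Measurable (Function.uncurry c))
    (ε : ℝ) (hε : 0 < ε) (p : ℝ) (hp : 0 < p) (R₀ : ℝ)
    (hc : ∀ r, R₀ ≤ r → ∀ x ∈ closedBall x₀ r, ∀ y ∈ closedBall x₀ r, c x y ≤ ε * r ^ p)
    (u v : Z → ℝ) (hv0 : ∀ y, 0 < v y) (hvm : Measurable v)
    (hi : ∀ x, Integrable (fun y => Real.exp (-c x y / ε) * v y) ν)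
    (huv : ∀ x, u x = (∫ y, Real.exp (-c x y / ε) * v y ∂ν)⁻¹) :
    ∃ D : ℝ, 0 < D ∧ ∀ x, u x ≤ D * Real.exp (dist x x₀ ^ p) := by
  obtain ⟨n, hn1, hn2, hn3⟩ := ((exists_ball ν x₀).and ((tendsto_natCast_atTop_atTop (R := ℝ)
    |>.eventually_ge_atTop R₀).and (tendsto_natCast_atTop_atTop (R := ℝ)
    |>.eventually_ge_atTop 1))).exists
  set R : ℝ := (n : ℝ) with hR
  have hmm : Measurable (fun y => min (v y) 1) := hvm.min measurable_const
  have hmi : Integrable (fun y => min (v y) 1) ν := integrable_of_bdd hmm 1 fun y => by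
    rw [abs_of_pos (lt_min (hv0 y) one_pos)]; exact min_le_right _ _
  set β := ∫ y in closedBall x₀ R, min (v y) 1 ∂ν with hβ
  have hβ0 : 0 < β := by
    rw [hβ, setIntegral_pos_iff_support_of_nonneg_ae
      (Eventually.of_forall fun y => (lt_min (hv0 y) one_pos).le) hmi.integrableOn]
    have : Function.support (fun y => min (v y) 1) = univ := by
      ext y; simpa using (lt_min (hv0 y) one_pos).ne'
    rw [this, univ_inter]
    exact pos_iff_ne_zero.2 hn1
  refine ⟨β⁻¹ * Real.exp (R ^ p), by positivity, fun x => ?_⟩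
  set E := Real.exp (-(dist x x₀ ^ p + R ^ p)) with hE
  have hK : ∀ y ∈ closedBall x₀ R, E ≤ Real.exp (-c x y / ε) := fun y hy => by
    rw [hE, Real.exp_le_exp, neg_div, neg_le_neg_iff, div_le_iff₀ hε]
    have h1 := hc (max (dist x x₀) R) (hn2.trans (le_max_right _ _)) x
      (mem_closedBall.2 (le_max_left _ _)) y
      (mem_closedBall.2 ((mem_closedBall.1 hy).trans (le_max_right _ _)))
    refine h1.trans ?_
    rw [mul_comm]
    refine mul_le_mul_of_nonneg_right ?_ hε.le
    have p1 : 0 ≤ dist x x₀ ^ p := Real.rpow_nonneg dist_nonneg p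
    have p2 : 0 ≤ R ^ p := Real.rpow_nonneg (by positivity) p
    rcases max_cases (dist x x₀) R with h | h <;> rw [h.1] <;> linarith
  have hlow : E * β ≤ ∫ y, Real.exp (-c x y / ε) * v y ∂ν := by
    rw [hβ, ← integral_const_mul]
    calc ∫ y in closedBall x₀ R, E * min (v y) 1 ∂ν ≤
          ∫ y in closedBall x₀ R, Real.exp (-c x y / ε) * v y ∂ν := by
          refine setIntegral_mono_on (hmi.const_mul E).integrableOn (hi x).integrableOn
            measurableSet_closedBall fun y hy => ?_
          exact mul_le_mul (hK y hy) (min_le_left _ _) (lt_min (hv0 y) one_pos).le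
            (Real.exp_pos _).le
      _ ≤ _ := setIntegral_le_integral (hi x)
          (Eventually.of_forall fun y => mul_nonneg (Real.exp_pos _).le (hv0 y).le)
  have hEp : 0 < E := Real.exp_pos _
  rw [huv]
  calc _ ≤ (E * β)⁻¹ := inv_anti₀ (by positivity) hlow
    _ = _ := by
      rw [hE, mul_inv, ← Real.exp_neg, neg_neg, Real.exp_add]; ring

lemma cube_int (ρ : Measure Z) [IsProbabilityMeasure ρ] (x₀ : Z) (p δ : ℝ) (hp : 0 < p) (hδ : 0 < δ)
    (ht : ∀ᶠ r : ℝ in atTop, (ρ ((closedBall x₀ r)ᶜ)).toReal ≤ Real.exp (-r ^ (p + δ)))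
    {u : Z → ℝ} (hum : Measurable u) (hu0 : ∀ x, 0 < u x) {D : ℝ}
    (hD : ∀ x, u x ≤ D * Real.exp (dist x x₀ ^ p)) :
    Integrable (fun x => u x ^ 3) ρ ∧ Integrable (fun x => u x ^ 2) ρ ∧ Integrable u ρ := by
  have h3 : Integrable (fun x => u x ^ 3) ρ := by
    refine ((expmom ρ x₀ p δ hp hδ ht 3 (by norm_num)).const_mul (D ^ 3)).mono'
      (hum.pow_const 3).aestronglyMeasurable (Eventually.of_forall fun x => ?_)
    have := hu0 x
    rw [Real.norm_eq_abs, abs_of_nonneg (by positivity)]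
    calc u x ^ 3 ≤ (D * Real.exp (dist x x₀ ^ p)) ^ 3 := pow_le_pow_left₀ this.le (hD x) 3
      _ = _ := by rw [mul_pow, ← Real.exp_nat_mul]; norm_num
  have h2 : Integrable (fun x => u x ^ 2) ρ := by
    refine (h3.add (integrable_const 1)).mono' (hum.pow_const 2).aestronglyMeasurable
      (Eventually.of_forall fun x => ?_)
    have := hu0 x
    rw [Real.norm_eq_abs, abs_of_nonneg (by positivity), Pi.add_apply]
    rcases le_total (u x) 1 with h | h
    · have : u x ^ 2 ≤ 1 := pow_le_one₀ this.le h
      have : 0 ≤ u x ^ 3 := by positivity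
      linarith
    · have : u x ^ 2 ≤ u x ^ 3 := pow_le_pow_right₀ h (by norm_num)
      linarith
  exact ⟨h3, h2, integrable_of_sq hum h2⟩

lemma schr_meas (ν : Measure Z) [IsProbabilityMeasure ν] (x₀ : Z) (c : Z → Z → ℝ)
    (hcm : Measurable (Function.uncurry c)) (ε : ℝ)
    (u v : Z → ℝ) (hi : ∀ x, Integrable (fun y => Real.exp (-c x y / ε) * v y) ν)
    (huv : ∀ x, u x = (∫ y, Real.exp (-c x y / ε) * v y ∂ν)⁻¹) : Measurable u := by
  have hKm : Measurable (fun q : Z × Z => Real.exp (-c q.1 q.2 / ε)) :=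
    (hcm.neg.div_const ε).exp
  have hv : AEStronglyMeasurable v ν := by
    have h1 : Measurable (fun y => Real.exp (-c x₀ y / ε)) := hKm.comp measurable_prodMk_left
    have h2 := h1.inv.aestronglyMeasurable (μ := ν) |>.mul (hi x₀).aestronglyMeasurable
    refine h2.congr (Eventually.of_forall fun y => ?_)
    have := (Real.exp_pos (-c x₀ y / ε)).ne'
    simp only [Pi.mul_apply, Pi.inv_apply]
    field_simp
  obtain ⟨w, hw, hvw⟩ := hv
  have e : u = fun x => (∫ y, Real.exp (-c x y / ε) * w y ∂ν)⁻¹ := by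
    funext x
    rw [huv]
    congr 1
    refine integral_congr_ae ?_
    filter_upwards [hvw] with y hy
    rw [hy]
  rw [e]
  have : StronglyMeasurable (Function.uncurry fun x y => Real.exp (-c x y / ε) * w y) :=
    (hKm.mul (hw.measurable.comp measurable_snd)).stronglyMeasurable
  exact this.integral_prod_right.measurable.inv

lemma lower (ν : Measure Z) [IsProbabilityMeasure ν] (c : Z → Z → ℝ) (ε : ℝ) (hε : 0 < ε)
    (hc0 : ∀ x y, 0 ≤ c x y)
    (u v : Z → ℝ) (hu0 : ∀ x, 0 < u x) (hv0 : ∀ y, 0 < v y) (hvi : Integrable v ν)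
    (hi : ∀ x, Integrable (fun y => Real.exp (-c x y / ε) * v y) ν)
    (huv : ∀ x, u x = (∫ y, Real.exp (-c x y / ε) * v y ∂ν)⁻¹) (x : Z) :
    (u x)⁻¹ ≤ ∫ y, v y ∂ν := by
  rw [huv, inv_inv]
  refine integral_mono (hi x) hvi fun y => ?_
  have : Real.exp (-c x y / ε) ≤ 1 :=
    Real.exp_le_one_iff.2 (div_nonpos_of_nonpos_of_nonneg (by linarith [hc0 x y]) hε.le)
  exact mul_le_of_le_one_left (hv0 y).le this

end Ana

theorem statement19 (μ ν : Measure X) [IsProbabilityMeasure μ] [IsProbabilityMeasure ν]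
    (x₀ : X) (c : X → X → ℝ) (hcmeas : Measurable (Function.uncurry c))
    (hcnn : ∀ x y, 0 ≤ c x y)
    (hcint : Integrable (fun q : X × X => c q.1 q.2) (μ.prod ν))
    (ε : ℝ) (hε : 0 < ε) (p δ : ℝ) (hp : 0 < p) (hδ : 0 < δ)
    (hcbdd : ∀ r : ℝ,
      BddAbove {v : ℝ | ∃ x ∈ closedBall x₀ r, ∃ y ∈ closedBall x₀ r, v = c x y})
    (hclim : Tendsto (fun r : ℝ =>
        sSup {v : ℝ | ∃ x ∈ closedBall x₀ r, ∃ y ∈ closedBall x₀ r, v = c x y} / r ^ p)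
      atTop (𝓝 0))
    (htaillim : Tendsto (fun r : ℝ =>
        max (μ ((closedBall x₀ r)ᶜ)).toReal (ν ((closedBall x₀ r)ᶜ)).toReal
          / Real.exp (-r ^ (p + δ))) atTop (𝓝 0))
    (g1s g2s : X → ℝ) (hg1spos : ∀ x, 0 < g1s x) (hg2spos : ∀ y, 0 < g2s y)
    (hschr1 : ∀ x, g1s x = (∫ y, Real.exp (-c x y / ε) * g2s y ∂ν)⁻¹)
    (hschr2 : ∀ y, g2s y = (∫ x, Real.exp (-c x y / ε) * g1s x ∂μ)⁻¹)
    (g1 g2 : ℕ → X → ℝ)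
    (hg10 : ∀ x, g1 0 x = 1) (hg20 : ∀ x, g2 0 x = 1)
    (hrec1 : ∀ n x, g1 (n + 1) x = (∫ y, Real.exp (-c x y / ε) * g2 n y ∂ν)⁻¹)
    (hrec2 : ∀ n y, g2 (n + 1) y = (∫ x, Real.exp (-c x y / ε) * g1 (n + 1) x ∂μ)⁻¹)
    (hwell1 : ∀ n x, Integrable (fun y => Real.exp (-c x y / ε) * g2 n y) ν ∧
      0 < ∫ y, Real.exp (-c x y / ε) * g2 n y ∂ν)
    (hwell2 : ∀ n y, Integrable (fun x => Real.exp (-c x y / ε) * g1 (n + 1) x) μ ∧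
      0 < ∫ x, Real.exp (-c x y / ε) * g1 (n + 1) x ∂μ) :
    ∃ C : ℝ, 0 < C ∧ ∃ ρ : ℝ, 0 < ρ ∧ ρ < 1 ∧ ∀ n : ℕ,
      ∫ q, |g1 n q.1 * g2 n q.2 - g1s q.1 * g2s q.2| * Real.exp (-c q.1 q.2 / ε) ∂(μ.prod ν)
        ≤ C * ρ ^ n := by
  have hi1 : ∀ x, Integrable (fun y => Real.exp (-c x y / ε) * g2s y) ν := fun x => by
    by_contra h
    have := hg1spos x
    rw [hschr1 x, integral_undef h] at this
    simp at this
  have hi2 : ∀ y, Integrable (fun x => Real.exp (-c x y / ε) * g1s x) μ := fun y => by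
    by_contra h
    have := hg2spos y
    rw [hschr2 y, integral_undef h] at this
    simp at this
  have hcs : Measurable (Function.uncurry (fun y x => c x y)) := hcmeas.comp measurable_swap
  have hm1 : Measurable g1s := schr_meas ν x₀ c hcmeas ε g1s g2s hi1 hschr1
  have hm2 : Measurable g2s := schr_meas μ x₀ (fun y x => c x y) hcs ε g2s g1s hi2 hschr2
  obtain ⟨R₀, hR₀⟩ : ∃ R₀ : ℝ, ∀ r, R₀ ≤ r → ∀ x ∈ closedBall x₀ r, ∀ y ∈ closedBall x₀ r,
      c x y ≤ ε * r ^ p := by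
    have h1 := (hclim.eventually_lt_const hε).and (eventually_gt_atTop (0 : ℝ))
    obtain ⟨R₀, h2⟩ := eventually_atTop.1 h1
    refine ⟨R₀, fun r hr x hx y hy => ?_⟩
    obtain ⟨h3, h4⟩ := h2 r hr
    rw [div_lt_iff₀ (Real.rpow_pos_of_pos h4 p)] at h3
    exact (le_csSup (hcbdd r) ⟨x, hx, y, hy, rfl⟩).trans h3.le
  have htail : ∀ᶠ r : ℝ in atTop,
      max (μ ((closedBall x₀ r)ᶜ)).toReal (ν ((closedBall x₀ r)ᶜ)).toReal
        ≤ Real.exp (-r ^ (p + δ)) := by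
    filter_upwards [htaillim.eventually_lt_const one_pos] with r hr
    rw [div_lt_iff₀ (Real.exp_pos _), one_mul] at hr
    exact hr.le
  have ht1 := htail.mono fun r h => (le_max_left _ _).trans h
  have ht2 := htail.mono fun r h => (le_max_right _ _).trans h
  obtain ⟨D1, -, hD1⟩ := upper ν x₀ c hcmeas ε hε p hp R₀ hR₀ g1s g2s hg2spos hm2 hi1 hschr1
  obtain ⟨D2, -, hD2⟩ := upper μ x₀ (fun y x => c x y) hcs ε hε p hp R₀
    (fun r hr x hx y hy => hR₀ r hr y hy x hx) g2s g1s hg1spos hm1 hi2 hschr2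
  obtain ⟨i13, i12, i11⟩ := cube_int μ x₀ p δ hp hδ ht1 hm1 hg1spos hD1
  obtain ⟨i23, i22, i21⟩ := cube_int ν x₀ p δ hp hδ ht2 hm2 hg2spos hD2
  have l1 := lower ν c ε hε hcnn g1s g2s hg1spos hg2spos i21 hi1 hschr1
  have l2 := lower μ (fun y x => c x y) ε hε (fun y x => hcnn x y) g2s g1s hg2spos hg1spos i11
    hi2 hschr2
  have I1 : 0 < ∫ x, g1s x ∂μ := int_inv_pos hg1spos i11
  have I2 : 0 < ∫ y, g2s y ∂ν := int_inv_pos hg2spos i21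
  set k : X → X → ℝ := fun x y => g1s x * g2s y * Real.exp (-c x y / ε) with hkdef
  have hKm : Measurable (fun q : X × X => Real.exp (-c q.1 q.2 / ε)) :=
    (hcmeas.neg.div_const ε).exp
  have hDS : DS μ ν k :=
    { meas := ((hm1.comp measurable_fst).mul (hm2.comp measurable_snd)).mul hKm
      nn := fun x y => by
        have := hg1spos x
        have := hg2spos y
        simp only [hkdef]
        positivity
      one1 := fun x => by
        have e : (fun y => k x y) = fun y => g1s x * (Real.exp (-c x y / ε) * g2s y) := by
          funext y; simp only [hkdef]; ring
        have h0 := (hg1spos x).ne'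
        rw [e, integral_const_mul]
        have h1 := hschr1 x
        rw [h1] at h0 ⊢
        exact inv_mul_cancel₀ (fun hz => h0 (by rw [hz, inv_zero]))
      one2 := fun y => by
        have e : (fun x => k x y) = fun x => g2s y * (Real.exp (-c x y / ε) * g1s x) := by
          funext x; simp only [hkdef]; ring
        have h0 := (hg2spos y).ne'
        rw [e, integral_const_mul]
        have h1 := hschr2 y
        rw [h1] at h0 ⊢
        exact inv_mul_cancel₀ (fun hz => h0 (by rw [hz, inv_zero])) }
  have hkuv : ∀ x y, k x y ≤ g1s x * g2s y := fun x y => by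
    have h1 : Real.exp (-c x y / ε) ≤ 1 := Real.exp_le_one_iff.2
      (div_nonpos_of_nonpos_of_nonneg (by linarith [hcnn x y]) hε.le)
    exact mul_le_of_le_one_right (mul_pos (hg1spos x) (hg2spos y)).le h1
  have hts := ((tail_small ν x₀ i22).const_mul 8).mul_const (∫ x, g1s x ^ 2 ∂μ)
  rw [mul_zero, zero_mul] at hts
  obtain ⟨n, hn1, hn2⟩ := ((exists_ball μ x₀).and (hts.eventually_lt_const one_pos)).exists
  set Sn := sSup {v : ℝ | ∃ x ∈ closedBall x₀ (n : ℝ), ∃ y ∈ closedBall x₀ (n : ℝ), v = c x y}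
    with hSn
  have hk : ∀ x ∈ closedBall x₀ (n : ℝ), ∀ y ∈ closedBall x₀ (n : ℝ),
      (∫ y, g2s y ∂ν)⁻¹ * (∫ x, g1s x ∂μ)⁻¹ * Real.exp (-Sn / ε) ≤ k x y := by
    intro x hx y hy
    have h1 : c x y ≤ Sn := le_csSup (hcbdd n) ⟨x, hx, y, hy, rfl⟩
    have h2 : Real.exp (-Sn / ε) ≤ Real.exp (-c x y / ε) := by
      rw [Real.exp_le_exp]
      exact div_le_div_of_nonneg_right (by linarith) hε.le
    have h3 := inv_le_of_inv_le₀ (hg1spos x) (l1 x)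
    have h4 := inv_le_of_inv_le₀ (hg2spos y) (l2 y)
    have := hg1spos x
    have := hg2spos y
    simp only [hkdef]
    gcongr
  obtain ⟨κ, hκ, hpo⟩ := hDS.poincare hm1 hm2 hg1spos hg2spos hkuv i12 i13 i22
    (measurableSet_closedBall (x := x₀) (ε := (n : ℝ))) hn1 (by positivity) hk hn2.le
    (∫ x, g1s x ∂μ) (∫ y, g2s y ^ 2 ∂ν) I1
  have hg1p : ∀ n x, 0 < g1 (n + 1) x := fun n x => by
    rw [hrec1]; exact inv_pos.2 (hwell1 n x).2
  have hg2p : ∀ n x, 0 < g2 n x := fun n x => by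
    cases n with
    | zero => rw [hg20]; exact one_pos
    | succ n => rw [hrec2]; exact inv_pos.2 (hwell2 n x).2
  have e0 : (fun y => (g2 0 y / g2s y)⁻¹ ^ 2) = fun y => g2s y ^ 2 := by
    funext y; rw [hg20, one_div, inv_inv]
  have ek : ∀ n y, (fun x => k x y * (g1s x / g1 (n + 1) x)⁻¹) =
      fun x => g2s y * (Real.exp (-c x y / ε) * g1 (n + 1) x) := fun n y => by
    funext x
    have := (hg1spos x).ne'
    have := (hg1p n x).ne'
    simp only [hkdef]
    field_simp
  obtain ⟨C', ρ, hC', hρ0, hρ1, hconv⟩ := hDS.converge (fun n x => g1s x / g1 (n + 1) x)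
    (fun n y => g2 n y / g2s y) (∫ x, g1s x ∂μ) (∫ y, g2s y ^ 2 ∂ν) κ hκ
    (fun n x => div_pos (hg1spos x) (hg1p n x)) (fun n y => div_pos (hg2p n y) (hg2spos y))
    (fun n x => by
      have e : (fun y => k x y * (g2 n y / g2s y)) =
          fun y => g1s x * (Real.exp (-c x y / ε) * g2 n y) := by
        funext y
        have := (hg2spos y).ne'
        simp only [hkdef]
        field_simp
      rw [e, integral_const_mul, hrec1, div_inv_eq_mul])
    (fun n y => by
      rw [ek, integral_const_mul, hrec2, inv_div, div_inv_eq_mul])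
    (fun n y => by rw [ek]; exact (hwell2 n y).1.const_mul _)
    (by
      have : (fun y => g2 0 y / g2s y) = fun y => (g2s y)⁻¹ := by
        funext y; rw [hg20, one_div]
      rw [this]; exact hm2.inv)
    (fun y => by rw [hg20, one_div]; exact l2 y)
    (by rw [e0]; exact i22) (by rw [e0]) hpo
  set TV : ℕ → ℝ := fun n => ∫ q, |g1 n q.1 * g2 n q.2 - g1s q.1 * g2s q.2| *
    Real.exp (-c q.1 q.2 / ε) ∂(μ.prod ν) with hTV
  have hstep : ∀ n, TV (n + 1) ≤ C' * ρ ^ n := fun n => by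
    refine le_of_eq_of_le ?_ (hconv n)
    rw [hDS.integral_eq]
    refine integral_congr_ae (Eventually.of_forall fun q => ?_)
    have h1 := hg1spos q.1
    have h2 := hg2spos q.2
    have h3 := (hg1p n q.1).ne'
    have e : g1 (n + 1) q.1 * g2 (n + 1) q.2 - g1s q.1 * g2s q.2 = (g1s q.1 * g2s q.2) *
        (g2 (n + 1) q.2 / g2s q.2 * (g1s q.1 / g1 (n + 1) q.1)⁻¹ - 1) := by
      field_simp
    simp only [hkdef]
    rw [e, abs_mul, abs_of_pos (mul_pos h1 h2)]
    ring
  refine ⟨|TV 0| + C' / ρ, by positivity, ρ, hρ0, hρ1, fun n => ?_⟩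
  change TV n ≤ _
  have hCρ : 0 < C' / ρ := by positivity
  cases n with
  | zero =>
    rw [pow_zero, mul_one]
    linarith [le_abs_self (TV 0)]
  | succ n =>
    refine (hstep n).trans ?_
    have e : C' * ρ ^ n = C' / ρ * ρ ^ (n + 1) := by
      rw [pow_succ]; field_simp
    rw [e]
    refine mul_le_mul_of_nonneg_right ?_ (by positivity)
    linarith [abs_nonneg (TV 0)]

end Paper
end
end
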